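/- Fix an integer k ≥ 1 and assume (A)–(D). Then the system (S) admits a sequence (u_{1,l},…,u_{N,l}), l ∈ ℕ, of classical solutions, each component u_{i,l} being nodal (taking both positive and negative values in Ω), the sequence being unbounded in the sense that sup_l Σ_{j=1}^N ∫_Ω (|∇u_{j,l}|² + u_{j,l}²) dx = ∞, and such that each u_{i,l} is 𝓡_{2π/k}-invariant but not 𝓡_{2π/(2k)}-invariant; in particular every u_{i,l} is non-radial. -/

import Mathlib

noncomputable section

open Real MeasureTheory Finset

abbrev Euc (n : ℕ) := EuclideanSpace ℝ (Fin n)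

/-- The rotation `R_θ` by angle `θ` in the `(x₁,x₂)`-plane (fixing remaining coordinates). -/
def rotPt {n : ℕ} (θ : ℝ) (x : Euc n) : Euc n :=
  WithLp.toLp 2 fun i : Fin n => if (i : ℕ) = 0 then Real.cos θ * x i - Real.sin θ * x ⟨1 % n, Nat.mod_lt 1 i.pos⟩
    else if (i : ℕ) = 1 then Real.sin θ * x ⟨0, i.pos⟩ + Real.cos θ * x i
    else x i

/-- `u` is `𝓡_θ`-invariant on `Ω`, i.e. `u (R_{-θ} x) = u x` on `Ω`. -/
def RotInv {n : ℕ} (θ : ℝ) (Ω : Set (Euc n)) (u : Euc n → ℝ) : Prop :=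
  ∀ x ∈ Ω, u (rotPt (-θ) x) = u x

def IsRadialFn {n : ℕ} (Ω : Set (Euc n)) (u : Euc n → ℝ) : Prop :=
  ∀ x ∈ Ω, ∀ y ∈ Ω, ‖x‖ = ‖y‖ → u x = u y

/-- `Ω` is an open ball or an open annulus centered at the origin. -/
def RadialDomain {n : ℕ} (Ω : Set (Euc n)) : Prop :=
  (∃ R : ℝ, 0 < R ∧ Ω = Metric.ball (0 : Euc n) R) ∨
  (∃ r R : ℝ, 0 < r ∧ r < R ∧ Ω = {x : Euc n | r < ‖x‖ ∧ ‖x‖ < R})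

/-- The Laplacian of `u`. -/
def lap {n : ℕ} (u : Euc n → ℝ) (x : Euc n) : ℝ :=
  ∑ i : Fin n, fderiv ℝ (fun y => fderiv ℝ u y (EuclideanSpace.single i 1)) x
    (EuclideanSpace.single i 1)

/-- The squared `H¹` norm. -/
def H1norm2 {n : ℕ} (Ω : Set (Euc n)) (u : Euc n → ℝ) : ℝ :=
  ∫ x in Ω, (‖fderiv ℝ u x‖ ^ 2 + (u x) ^ 2)

/-- 1-based block cyclic shift `π`. -/
def blockCycle (p : ℕ) (j : ℕ) : ℕ := if j % p = 0 then j + 1 - p else j + 1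

/-- Assumptions (A)-(D). -/
def SysAssump (N p B : ℕ) (lam mu : ℕ → ℝ) (beta : ℕ → ℕ → ℝ) : Prop :=
  p.Prime ∧ N = p * B ∧ 0 < B ∧
  -- (A)
  (∀ b ∈ Finset.Icc 1 B, ∀ i ∈ Finset.Icc (p * b - p + 1) (p * b),
    lam i = lam (p * b) ∧ 0 < lam i) ∧
  -- (B)
  (∀ i ∈ Finset.Icc 1 N, ∀ j ∈ Finset.Icc 1 N, i ≠ j → beta i j = beta j i ∧ beta i j ≤ 0) ∧
  (∀ j ∈ Finset.Icc 1 N, 0 < mu j) ∧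
  -- (C)
  (∀ i ∈ Finset.Icc 1 N, ∀ j ∈ Finset.Icc 1 N, i ≠ j →
    beta (blockCycle p i) (blockCycle p j) = beta i j) ∧
  -- (D)
  (∀ b ∈ Finset.Icc 1 B, ∀ j ∈ Finset.Icc (p * b - p + 1) (p * b),
    mu j + ∑ i ∈ (Finset.Icc (p * b - p + 1) (p * b)).erase j, beta i j ≤ 0)

/-- Classical solution of the system (S). -/
def IsClassicalSolution {n : ℕ} (Ω : Set (Euc n)) (N : ℕ) (lam mu : ℕ → ℝ)
    (beta : ℕ → ℕ → ℝ) (u : ℕ → Euc n → ℝ) : Prop :=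
  ∀ j ∈ Finset.Icc 1 N,
    ContDiffOn ℝ 2 (u j) Ω ∧ ContinuousOn (u j) (closure Ω) ∧
    (∀ x ∈ frontier Ω, u j x = 0) ∧
    (∀ x ∈ Ω, -(lap (u j) x) + lam j * u j x =
      mu j * (u j x) ^ 3 + ∑ m ∈ (Finset.Icc 1 N).erase j, beta j m * u j x * (u m x) ^ 2)


/-! ### Part 1: abstract Nehari minimisation -/

section Abstract
open Filter Topology

variable {ι : Type*} [Fintype ι] [DecidableEq ι]

/-- Monotonicity for M-matrices. -/
lemma mmat_mono (A : ι → ι → ℝ) (hoff : ∀ i j, i ≠ j → A i j ≤ 0)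
    (hrow : ∀ i, 0 < ∑ j, A i j) (x : ι → ℝ) (hx : ∀ i, 0 ≤ ∑ j, A i j * x j) :
    ∀ i, 0 ≤ x i := by
  intro i0
  haveI : Nonempty ι := ⟨i0⟩
  obtain ⟨i, hi⟩ := Finite.exists_min x
  suffices h : 0 ≤ x i from h.trans (hi i0)
  by_contra hneg
  push Not at hneg
  have h1 : ∑ j, A i j * x j ≤ ∑ j, A i j * x i := by
    apply Finset.sum_le_sum
    intro j _
    by_cases hij : i = j
    · subst hij; exact le_rfl
    · exact mul_le_mul_of_nonpos_left (hi j) (hoff i j hij)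
  have h2 : ∑ j, A i j * x i < 0 := by
    rw [← Finset.sum_mul]
    exact mul_neg_of_pos_of_neg (hrow i) hneg
  linarith [hx i]

lemma mmat_exists (A : ι → ι → ℝ) (hoff : ∀ i j, i ≠ j → A i j ≤ 0)
    (hrow : ∀ i, 0 < ∑ j, A i j) (b : ι → ℝ) (hb : ∀ i, 0 < b i) :
    ∃ s : ι → ℝ, (∀ i, 0 < s i) ∧ ∀ i, ∑ j, A i j * s j = b i := by
  have hdet : (Matrix.of A).det ≠ 0 := by
    apply det_ne_zero_of_sum_row_lt_diag
    intro k
    have h1 : ∑ j ∈ Finset.univ.erase k, ‖A k j‖ = - ∑ j ∈ Finset.univ.erase k, A k j := by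
      rw [← Finset.sum_neg_distrib]
      apply Finset.sum_congr rfl
      intro j hj
      rw [Real.norm_of_nonpos (hoff k j (Finset.ne_of_mem_erase hj).symm)]
    have h2 := Finset.add_sum_erase Finset.univ (fun j => A k j) (Finset.mem_univ k)
    have h3 := hrow k
    simp only [Matrix.of_apply]
    rw [h1, Real.norm_eq_abs]
    have := le_abs_self (A k k)
    linarith
  have hu : IsUnit (Matrix.of A).det := isUnit_iff_ne_zero.mpr hdet
  set s := (Matrix.of A)⁻¹.mulVec b with hs
  have hAs : ∀ i, ∑ j, A i j * s j = b i := by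
    intro i
    have : (Matrix.of A).mulVec s = b := by
      rw [hs, Matrix.mulVec_mulVec, Matrix.mul_nonsing_inv _ hu, Matrix.one_mulVec]
    exact congrFun this i
  have hs0 := mmat_mono A hoff hrow s (fun i => by rw [hAs i]; exact (hb i).le)
  refine ⟨s, fun i => lt_of_le_of_ne (hs0 i) ?_, hAs⟩
  intro h0
  have h1 := hAs i
  have h2 : ∑ j, A i j * s j ≤ 0 := by
    apply Finset.sum_nonpos
    intro j _
    by_cases hij : i = j
    · subst hij; rw [← h0]; simp
    · exact mul_nonpos_of_nonpos_of_nonneg (hoff i j hij) (hs0 j)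
  linarith [hb i]

lemma mmat_psd (A : ι → ι → ℝ) (hsym : ∀ i j, A i j = A j i)
    (hoff : ∀ i j, i ≠ j → A i j ≤ 0)
    (hrow : ∀ i, 0 < ∑ j, A i j) (x : ι → ℝ) : 0 ≤ ∑ i, ∑ j, A i j * x i * x j := by
  have h1 : ∑ i, ∑ j, A i j * (x i - x j) ^ 2 ≤ 0 := by
    apply Finset.sum_nonpos; intro i _
    apply Finset.sum_nonpos; intro j _
    by_cases hij : i = j
    · subst hij; simp
    · exact mul_nonpos_of_nonpos_of_nonneg (hoff i j hij) (sq_nonneg _)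
  have h2 : ∑ i, ∑ j, A i j * (x i - x j) ^ 2 =
      2 * ∑ i, (∑ j, A i j) * x i ^ 2 - 2 * ∑ i, ∑ j, A i j * x i * x j := by
    have e1 : ∑ i, ∑ j, A i j * x j ^ 2 = ∑ i, (∑ j, A i j) * x i ^ 2 := by
      rw [Finset.sum_comm]
      simp_rw [Finset.sum_mul]
      apply Finset.sum_congr rfl; intro i _
      apply Finset.sum_congr rfl; intro j _
      rw [hsym]
    have e2 : ∑ i, ∑ j, A i j * x i ^ 2 = ∑ i, (∑ j, A i j) * x i ^ 2 := by
      simp_rw [Finset.sum_mul]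
    have : ∑ i, ∑ j, A i j * (x i - x j) ^ 2 = ∑ i, ∑ j, A i j * x i ^ 2
        + ∑ i, ∑ j, A i j * x j ^ 2 - 2 * ∑ i, ∑ j, A i j * x i * x j := by
      simp_rw [Finset.mul_sum, ← Finset.sum_add_distrib, ← Finset.sum_sub_distrib]
      apply Finset.sum_congr rfl; intro i _
      apply Finset.sum_congr rfl; intro j _
      ring
    rw [this, e1, e2]; ring
  have h3 : 0 ≤ ∑ i, (∑ j, A i j) * x i ^ 2 :=
    Finset.sum_nonneg fun i _ => mul_nonneg (hrow i).le (sq_nonneg _)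
  linarith

/-- Weak sequential compactness in a separable Hilbert space. -/
lemma weak_subseq {H : Type*} [NormedAddCommGroup H] [InnerProductSpace ℝ H] [CompleteSpace H]
    [TopologicalSpace.SeparableSpace H] (x : ℕ → H) (C : ℝ) (hx : ∀ n, ‖x n‖ ≤ C) :
    ∃ (x' : H) (σ : ℕ → ℕ), StrictMono σ ∧
      ∀ y, Tendsto (fun n => inner ℝ (x (σ n)) y) atTop (𝓝 (inner ℝ x' y)) := by
  have hc := WeakDual.isSeqCompact_closedBall ℝ H (0 : StrongDual ℝ H) C
  let f : ℕ → WeakDual ℝ H := fun n =>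
    StrongDual.toWeakDual (InnerProductSpace.toDual ℝ H (x n))
  obtain ⟨a, -, σ, hσ, hlim⟩ := hc (x := f) (fun n => by
    simp only [Set.mem_preimage, Metric.mem_closedBall, dist_zero_right]
    have : WeakDual.toStrongDual (f n) = InnerProductSpace.toDual ℝ H (x n) := rfl
    rw [this]
    simpa using hx n)
  refine ⟨(InnerProductSpace.toDual ℝ H).symm (WeakDual.toStrongDual a), σ, hσ, fun y => ?_⟩
  have h1 := ((WeakDual.eval_continuous y).tendsto a).comp hlim
  have h2 : inner ℝ ((InnerProductSpace.toDual ℝ H).symm (WeakDual.toStrongDual a)) y = a y := by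
    rw [InnerProductSpace.toDual_symm_apply]; rfl
  rw [h2]
  exact h1

lemma weak_subseq_pi {H : Type*} [NormedAddCommGroup H] [InnerProductSpace ℝ H] [CompleteSpace H]
    [TopologicalSpace.SeparableSpace H] (x : ℕ → ι → H) (C : ℝ) (hx : ∀ n j, ‖x n j‖ ≤ C) :
    ∃ (x' : ι → H) (σ : ℕ → ℕ), StrictMono σ ∧
      ∀ j y, Tendsto (fun n => inner ℝ (x (σ n) j) y) atTop (𝓝 (inner ℝ (x' j) y)) := by
  have key : ∀ s : Finset ι, ∃ (x' : ι → H) (σ : ℕ → ℕ), StrictMono σ ∧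
      ∀ j ∈ s, ∀ y, Tendsto (fun n => inner ℝ (x (σ n) j) y) atTop (𝓝 (inner ℝ (x' j) y)) := by
    intro s
    induction s using Finset.induction_on with
    | empty => exact ⟨fun _ => 0, id, strictMono_id, by simp⟩
    | insert j s hj ih =>
      obtain ⟨x', σ, hσ, h⟩ := ih
      obtain ⟨y', τ, hτ, h'⟩ := weak_subseq (fun n => x (σ n) j) C (fun n => hx _ _)
      refine ⟨Function.update x' j y', σ ∘ τ, hσ.comp hτ, fun i hi y => ?_⟩
      by_cases hij : i = j
      · subst hij
        simpa using h' y
      · have hi' : i ∈ s := by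
          rcases Finset.mem_insert.mp hi with h | h
          · exact absurd h hij
          · exact h
        rw [Function.update_of_ne hij]
        exact (h i hi' y).comp hτ.tendsto_atTop
  obtain ⟨x', σ, hσ, h⟩ := key Finset.univ
  exact ⟨x', σ, hσ, fun j y => h j (Finset.mem_univ j) y⟩

end Abstract

section Abstract2
open Filter Topology

variable {ι : Type*} [Fintype ι] [DecidableEq ι]
variable {H K : Type*} [NormedAddCommGroup H] [InnerProductSpace ℝ H]
  [NormedAddCommGroup K] [InnerProductSpace ℝ K]

/-- quartic interaction -/
def qD (M : H →L[ℝ] H →L[ℝ] K) (x y : H) : ℝ := inner ℝ (M x x) (M y y)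

lemma qD_smul (M : H →L[ℝ] H →L[ℝ] K) (s t : ℝ) (x y : H) :
    qD M (s • x) (t • y) = s ^ 2 * t ^ 2 * qD M x y := by
  simp only [qD, map_smul, ContinuousLinearMap.smul_apply, inner_smul_left, inner_smul_right]
  simp; ring

lemma qD_comm (M : H →L[ℝ] H →L[ℝ] K) (x y : H) : qD M x y = qD M y x :=
  real_inner_comm _ _

/-- The Nehari set. -/
def Neh (M : H →L[ℝ] H →L[ℝ] K) (B : ι → H →L[ℝ] H →L[ℝ] ℝ) (β : ι → ι → ℝ)
    (u : ι → H) : Prop :=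
  ∀ j, u j ≠ 0 ∧ B j (u j) (u j) = ∑ k, β j k * qD M (u j) (u k)

lemma neh_scale (M : H →L[ℝ] H →L[ℝ] K) (B : ι → H →L[ℝ] H →L[ℝ] ℝ) (β : ι → ι → ℝ)
    (u : ι → H) (hu : ∀ j, u j ≠ 0) (s : ι → ℝ) (hs : ∀ j, 0 < s j)
    (h : ∀ j, ∑ k, (β j k * qD M (u j) (u k)) * s k = B j (u j) (u j)) :
    Neh M B β (fun j => √(s j) • u j) ∧
    ∀ j, B j (√(s j) • u j) (√(s j) • u j) = s j * B j (u j) (u j) := by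
  have e : ∀ j, B j (√(s j) • u j) (√(s j) • u j) = s j * B j (u j) (u j) := by
    intro j
    simp only [map_smul, ContinuousLinearMap.smul_apply, smul_eq_mul]
    rw [← mul_assoc, Real.mul_self_sqrt (hs j).le]
  refine ⟨fun j => ⟨smul_ne_zero (Real.sqrt_pos.mpr (hs j)).ne' (hu j), ?_⟩, e⟩
  rw [e j, ← h j, Finset.mul_sum]
  apply Finset.sum_congr rfl
  intro k _
  rw [qD_smul, Real.sq_sqrt (hs j).le, Real.sq_sqrt (hs k).le]
  ring

lemma neh_nonempty (M : H →L[ℝ] H →L[ℝ] K) (B : ι → H →L[ℝ] H →L[ℝ] ℝ) (β : ι → ι → ℝ)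
    (c : ℝ) (hc : 0 < c) (hB : ∀ j x, c * ‖x‖ ^ 2 ≤ B j x x)
    (hM0 : ∀ x, M x x = 0 → x = 0) (hdiag : ∀ j, 0 < β j j)
    (v : ι → H) (hv : ∀ j, v j ≠ 0) (hvd : ∀ i j, i ≠ j → qD M (v i) (v j) = 0) :
    ∃ u, Neh M B β u := by
  have hD : ∀ j, 0 < qD M (v j) (v j) := fun j => by
    unfold qD
    rw [real_inner_self_eq_norm_sq]
    have : M (v j) (v j) ≠ 0 := fun h => hv j (hM0 _ h)
    positivity
  have hb : ∀ j, 0 < B j (v j) (v j) := fun j => by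
    have := hv j
    exact lt_of_lt_of_le (by positivity) (hB j (v j))
  refine ⟨_, (neh_scale M B β v hv (fun j => B j (v j) (v j) / (β j j * qD M (v j) (v j)))
    (fun j => div_pos (hb j) (mul_pos (hdiag j) (hD j))) (fun j => ?_)).1⟩
  rw [Finset.sum_eq_single j]
  · have := (hdiag j).ne'
    have := (hD j).ne'
    field_simp
  · intro k _ hk
    rw [hvd j k hk.symm]; simp
  · simp

/-- A minimiser on the Nehari set. -/
lemma neh_min [CompleteSpace H] [TopologicalSpace.SeparableSpace H]
    (M : H →L[ℝ] H →L[ℝ] K) (B : ι → H →L[ℝ] H →L[ℝ] ℝ) (β : ι → ι → ℝ)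
    (c : ℝ) (hc : 0 < c) (hB : ∀ j x, c * ‖x‖ ^ 2 ≤ B j x x)
    (hBs : ∀ j x y, B j x y = B j y x)
    (hMc : ∀ (x : ℕ → H) (x' : H) (C : ℝ), (∀ n, ‖x n‖ ≤ C) →
      (∀ y, Tendsto (fun n => inner ℝ (x n) y) atTop (𝓝 (inner ℝ x' y))) →
      Tendsto (fun n => M (x n) (x n)) atTop (𝓝 (M x' x')))
    (hpos : ∀ x y, 0 ≤ qD M x y)
    (hdiag : ∀ j, 0 < β j j) (hoff : ∀ i j, i ≠ j → β i j ≤ 0)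
    (hne : ∃ u, Neh M B β u) :
    ∃ u, Neh M B β u ∧ ∀ w, Neh M B β w → ∑ j, B j (u j) (u j) ≤ ∑ j, B j (w j) (w j) := by
  have hB0 : ∀ j x, 0 ≤ B j x x := fun j x => le_trans (by positivity) (hB j x)
  set E : (ι → H) → ℝ := fun u => ∑ j, B j (u j) (u j) with hE
  have hE0 : ∀ u, 0 ≤ E u := fun u => Finset.sum_nonneg fun j _ => hB0 j _
  set m := sInf (E '' {u | Neh M B β u}) with hm
  have hbdd : BddBelow (E '' {u | Neh M B β u}) := ⟨0, by rintro _ ⟨u, -, rfl⟩; exact hE0 u⟩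
  have hnon : (E '' {u | Neh M B β u}).Nonempty := by
    obtain ⟨u, hu⟩ := hne; exact ⟨_, u, hu, rfl⟩
  have hmle : ∀ w, Neh M B β w → m ≤ E w := fun w hw => csInf_le hbdd ⟨w, hw, rfl⟩
  obtain ⟨e, -, hetend, he⟩ := exists_seq_tendsto_sInf hnon hbdd
  choose x0 hx0 hx0e using he
  obtain ⟨C0, hC0⟩ := hetend.bddAbove_range
  have hbd : ∀ n j, ‖x0 n j‖ ≤ √(C0 / c) := by
    intro n j
    apply Real.le_sqrt_of_sq_le
    rw [le_div_iff₀ hc]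
    have h1 : B j (x0 n j) (x0 n j) ≤ E (x0 n) :=
      Finset.single_le_sum (f := fun j => B j (x0 n j) (x0 n j)) (fun j _ => hB0 j _)
        (Finset.mem_univ j)
    have h2 : E (x0 n) ≤ C0 := by rw [hx0e]; exact hC0 ⟨n, rfl⟩
    have := hB j (x0 n j)
    linarith
  obtain ⟨u, σ, hσ, hw⟩ := weak_subseq_pi x0 _ hbd
  set x : ℕ → ι → H := fun n => x0 (σ n) with hx
  have hxN : ∀ n, Neh M B β (x n) := fun n => hx0 _
  have hxE : Tendsto (fun n => E (x n)) atTop (𝓝 m) := by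
    have : (fun n => E (x n)) = e ∘ σ := by ext n; simp [hx, hx0e]
    rw [this]; exact hetend.comp hσ.tendsto_atTop
  have hMt : ∀ j, Tendsto (fun n => M (x n j) (x n j)) atTop (𝓝 (M (u j) (u j))) := fun j =>
    hMc (fun n => x n j) (u j) _ (fun n => hbd _ j) (hw j)
  have hDt : ∀ i j, Tendsto (fun n => qD M (x n i) (x n j)) atTop (𝓝 (qD M (u i) (u j))) :=
    fun i j => (hMt i).inner (hMt j)
  set a : ι → ℝ := fun j => ∑ k, β j k * qD M (u j) (u k) with ha
  have hbt : ∀ j, Tendsto (fun n => B j (x n j) (x n j)) atTop (𝓝 (a j)) := by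
    intro j
    have : (fun n => B j (x n j) (x n j)) = fun n => ∑ k, β j k * qD M (x n j) (x n k) := by
      ext n; exact (hxN n j).2
    rw [this]
    exact tendsto_finset_sum _ fun k _ => (hDt j k).const_mul _
  have ham : ∑ j, a j = m := by
    refine tendsto_nhds_unique (tendsto_finset_sum _ fun j _ => hbt j) hxE
  -- weak lower semicontinuity
  have hlsc : ∀ j, B j (u j) (u j) ≤ a j := by
    intro j
    have hlin : Tendsto (fun n => B j (u j) (x n j)) atTop (𝓝 (B j (u j) (u j))) := by
      set g := (InnerProductSpace.toDual ℝ H).symm (B j (u j)) with hg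
      have : ∀ y, B j (u j) y = inner ℝ y g := by
        intro y
        rw [real_inner_comm, hg, InnerProductSpace.toDual_symm_apply]
      simp_rw [this]
      exact hw j g
    have h2 : Tendsto (fun n => 2 * B j (u j) (x n j) - B j (u j) (u j)) atTop
        (𝓝 (2 * B j (u j) (u j) - B j (u j) (u j))) := (hlin.const_mul 2).sub_const _
    have h3 := le_of_tendsto_of_tendsto' h2 (hbt j) (fun n => by
      have h4 := hB0 j (x n j - u j)
      simp only [map_sub, ContinuousLinearMap.sub_apply] at h4
      rw [hBs j (x n j) (u j)] at h4
      linarith)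
    linarith
  -- nontriviality
  have hu0 : ∀ j, u j ≠ 0 := by
    intro j hj
    have hlow : ∀ n, c ^ 2 / (β j j * (‖M‖ ^ 2 + 1)) ≤ B j (x n j) (x n j) := by
      intro n
      obtain ⟨h1, h2⟩ := hxN n j
      set b := B j (x n j) (x n j) with hb
      have h3 : b ≤ β j j * qD M (x n j) (x n j) := by
        rw [h2, ← Finset.add_sum_erase _ _ (Finset.mem_univ j)]
        have : ∑ k ∈ Finset.univ.erase j, β j k * qD M (x n j) (x n k) ≤ 0 :=
          Finset.sum_nonpos fun k hk => mul_nonpos_of_nonpos_of_nonneg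
            (hoff j k (Finset.ne_of_mem_erase hk).symm) (hpos _ _)
        linarith
      have hn : 0 < ‖x n j‖ := norm_pos_iff.mpr h1
      have h4 : qD M (x n j) (x n j) ≤ (‖M‖ ^ 2 + 1) * (‖x n j‖ ^ 2) ^ 2 := by
        unfold qD
        rw [real_inner_self_eq_norm_sq]
        have h5 : ‖M (x n j) (x n j)‖ ≤ ‖M‖ * ‖x n j‖ * ‖x n j‖ := M.le_opNorm₂ _ _
        calc ‖M (x n j) (x n j)‖ ^ 2 ≤ (‖M‖ * ‖x n j‖ * ‖x n j‖) ^ 2 := by gcongr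
          _ = ‖M‖ ^ 2 * (‖x n j‖ ^ 2) ^ 2 := by ring
          _ ≤ _ := by gcongr; linarith
      have h6 := hB j (x n j)
      rw [← hb] at h6
      have hbp : 0 < b := lt_of_lt_of_le (by positivity) h6
      have h7 : ‖x n j‖ ^ 2 ≤ b / c := by rw [le_div_iff₀ hc]; linarith
      have h8 : b ≤ β j j * ((‖M‖ ^ 2 + 1) * (b / c) ^ 2) := by
        refine h3.trans (mul_le_mul_of_nonneg_left (h4.trans ?_) (hdiag j).le)
        gcongr
      have hdj := hdiag j
      rw [div_le_iff₀ (by positivity)]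
      have h9 : b * c ^ 2 ≤ b * (b * (β j j * (‖M‖ ^ 2 + 1))) := by
        have h10 := mul_le_mul_of_nonneg_right h8 (sq_nonneg c)
        have h11 : β j j * ((‖M‖ ^ 2 + 1) * (b / c) ^ 2) * c ^ 2
          = b * (b * (β j j * (‖M‖ ^ 2 + 1))) := by field_simp
        linarith
      exact le_of_mul_le_mul_left h9 hbp
    have h1 : c ^ 2 / (β j j * (‖M‖ ^ 2 + 1)) ≤ a j := ge_of_tendsto' (hbt j) hlow
    have h2 : a j = 0 := by
      simp only [ha, hj, qD, map_zero, inner_zero_left, mul_zero, Finset.sum_const_zero]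
    have h3 : 0 < c ^ 2 / (β j j * (‖M‖ ^ 2 + 1)) := by have := hdiag j; positivity
    linarith
  have hbpos : ∀ j, 0 < B j (u j) (u j) := fun j => by
    have := hu0 j
    exact lt_of_lt_of_le (by positivity) (hB j (u j))
  -- rescaling
  set A : ι → ι → ℝ := fun j k => β j k * qD M (u j) (u k) with hA
  have hAoff : ∀ i j, i ≠ j → A i j ≤ 0 := fun i j hij =>
    mul_nonpos_of_nonpos_of_nonneg (hoff i j hij) (hpos _ _)
  have hrow : ∀ i, 0 < ∑ j, A i j := fun i => (hbpos i).trans_le (hlsc i)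
  obtain ⟨s, hs, hAs⟩ := mmat_exists A hAoff hrow _ hbpos
  have hs1 : ∀ j, s j ≤ 1 := by
    intro j
    have := mmat_mono A hAoff hrow (fun j => 1 - s j) (fun i => by
      simp only [mul_sub, mul_one, Finset.sum_sub_distrib]
      rw [hAs i]
      have := hlsc i
      simp only [ha] at this
      linarith) j
    linarith
  obtain ⟨hN, hN2⟩ := neh_scale M B β u hu0 s hs hAs
  have h1 := hmle _ hN
  simp only [hE] at h1
  simp_rw [hN2] at h1
  have h2 : ∀ j ∈ Finset.univ, s j * B j (u j) (u j) ≤ a j := fun j _ => by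
    nlinarith [hs1 j, hbpos j, hlsc j]
  have h3 : ∑ j, s j * B j (u j) (u j) = ∑ j, a j :=
    le_antisymm (Finset.sum_le_sum h2) (by rw [ham]; exact h1)
  have h4 := (Finset.sum_eq_sum_iff_of_le h2).mp h3
  have h5 : ∀ j, B j (u j) (u j) = a j := fun j => by
    have := h4 j (Finset.mem_univ j)
    nlinarith [hs1 j, hbpos j, hlsc j]
  refine ⟨u, fun j => ⟨hu0 j, h5 j⟩, fun w hw => ?_⟩
  simp_rw [h5]
  rw [ham]
  exact hmle w hw

end Abstract2

section Abstract3
open Filter Topology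

variable {ι : Type*} [Fintype ι] [DecidableEq ι]
variable {H K : Type*} [NormedAddCommGroup H] [InnerProductSpace ℝ H]
  [NormedAddCommGroup K] [InnerProductSpace ℝ K]

lemma hasDerivAt_line (u φ : H) : HasDerivAt (fun t : ℝ => u + t • φ) φ 0 := by
  simpa using ((hasDerivAt_id (0:ℝ)).smul_const φ).const_add u

lemma hasDerivAt_bilin {G : Type*} [NormedAddCommGroup G] [NormedSpace ℝ G]
    (B : H →L[ℝ] H →L[ℝ] G) (u φ : H) :
    HasDerivAt (fun t : ℝ => B (u + t • φ) (u + t • φ)) (B φ u + B u φ) 0 := by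
  have h := hasDerivAt_line u φ
  have h1 : HasDerivAt (fun t : ℝ => B (u + t • φ)) (B φ) 0 := by
    exact B.hasFDerivAt.comp_hasDerivAt (0:ℝ) h
  simpa using h1.clm_apply h

lemma hasDerivAt_qD (M : H →L[ℝ] H →L[ℝ] K) (hMs : ∀ x y, M x y = M y x) (u φ v ψ : H) :
    HasDerivAt (fun t : ℝ => qD M (u + t • φ) (v + t • ψ))
      (2 * inner ℝ (M u u) (M v ψ) + 2 * inner ℝ (M u φ) (M v v)) 0 := by
  have := (hasDerivAt_bilin M u φ).inner ℝ (hasDerivAt_bilin M v ψ)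
  simp only [zero_smul, add_zero] at this
  unfold qD
  rw [hMs φ u, hMs ψ v, ← two_smul ℝ, ← two_smul ℝ (M u φ), inner_smul_left,
    inner_smul_right] at this
  exact this

lemma neh_EL
    (M : H →L[ℝ] H →L[ℝ] K) (B : ι → H →L[ℝ] H →L[ℝ] ℝ) (β : ι → ι → ℝ)
    (c : ℝ) (hc : 0 < c) (hB : ∀ j x, c * ‖x‖ ^ 2 ≤ B j x x)
    (hBs : ∀ j x y, B j x y = B j y x) (hMs : ∀ x y, M x y = M y x)
    (hpos : ∀ x y, 0 ≤ qD M x y)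
    (hoff : ∀ i j, i ≠ j → β i j ≤ 0) (hsym : ∀ i j, β i j = β j i)
    (u : ι → H) (hu : Neh M B β u)
    (hmin : ∀ w, Neh M B β w → ∑ j, B j (u j) (u j) ≤ ∑ j, B j (w j) (w j)) (φ : ι → H) :
    ∑ j, (B j (u j) (φ j) - ∑ k, β j k * inner ℝ (M (u j) (φ j)) (M (u k) (u k))) = 0 := by
  set v : ℝ → ι → H := fun t j => u j + t • φ j with hv
  set b : ℝ → ι → ℝ := fun t j => B j (v t j) (v t j) with hb
  set A : ℝ → ι → ι → ℝ := fun t j k => β j k * qD M (v t j) (v t k) with hA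
  have hv0 : v 0 = u := by ext j; simp [hv]
  have hbpos : ∀ j, 0 < b 0 j := fun j => by
    have := (hu j).1
    simp only [hb, hv0]
    exact lt_of_lt_of_le (by positivity) (hB j (u j))
  have hA0 : ∀ j, ∑ k, A 0 j k = b 0 j := fun j => by
    simp only [hA, hb, hv0]; exact (hu j).2.symm
  have hAoff : ∀ t i j, i ≠ j → A t i j ≤ 0 := fun t i j hij =>
    mul_nonpos_of_nonpos_of_nonneg (hoff i j hij) (hpos _ _)
  have hAsym : ∀ t i j, A t i j = A t j i := fun t i j => by
    simp only [hA]; rw [hsym, qD_comm]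
  have hbd : ∀ j, HasDerivAt (fun t => b t j) (2 * B j (u j) (φ j)) 0 := fun j => by
    have := hasDerivAt_bilin (B j) (u j) (φ j)
    rw [hBs j (φ j) (u j), ← two_mul] at this
    exact this
  have hAd : ∀ j k, HasDerivAt (fun t => A t j k)
      (β j k * (2 * inner ℝ (M (u j) (u j)) (M (u k) (φ k))
        + 2 * inner ℝ (M (u j) (φ j)) (M (u k) (u k)))) 0 := fun j k =>
    (hasDerivAt_qD M hMs (u j) (φ j) (u k) (φ k)).const_mul _
  have hbc : ∀ j, Tendsto (fun t => b t j) (𝓝 0) (𝓝 (b 0 j)) :=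
    fun j => (hbd j).continuousAt
  have hAc : ∀ j k, Tendsto (fun t => A t j k) (𝓝 0) (𝓝 (A 0 j k)) :=
    fun j k => (hAd j k).continuousAt
  have hac : ∀ j, Tendsto (fun t => ∑ k, A t j k) (𝓝 0) (𝓝 (∑ k, A 0 j k)) :=
    fun j => tendsto_finsetSum _ fun k _ => hAc j k
  -- good parameters
  have hgood : ∀ᶠ t in 𝓝 (0:ℝ), ∀ j, b 0 j / 2 < ∑ k, A t j k ∧ 0 < b t j := by
    rw [eventually_all]
    intro j
    have h1 : b 0 j / 2 < ∑ k, A 0 j k := by rw [hA0]; linarith [hbpos j]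
    exact ((hac j).eventually_const_lt h1).and ((hbc j).eventually_const_lt (hbpos j))
  have hex : ∀ t, ∃ s : ι → ℝ, (∀ j, b 0 j / 2 < ∑ k, A t j k ∧ 0 < b t j) →
      (∀ i, 0 < s i) ∧ ∀ i, ∑ j, A t i j * s j = b t i := by
    intro t
    by_cases h : ∀ j, b 0 j / 2 < ∑ k, A t j k ∧ 0 < b t j
    · obtain ⟨s, hs⟩ := mmat_exists (A t) (hAoff t)
        (fun i => by linarith [(h i).1, hbpos i]) (b t) (fun i => (h i).2)
      exact ⟨s, fun _ => hs⟩
    · exact ⟨0, fun h' => absurd h' h⟩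
  choose s hs using hex
  -- s → 1
  have hs1 : ∀ j, Tendsto (fun t => s t j) (𝓝 0) (𝓝 1) := by
    intro j
    haveI : Nonempty ι := ⟨j⟩
    obtain ⟨i0, hi0⟩ := Finite.exists_min (b 0)
    rw [Metric.tendsto_nhds]
    intro ε hε
    have hyt : ∀ᶠ t in 𝓝 (0:ℝ), ∀ i, |b t i - ∑ k, A t i k| < (ε / 2) * (b 0 i0 / 2) := by
      rw [eventually_all]
      intro i
      have h0 : Tendsto (fun t => |b t i - ∑ k, A t i k|) (𝓝 0) (𝓝 |b 0 i - ∑ k, A 0 i k|) :=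
        ((hbc i).sub (hac i)).abs
      have h1 : |b 0 i - ∑ k, A 0 i k| = 0 := by rw [hA0]; simp
      rw [h1] at h0
      exact h0.eventually_lt_const (by have := hbpos i0; positivity)
    filter_upwards [hgood, hyt] with t ht hy
    obtain ⟨hsp, hsA⟩ := hs t ht
    have hrow : ∀ i, 0 < ∑ j, A t i j := fun i => by linarith [(ht i).1, hbpos i]
    have k1 := mmat_mono (A t) (hAoff t) hrow (fun j => ε / 2 + (s t j - 1)) (fun i => by
      simp only [mul_add, mul_sub, mul_one, Finset.sum_sub_distrib, Finset.sum_add_distrib, hsA,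
        ← Finset.sum_mul]
      have h1 := (abs_lt.mp (hy i)).1
      have h2 := mul_le_mul_of_nonneg_right (le_trans (by linarith [hi0 i]) (ht i).1.le :
        b 0 i0 / 2 ≤ ∑ k, A t i k) (by positivity : 0 ≤ ε / 2)
      linarith) j
    have k2 := mmat_mono (A t) (hAoff t) hrow (fun j => ε / 2 - (s t j - 1)) (fun i => by
      simp only [mul_sub, mul_one, Finset.sum_sub_distrib, hsA,
        ← Finset.sum_mul]
      have h1 := (abs_lt.mp (hy i)).2
      have h2 := mul_le_mul_of_nonneg_right (le_trans (by linarith [hi0 i]) (ht i).1.le :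
        b 0 i0 / 2 ≤ ∑ k, A t i k) (by positivity : 0 ≤ ε / 2)
      linarith) j
    rw [Real.dist_eq, abs_lt]
    constructor <;> linarith
  -- the basic inequality
  set F : ℝ → ℝ := fun t => ∑ j, s t j * (b t j - b 0 j)
    - (1/2) * ∑ j, ∑ k, s t j * s t k * (A t j k - A 0 j k) with hF
  have hFnn : ∀ᶠ t in 𝓝 (0:ℝ), 0 ≤ F t := by
    filter_upwards [hgood] with t ht
    obtain ⟨hsp, hsA⟩ := hs t ht
    have hvne : ∀ j, v t j ≠ 0 := fun j h => by
      have := (ht j).2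
      simp only [hb, h, map_zero] at this
      exact lt_irrefl _ this
    obtain ⟨hN, hN2⟩ := neh_scale M B β (v t) hvne (s t) hsp hsA
    have h1 := hmin _ hN
    simp_rw [hN2] at h1
    have e0 : ∀ j, B j (u j) (u j) = b 0 j := fun j => by simp only [hb, hv0]
    have e1 : ∀ j, B j (v t j) (v t j) = b t j := fun j => rfl
    simp_rw [e0, e1] at h1
    have h2 := mmat_psd (A 0) (hAsym 0) (hAoff 0) (fun i => by rw [hA0]; exact hbpos i)
      (fun j => s t j - 1)
    have h3 : ∑ j, ∑ k, s t j * s t k * A t j k = ∑ j, s t j * b t j := by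
      apply Finset.sum_congr rfl; intro j _
      rw [← hsA j, Finset.mul_sum]
      apply Finset.sum_congr rfl; intro k _; ring
    have h4 : ∑ j, ∑ k, A 0 j k * (s t j - 1) * (s t k - 1) =
        ∑ j, ∑ k, s t j * s t k * A 0 j k - 2 * ∑ j, s t j * b 0 j + ∑ j, b 0 j := by
      have f1 : ∑ j, ∑ k, A 0 j k * s t j = ∑ j, s t j * b 0 j := by
        apply Finset.sum_congr rfl; intro j _
        rw [← hA0 j, Finset.mul_sum]
        apply Finset.sum_congr rfl; intro k _; ring
      have f2 : ∑ j, ∑ k, A 0 j k * s t k = ∑ j, s t j * b 0 j := by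
        rw [Finset.sum_comm, ← f1]
        apply Finset.sum_congr rfl; intro j _
        apply Finset.sum_congr rfl; intro k _; rw [hAsym]
      have f3 : ∑ j, ∑ k, A 0 j k = ∑ j, b 0 j := by simp_rw [hA0]
      have : ∑ j, ∑ k, A 0 j k * (s t j - 1) * (s t k - 1) =
        ∑ j, ∑ k, s t j * s t k * A 0 j k - ∑ j, ∑ k, A 0 j k * s t j
          - ∑ j, ∑ k, A 0 j k * s t k + ∑ j, ∑ k, A 0 j k := by
        simp_rw [← Finset.sum_sub_distrib, ← Finset.sum_add_distrib]
        apply Finset.sum_congr rfl; intro j _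
        apply Finset.sum_congr rfl; intro k _; ring
      rw [this, f1, f2, f3]; ring
    simp only [hF, mul_sub, Finset.sum_sub_distrib, h3]
    rw [h4] at h2
    linarith
  -- derivative of F
  set L := ∑ j, 1 * (2 * B j (u j) (φ j)) - (1/2) * ∑ j, ∑ k, (1 * 1) *
    (β j k * (2 * inner ℝ (M (u j) (u j)) (M (u k) (φ k))
        + 2 * inner ℝ (M (u j) (φ j)) (M (u k) (u k)))) with hL
  have hslope : ∀ (f : ℝ → ℝ) (f' : ℝ), HasDerivAt f f' 0 →
      Tendsto (fun t => (f t - f 0) / t) (𝓝[≠] 0) (𝓝 f') := by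
    intro f f' h
    have := h.tendsto_slope
    refine this.congr fun t => ?_
    simp [slope_def_field]
  have hFt : Tendsto (fun t => F t / t) (𝓝[≠] 0) (𝓝 L) := by
    have : (fun t => F t / t) = fun t => ∑ j, s t j * ((b t j - b 0 j) / t)
      - (1/2) * ∑ j, ∑ k, s t j * s t k * ((A t j k - A 0 j k) / t) := by
      ext t
      simp only [hF, sub_div, Finset.sum_div, mul_div_assoc]
    rw [this]
    have hsn : ∀ j, Tendsto (fun t => s t j) (𝓝[≠] 0) (𝓝 1) := fun j =>
      (hs1 j).mono_left nhdsWithin_le_nhds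
    refine Tendsto.sub (tendsto_finsetSum _ fun j _ => (hsn j).mul (hslope _ _ (hbd j)))
      (Tendsto.const_mul _ (tendsto_finsetSum _ fun j _ => tendsto_finsetSum _ fun k _ =>
        ((hsn j).mul (hsn k)).mul (hslope _ _ (hAd j k))))
  have hL1 : 0 ≤ L := by
    have h1 : Tendsto (fun t => F t / t) (𝓝[>] 0) (𝓝 L) :=
      hFt.mono_left (nhdsWithin_mono _ fun t ht => ne_of_gt ht)
    apply ge_of_tendsto h1
    filter_upwards [hFnn.filter_mono nhdsWithin_le_nhds, self_mem_nhdsWithin] with t h2 h3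
    exact div_nonneg h2 (le_of_lt h3)
  have hL2 : L ≤ 0 := by
    have h1 : Tendsto (fun t => F t / t) (𝓝[<] 0) (𝓝 L) :=
      hFt.mono_left (nhdsWithin_mono _ fun t ht => ne_of_lt ht)
    apply le_of_tendsto h1
    filter_upwards [hFnn.filter_mono nhdsWithin_le_nhds, self_mem_nhdsWithin] with t h2 h3
    exact div_nonpos_of_nonneg_of_nonpos h2 (le_of_lt h3)
  have hL0 : L = 0 := le_antisymm hL2 hL1
  have hswap : ∑ j, ∑ k, β j k * inner ℝ (M (u j) (u j)) (M (u k) (φ k))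
      = ∑ j, ∑ k, β j k * inner ℝ (M (u j) (φ j)) (M (u k) (u k)) := by
    rw [Finset.sum_comm]
    apply Finset.sum_congr rfl; intro j _
    apply Finset.sum_congr rfl; intro k _
    rw [hsym, real_inner_comm]
  have hL3 : L = 2 * ∑ j, B j (u j) (φ j) - ∑ j, ∑ k, β j k * inner ℝ (M (u j) (u j)) (M (u k) (φ k))
      - ∑ j, ∑ k, β j k * inner ℝ (M (u j) (φ j)) (M (u k) (u k)) := by
    rw [hL]
    simp_rw [Finset.mul_sum, ← Finset.sum_sub_distrib]
    apply Finset.sum_congr rfl; intro j _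
    rw [sub_sub, ← Finset.sum_add_distrib, one_mul]
    congr 1
    apply Finset.sum_congr rfl; intro k _
    ring
  rw [hswap] at hL3
  rw [Finset.sum_sub_distrib]
  linarith

/-- Abstract existence theorem. -/
theorem abstract_nehari [CompleteSpace H] [TopologicalSpace.SeparableSpace H]
    (M : H →L[ℝ] H →L[ℝ] K) (B : ι → H →L[ℝ] H →L[ℝ] ℝ) (β : ι → ι → ℝ)
    (c : ℝ) (hc : 0 < c) (hB : ∀ j x, c * ‖x‖ ^ 2 ≤ B j x x)
    (hBs : ∀ j x y, B j x y = B j y x) (hMs : ∀ x y, M x y = M y x)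
    (hM0 : ∀ x, M x x = 0 → x = 0)
    (hMc : ∀ (x : ℕ → H) (x' : H) (C : ℝ), (∀ n, ‖x n‖ ≤ C) →
      (∀ y, Tendsto (fun n => inner ℝ (x n) y) atTop (𝓝 (inner ℝ x' y))) →
      Tendsto (fun n => M (x n) (x n)) atTop (𝓝 (M x' x')))
    (hpos : ∀ x y, 0 ≤ qD M x y)
    (hdiag : ∀ j, 0 < β j j) (hoff : ∀ i j, i ≠ j → β i j ≤ 0) (hsym : ∀ i j, β i j = β j i)
    (v : ι → H) (hv : ∀ j, v j ≠ 0) (hvd : ∀ i j, i ≠ j → qD M (v i) (v j) = 0) :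
    ∃ u : ι → H, (∀ j, u j ≠ 0) ∧ ∀ j φ,
      B j (u j) φ = ∑ k, β j k * inner ℝ (M (u j) φ) (M (u k) (u k)) := by
  obtain ⟨u, hu, hmin⟩ := neh_min M B β c hc hB hBs hMc hpos hdiag hoff
    (neh_nonempty M B β c hc hB hM0 hdiag v hv hvd)
  refine ⟨u, fun j => (hu j).1, fun j φ => ?_⟩
  have h := neh_EL M B β c hc hB hBs hMs hpos hoff hsym u hu hmin (Pi.single j φ)
  rw [Finset.sum_eq_single j] at h
  · simp only [Pi.single_eq_same] at h
    linarith
  · intro i _ hij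
    rw [Pi.single_eq_of_ne hij]
    simp
  · simp

end Abstract3

section Rot
open Filter Topology

variable {n : ℕ}

lemma rotPt_rotPt (hn : n = 2 ∨ n = 3) (a b : ℝ) (x : Euc n) :
    rotPt a (rotPt b x) = rotPt (a + b) x := by
  rcases hn with rfl | rfl
  · ext i
    fin_cases i <;> simp [rotPt, Real.cos_add, Real.sin_add] <;> ring
  · ext i
    fin_cases i <;> simp [rotPt, Real.cos_add, Real.sin_add] <;> ring

lemma rotPt_zero (hn : n = 2 ∨ n = 3) (x : Euc n) : rotPt 0 x = x := by
  rcases hn with rfl | rfl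
  · ext i; fin_cases i <;> simp [rotPt]
  · ext i; fin_cases i <;> simp [rotPt]

lemma rotPt_two_pi (hn : n = 2 ∨ n = 3) (x : Euc n) : rotPt (2 * π) x = x := by
  rcases hn with rfl | rfl
  · ext i; fin_cases i <;> simp [rotPt]
  · ext i; fin_cases i <;> simp [rotPt]

/-- rotation as linear map -/
def rotLin (hn : n = 2 ∨ n = 3) (a : ℝ) : Euc n →ₗ[ℝ] Euc n where
  toFun := rotPt a
  map_add' x y := by
    rcases hn with rfl | rfl
    · ext i; fin_cases i <;> simp [rotPt] <;> ring
    · ext i; fin_cases i <;> simp [rotPt] <;> ring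
  map_smul' c x := by
    rcases hn with rfl | rfl
    · ext i; fin_cases i <;> simp [rotPt] <;> ring
    · ext i; fin_cases i <;> simp [rotPt] <;> ring

lemma rotPt_norm (hn : n = 2 ∨ n = 3) (a : ℝ) (x : Euc n) : ‖rotPt a x‖ = ‖x‖ := by
  have key : ‖rotPt a x‖ ^ 2 = ‖x‖ ^ 2 := by
    have h := Real.sin_sq_add_cos_sq a
    rcases hn with rfl | rfl
    · simp only [EuclideanSpace.norm_sq_eq, Fin.sum_univ_two, Real.norm_eq_abs, sq_abs]
      simp [rotPt]
      linear_combination (x 0 ^ 2 + x 1 ^ 2) * h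
    · simp only [EuclideanSpace.norm_sq_eq, Fin.sum_univ_three, Real.norm_eq_abs, sq_abs]
      simp [rotPt]
      linear_combination (x 0 ^ 2 + x 1 ^ 2) * h
  exact (sq_eq_sq₀ (norm_nonneg _) (norm_nonneg _)).mp key

/-- rotation as a linear isometry equivalence -/
def rotE (hn : n = 2 ∨ n = 3) (a : ℝ) : Euc n ≃ₗᵢ[ℝ] Euc n where
  toLinearEquiv := LinearEquiv.ofLinear (rotLin hn a) (rotLin hn (-a))
    (by ext1 x; change rotPt a (rotPt (-a) x) = x
        rw [rotPt_rotPt hn]; simp [rotPt_zero hn])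
    (by ext1 x; change rotPt (-a) (rotPt a x) = x
        rw [rotPt_rotPt hn]; simp [rotPt_zero hn])
  norm_map' x := rotPt_norm hn a x

lemma rotE_apply (hn : n = 2 ∨ n = 3) (a : ℝ) (x : Euc n) : rotE hn a x = rotPt a x := rfl

lemma rotE_symm_apply (hn : n = 2 ∨ n = 3) (a : ℝ) (x : Euc n) :
    (rotE hn a).symm x = rotPt (-a) x := rfl

/-- the generator of rotations -/
def rotGen (t : ℝ) (x : Euc n) : Euc n :=
  WithLp.toLp 2 fun i : Fin n => if (i : ℕ) = 0 then
      -Real.sin t * x i - Real.cos t * x ⟨1 % n, Nat.mod_lt 1 i.pos⟩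
    else if (i : ℕ) = 1 then Real.cos t * x ⟨0, i.pos⟩ - Real.sin t * x i
    else 0

lemma rotGen_norm (hn : n = 2 ∨ n = 3) (a : ℝ) (x : Euc n) : ‖rotGen a x‖ ≤ ‖x‖ := by
  have key : ‖rotGen a x‖ ^ 2 ≤ ‖x‖ ^ 2 := by
    have h := Real.sin_sq_add_cos_sq a
    rcases hn with rfl | rfl
    · simp only [EuclideanSpace.norm_sq_eq, Fin.sum_univ_two, Real.norm_eq_abs, sq_abs]
      simp [rotGen]
      apply le_of_eq
      linear_combination (x 0 ^ 2 + x 1 ^ 2) * h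
    · simp only [EuclideanSpace.norm_sq_eq, Fin.sum_univ_three, Real.norm_eq_abs, sq_abs]
      simp [rotGen]
      have : (-(Real.sin a * x 0) - Real.cos a * x 1) ^ 2 + (Real.cos a * x 0 - Real.sin a * x 1) ^ 2
        = x 0 ^ 2 + x 1 ^ 2 := by
        linear_combination (x 0 ^ 2 + x 1 ^ 2) * h
      rw [this]
      linarith [sq_nonneg (x 2)]
  exact (sq_le_sq₀ (norm_nonneg _) (norm_nonneg _)).mp key

lemma rotPt_hasDerivAt_aux (t : ℝ) (x : Euc n) (i : Fin n) :
    HasDerivAt (fun t => rotPt t x i) (rotGen t x i) t := by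
  simp only [rotPt, rotGen]
  split_ifs
  · exact ((Real.hasDerivAt_cos t).mul_const (x i)).sub
      ((Real.hasDerivAt_sin t).mul_const (x ⟨1 % n, Nat.mod_lt 1 i.pos⟩))
  · have h := ((Real.hasDerivAt_sin t).mul_const (x ⟨0, i.pos⟩)).add
      ((Real.hasDerivAt_cos t).mul_const (x i))
    have e : Real.cos t * x ⟨0, i.pos⟩ - Real.sin t * x i =
      Real.cos t * x ⟨0, i.pos⟩ + -Real.sin t * x i := by ring
    rw [e]
    exact h
  · exact hasDerivAt_const _ _

lemma rotPt_hasDerivAt (t : ℝ) (x : Euc n) :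
    HasDerivAt (fun t => rotPt t x) (rotGen t x) t := by
  have key : HasDerivAt (fun t => (rotPt t x).ofLp) ((rotGen t x).ofLp) t := by
    rw [hasDerivAt_pi]
    intro i
    exact rotPt_hasDerivAt_aux t x i
  exact ((PiLp.continuousLinearEquiv 2 ℝ
    (fun _ : Fin n => ℝ)).symm.hasFDerivAt (x := (rotPt t x).ofLp)).comp_hasDerivAt t key

lemma rotPt_continuous : Continuous (fun p : ℝ × Euc n => rotPt p.1 p.2) := by
  unfold rotPt
  apply (PiLp.continuous_toLp 2 _).comp
  apply continuous_pi
  intro i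
  split_ifs <;> fun_prop

lemma rotGen_continuous : Continuous (fun p : ℝ × Euc n => rotGen p.1 p.2) := by
  unfold rotGen
  apply (PiLp.continuous_toLp 2 _).comp
  apply continuous_pi
  intro i
  split_ifs <;> fun_prop

lemma rotPt_mp (hn : n = 2 ∨ n = 3) (a : ℝ) :
    MeasurePreserving (rotPt a : Euc n → Euc n) volume volume :=
  (rotE hn a).measurePreserving

end Rot

section Flow
open Filter Topology
open scoped ENNReal

lemma sq_lintegral_le {α : Type*} [MeasurableSpace α] (μ : Measure α) [IsProbabilityMeasure μ]
    (f : α → ℝ≥0∞) (hf : AEMeasurable f μ) : (∫⁻ a, f a ∂μ) ^ 2 ≤ ∫⁻ a, f a ^ 2 ∂μ := by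
  have h := ENNReal.lintegral_mul_le_Lp_mul_Lq μ (Real.HolderConjugate.two_two) hf
    (aemeasurable_const (b := (1:ℝ≥0∞)))
  simp at h
  have h2 := ENNReal.rpow_le_rpow h (by norm_num : (0:ℝ) ≤ 2)
  rw [← ENNReal.rpow_mul] at h2
  simpa using h2

variable {n : ℕ}

lemma flow_L2 (Φ Φ' : ℝ → Euc n → Euc n)
    (hmp : ∀ t, MeasurePreserving (Φ t) volume volume)
    (hc : Continuous (fun p : ℝ × Euc n => Φ p.1 p.2))
    (hc' : Continuous (fun p : ℝ × Euc n => Φ' p.1 p.2))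
    (hd : ∀ t x, HasDerivAt (fun t => Φ t x) (Φ' t x) t)
    (h0 : ∀ x, Φ 0 x = x) (u : Euc n → ℝ) (hu : ContDiff ℝ 1 u) (C : ℝ≥0∞)
    (hb : ∀ t x, fderiv ℝ u (Φ t x) ≠ 0 → ‖Φ' t x‖ₑ ≤ C) :
    ∫⁻ x, ‖u (Φ 1 x) - u x‖ₑ ^ 2 ≤ C ^ 2 * ∫⁻ x, ‖fderiv ℝ u x‖ₑ ^ 2 := by
  have hfc : Continuous (fderiv ℝ u) := hu.continuous_fderiv (by norm_num)
  set P : Measure ℝ := volume.restrict (Set.Ioc 0 1) with hP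
  haveI : IsProbabilityMeasure P := ⟨by simp [hP]⟩
  have hpt : ∀ x, ‖u (Φ 1 x) - u x‖ₑ ^ 2 ≤ ∫⁻ t, C ^ 2 * ‖fderiv ℝ u (Φ t x)‖ₑ ^ 2 ∂P := by
    intro x
    have hder : ∀ t, HasDerivAt (fun t => u (Φ t x)) (fderiv ℝ u (Φ t x) (Φ' t x)) t := fun t =>
      ((hu.differentiable (by norm_num) _).hasFDerivAt).comp_hasDerivAt t (hd t x)
    have hcx : Continuous (fun t => Φ t x) := hc.comp (by fun_prop : Continuous fun t => (t, x))
    have hcx' : Continuous (fun t => Φ' t x) := hc'.comp (by fun_prop : Continuous fun t => (t, x))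
    have hcont : Continuous (fun t => fderiv ℝ u (Φ t x) (Φ' t x)) :=
      (hfc.comp hcx).clm_apply hcx'
    have h1 := intervalIntegral.integral_eq_sub_of_hasDerivAt (a := 0) (b := 1)
      (fun t _ => hder t) (hcont.intervalIntegrable _ _)
    rw [h0, intervalIntegral.integral_of_le (by norm_num)] at h1
    rw [← h1]
    calc ‖∫ t in Set.Ioc 0 1, fderiv ℝ u (Φ t x) (Φ' t x)‖ₑ ^ 2
        ≤ (∫⁻ t, ‖fderiv ℝ u (Φ t x) (Φ' t x)‖ₑ ∂P) ^ 2 := by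
          gcongr; exact enorm_integral_le_lintegral_enorm _
      _ ≤ ∫⁻ t, ‖fderiv ℝ u (Φ t x) (Φ' t x)‖ₑ ^ 2 ∂P :=
          sq_lintegral_le _ _ hcont.enorm.measurable.aemeasurable
      _ ≤ _ := by
          apply lintegral_mono
          intro t
          dsimp only
          rw [← mul_pow]
          gcongr
          by_cases hz : fderiv ℝ u (Φ t x) = 0
          · simp [hz]
          · refine (ContinuousLinearMap.le_opNorm_enorm _ _).trans ?_
            rw [mul_comm]
            gcongr
            exact hb t x hz
  calc ∫⁻ x, ‖u (Φ 1 x) - u x‖ₑ ^ 2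
      ≤ ∫⁻ x, ∫⁻ t, C ^ 2 * ‖fderiv ℝ u (Φ t x)‖ₑ ^ 2 ∂P := lintegral_mono hpt
    _ = ∫⁻ t, ∫⁻ x, C ^ 2 * ‖fderiv ℝ u (Φ t x)‖ₑ ^ 2 ∂volume ∂P := by
        apply lintegral_lintegral_swap
        apply Measurable.aemeasurable
        apply Measurable.const_mul
        apply Measurable.pow_const
        apply Measurable.enorm
        have : Continuous (fun p : Euc n × ℝ => fderiv ℝ u (Φ p.2 p.1)) :=
          hfc.comp (hc.comp (by fun_prop : Continuous fun p : Euc n × ℝ => (p.2, p.1)))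
        exact this.measurable
    _ = ∫⁻ t, C ^ 2 * ∫⁻ x, ‖fderiv ℝ u x‖ₑ ^ 2 ∂volume ∂P := by
        apply lintegral_congr
        intro t
        have hm : Measurable fun x => ‖fderiv ℝ u x‖ₑ ^ 2 :=
          (hfc.enorm.measurable).pow_const 2
        rw [lintegral_const_mul _ (show Measurable fun x => ‖fderiv ℝ u (Φ t x)‖ₑ ^ 2 from
          hm.comp (hmp t).measurable)]
        congr 1
        exact (hmp t).lintegral_comp hm
    _ = _ := by simp

end Flow

section Sob
open Filter Topology
open scoped ENNReal NNReal
variable {n : ℕ}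

/-- unit coordinate vectors -/
def bv (i : Fin n) : Euc n := EuclideanSpace.single i (1:ℝ)

lemma dual_norm_sq (L : Euc n →L[ℝ] ℝ) : ‖L‖ ^ 2 = ∑ i, (L (bv i)) ^ 2 := by
  obtain ⟨v, rfl⟩ := (InnerProductSpace.toDual ℝ (Euc n)).surjective L
  rw [LinearIsometryEquiv.norm_map, EuclideanSpace.norm_sq_eq]
  apply Finset.sum_congr rfl
  intro i _
  simp [bv, InnerProductSpace.toDual_apply_apply, EuclideanSpace.inner_single_right]

lemma holder_ball (R : ℝ) (p : ℝ≥0) (hp0 : 0 < p) (hp : p ≤ 2) :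
    ∃ V : ℝ≥0, ∀ f : Euc n → (Euc n →L[ℝ] ℝ), Continuous f → 
    tsupport f ⊆ Metric.ball 0 R →
    eLpNorm f p volume ≤ V * eLpNorm f 2 volume := by
  have hV : (volume (Metric.ball (0 : Euc n) R)) ^
        (1 / (p : ℝ≥0∞).toReal - 1 / (2:ℝ≥0∞).toReal) ≠ ∞ := by
    apply ENNReal.rpow_ne_top_of_nonneg
    · rw [sub_nonneg]
      apply one_div_le_one_div_of_le
      · simpa using hp0
      · have : (p : ℝ) ≤ 2 := by exact_mod_cast hp
        simpa using this
    · exact measure_ball_lt_top.ne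
  obtain ⟨V, hV⟩ : ∃ V : ℝ≥0, (V : ℝ≥0∞) = (volume (Metric.ball (0 : Euc n) R)) ^
        (1 / (p : ℝ≥0∞).toReal - 1 / (2:ℝ≥0∞).toReal) := ⟨_, ENNReal.coe_toNNReal hV⟩
  refine ⟨V, fun f hf hs => ?_⟩
  have hs' := (subset_tsupport _).trans hs
  rw [← eLpNorm_restrict_eq_of_support_subset (p := p) (f := f) (μ := volume) hs',
    ← eLpNorm_restrict_eq_of_support_subset (p := 2) (f := f) (μ := volume) hs', hV, mul_comm]
  have := eLpNorm_le_eLpNorm_mul_rpow_measure_univ (p := p) (q := 2)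
    (μ := volume.restrict (Metric.ball (0 : Euc n) R)) (f := f)
    (by exact_mod_cast hp) hf.aestronglyMeasurable
  rwa [Measure.restrict_apply_univ] at this

lemma gns (hn : n = 2 ∨ n = 3) (R : ℝ) : ∃ C : ℝ≥0, ∀ q : ℝ≥0, (q = 4 ∨ q = 6) →
    ∀ φ : Euc n → ℝ, ContDiff ℝ 1 φ → tsupport φ ⊆ Metric.ball 0 R →
      eLpNorm φ q volume ≤ C * eLpNorm (fderiv ℝ φ) 2 volume := by
  have key : ∀ q : ℝ≥0, (q = 4 ∨ q = 6) → ∃ C : ℝ≥0, 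
    ∀ φ : Euc n → ℝ, ContDiff ℝ 1 φ → tsupport φ ⊆ Metric.ball 0 R →
      eLpNorm φ q volume ≤ C * eLpNorm (fderiv ℝ φ) 2 volume := by
    intro q hq
    rcases hn with rfl | rfl
    · obtain ⟨V, hV⟩ := holder_ball (n := 2) R (3/2) (by positivity) (by
        rw [← NNReal.coe_le_coe]; push_cast; norm_num)
      refine ⟨eLpNormLESNormFDerivOfLeConst ℝ (volume : Measure (Euc 2)) (Metric.ball 0 R) (3/2) q
        * V, fun φ hφ hs => ?_⟩
      have h1 := eLpNorm_le_eLpNorm_fderiv_of_le (μ := volume) (F := ℝ) hφ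
        ((subset_tsupport _).trans hs) (p := 3/2) (q := q) (by
          rw [← NNReal.coe_le_coe]; push_cast; norm_num) (by
          simp; rw [← NNReal.coe_lt_coe]; push_cast; norm_num) (by
          simp only [finrank_euclideanSpace, Fintype.card_fin]
          rcases hq with rfl | rfl <;> (push_cast; norm_num)) Metric.isBounded_ball
      have h2 := hV (fderiv ℝ φ) (hφ.continuous_fderiv (by norm_num))
        ((tsupport_fderiv_subset ℝ).trans hs)
      refine h1.trans ?_
      rw [ENNReal.coe_mul, mul_assoc]
      gcongr
    · refine ⟨eLpNormLESNormFDerivOfLeConst ℝ (volume : Measure (Euc 3)) (Metric.ball 0 R) 2 q, 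
        fun φ hφ hs => ?_⟩
      exact eLpNorm_le_eLpNorm_fderiv_of_le (μ := volume) (F := ℝ) hφ
        ((subset_tsupport _).trans hs) (p := 2) (q := q) (by norm_num) (by
          simp; rw [← NNReal.coe_lt_coe]; push_cast; norm_num) (by
          simp only [finrank_euclideanSpace, Fintype.card_fin]
          rcases hq with rfl | rfl <;> (push_cast; norm_num)) Metric.isBounded_ball
  obtain ⟨C1, h1⟩ := key 4 (Or.inl rfl)
  obtain ⟨C2, h2⟩ := key 6 (Or.inr rfl)
  refine ⟨max C1 C2, ?_⟩
  rintro q (rfl | rfl) φ hφ hs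
  · refine (h1 φ hφ hs).trans ?_
    gcongr; exact le_max_left _ _
  · refine (h2 φ hφ hs).trans ?_
    gcongr; exact le_max_right _ _

lemma transl_L2 (u : Euc n → ℝ) (hu : ContDiff ℝ 1 u) (h : Euc n) :
    ∫⁻ x, ‖u (x + h) - u x‖ₑ ^ 2 ≤ ‖h‖ₑ ^ 2 * ∫⁻ x, ‖fderiv ℝ u x‖ₑ ^ 2 := by
  have hd : ∀ (t : ℝ) (x : Euc n), HasDerivAt (fun t : ℝ => x + t • h) h t := fun t x => by
    have := ((hasDerivAt_id t).smul_const h).const_add x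
    rw [one_smul] at this
    exact this
  have hmp : ∀ t : ℝ, MeasurePreserving (fun x : Euc n => x + t • h) volume volume :=
    fun t => measurePreserving_add_right volume (t • h)
  have hc : Continuous fun p : ℝ × Euc n => p.2 + p.1 • h := by fun_prop
  have := flow_L2 (fun (t : ℝ) (x : Euc n) => x + t • h) (fun _ _ => h)
    hmp hc continuous_const hd (fun x => by simp) u hu ‖h‖ₑ (fun _ _ _ => le_rfl)
  simpa using this

lemma rot_L2 (hn : n = 2 ∨ n = 3) (u : Euc n → ℝ) (hu : ContDiff ℝ 1 u) (θ R : ℝ) 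
    (hs : tsupport u ⊆ Metric.ball 0 R) :
    ∫⁻ x, ‖u (rotPt θ x) - u x‖ₑ ^ 2 ≤ ENNReal.ofReal (|θ| * R) ^ 2 * ∫⁻ x, ‖fderiv ℝ u x‖ₑ ^ 2 := by
  have hq : Continuous fun p : ℝ × Euc n => (p.1 * θ, p.2) := by fun_prop
  have hc : Continuous fun p : ℝ × Euc n => rotPt (p.1 * θ) p.2 := by
    have := (rotPt_continuous (n := n)).comp hq
    exact this
  have hc0 : Continuous fun p : ℝ × Euc n => rotGen (p.1 * θ) p.2 := by
    have := (rotGen_continuous (n := n)).comp hq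
    exact this
  have hc' : Continuous fun p : ℝ × Euc n => θ • rotGen (p.1 * θ) p.2 := hc0.const_smul θ
  have hd : ∀ (t : ℝ) (x : Euc n),
      HasDerivAt (fun t : ℝ => rotPt (t * θ) x) (θ • rotGen (t * θ) x) t := fun t x => by
    have := (rotPt_hasDerivAt (t * θ) x).scomp t ((hasDerivAt_id t).mul_const θ)
    rw [one_mul] at this
    exact this
  have := flow_L2 (fun t x => rotPt (t * θ) x) (fun t x => θ • rotGen (t * θ) x)
    (fun t => rotPt_mp hn _) hc hc' hd
    (by simp [rotPt_zero hn]) u hu (ENNReal.ofReal (|θ| * R)) (by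
      intro t x hx
      have h1 : rotPt (t * θ) x ∈ Metric.ball 0 R := by
        apply hs
        apply tsupport_fderiv_subset ℝ
        exact subset_tsupport _ hx
      rw [mem_ball_zero_iff, rotPt_norm hn] at h1
      rw [← ofReal_norm_eq_enorm, norm_smul, Real.norm_eq_abs]
      apply ENNReal.ofReal_le_ofReal
      gcongr
      exact (rotGen_norm hn _ _).trans h1.le)
  simpa using this

end Sob

section Rellich
open Filter Topology
open scoped ENNReal NNReal
variable {n : ℕ}

lemma avg_est (ν : Measure (Euc n)) [IsProbabilityMeasure ν] (ε : ℝ) (hν : ∀ᵐ h ∂ν, ‖h‖ ≤ ε)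
    (u : Euc n → ℝ) (hu : ContDiff ℝ 1 u) (hcs : HasCompactSupport u) :
    ∫⁻ x, ‖u x - ∫ h, u (x + h) ∂ν‖ₑ ^ 2 ≤ ENNReal.ofReal ε ^ 2 * ∫⁻ x, ‖fderiv ℝ u x‖ₑ ^ 2 := by
  have hc : Continuous u := hu.continuous
  obtain ⟨D, hD⟩ := hcs.exists_bound_of_continuous hc
  have hcx : ∀ x, Continuous fun h => u (x + h) := fun x => hc.comp (by fun_prop)
  have hint : ∀ x, Integrable (fun h => u (x + h)) ν := fun x =>
    Integrable.of_bound (hcx x).aestronglyMeasurable D (Filter.Eventually.of_forall fun h => hD _)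
  have hcp : Continuous fun p : Euc n × Euc n => u (p.1 + p.2) - u p.1 :=
    (hc.comp (by fun_prop : Continuous fun p : Euc n × Euc n => p.1 + p.2)).sub
      (hc.comp continuous_fst)
  have hpt : ∀ x, ‖u x - ∫ h, u (x + h) ∂ν‖ₑ ^ 2 ≤ ∫⁻ h, ‖u (x + h) - u x‖ₑ ^ 2 ∂ν := by
    intro x
    have e : u x - ∫ h, u (x + h) ∂ν = -∫ h, (u (x + h) - u x) ∂ν := by
      rw [integral_sub (hint x) (integrable_const _)]
      simp
    rw [e, enorm_neg]
    calc _ ≤ (∫⁻ h, ‖u (x + h) - u x‖ₑ ∂ν) ^ 2 := by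
          gcongr; exact enorm_integral_le_lintegral_enorm _
      _ ≤ _ := sq_lintegral_le _ _ ((hcx x).sub continuous_const).enorm.measurable.aemeasurable
  calc _ ≤ ∫⁻ x, ∫⁻ h, ‖u (x + h) - u x‖ₑ ^ 2 ∂ν := lintegral_mono hpt
    _ = ∫⁻ h, ∫⁻ x, ‖u (x + h) - u x‖ₑ ^ 2 ∂volume ∂ν := by
        apply lintegral_lintegral_swap
        exact (hcp.enorm.measurable.pow_const 2).aemeasurable
    _ ≤ ∫⁻ h, ENNReal.ofReal ε ^ 2 * ∫⁻ x, ‖fderiv ℝ u x‖ₑ ^ 2 ∂volume ∂ν := by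
        apply lintegral_mono_ae
        filter_upwards [hν] with h hh
        refine (transl_L2 u hu h).trans ?_
        gcongr
        rw [← ofReal_norm_eq_enorm]
        exact ENNReal.ofReal_le_ofReal hh
    _ = _ := by simp

lemma avg_tendsto (ν : Measure (Euc n)) [IsProbabilityMeasure ν] (ε : ℝ) (hν : ∀ᵐ h ∂ν, ‖h‖ ≤ ε)
    (D : ℝ≥0∞) (hD : D ≠ ∞) (hνD : ν ≤ D • volume)
    (φ : ℕ → Euc n → ℝ) (hφ : ∀ k, ContDiff ℝ 1 (φ k)) (R : ℝ)
    (hs : ∀ k, tsupport (φ k) ⊆ Metric.ball 0 R) (C : ℝ≥0∞) (hC : C ≠ ∞)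
    (h2 : ∀ k, ∫⁻ x, ‖φ k x‖ₑ ^ 2 ≤ C)
    (hw : ∀ x, Tendsto (fun k => ∫ h, φ k (x + h) ∂ν) atTop (𝓝 0)) :
    Tendsto (fun k => ∫⁻ x, ‖∫ h, φ k (x + h) ∂ν‖ₑ ^ 2) atTop (𝓝 0) := by
  have hc : ∀ k, Continuous (φ k) := fun k => (hφ k).continuous
  have hcp : ∀ k, Continuous fun p : Euc n × Euc n => φ k (p.1 + p.2) := fun k =>
    ((hc k).comp (by fun_prop : Continuous fun p : Euc n × Euc n => p.1 + p.2))
  have hmeas : ∀ k, Measurable fun x => ‖∫ h, φ k (x + h) ∂ν‖ₑ ^ 2 := fun k => by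
    have : StronglyMeasurable fun x => ∫ h, φ k (x + h) ∂ν :=
      StronglyMeasurable.integral_prod_right (f := fun x h => φ k (x + h))
        (hcp k).measurable.stronglyMeasurable
    exact this.measurable.enorm.pow_const 2
  have := tendsto_lintegral_of_dominated_convergence (μ := (volume : Measure (Euc n)))
    (F := fun k x => ‖∫ h, φ k (x + h) ∂ν‖ₑ ^ 2)
    (f := fun _ => 0)
    ((Metric.ball (0 : Euc n) (R + ε)).indicator fun _ => D * C) hmeas ?_ ?_ ?_
  · simpa using this
  · intro k
    refine Filter.Eventually.of_forall fun x => ?_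
    by_cases hx : x ∈ Metric.ball (0 : Euc n) (R + ε)
    · rw [Set.indicator_of_mem hx]
      have hcx : Continuous fun h => φ k (x + h) := (hc k).comp (by fun_prop)
      calc ‖∫ h, φ k (x + h) ∂ν‖ₑ ^ 2 ≤ (∫⁻ h, ‖φ k (x + h)‖ₑ ∂ν) ^ 2 := by
            gcongr; exact enorm_integral_le_lintegral_enorm _
        _ ≤ ∫⁻ h, ‖φ k (x + h)‖ₑ ^ 2 ∂ν := sq_lintegral_le _ _ hcx.enorm.measurable.aemeasurable
        _ ≤ ∫⁻ h, ‖φ k (x + h)‖ₑ ^ 2 ∂(D • volume) := lintegral_mono' hνD le_rfl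
        _ = D * ∫⁻ h, ‖φ k (x + h)‖ₑ ^ 2 := by rw [lintegral_smul_measure]; rfl
        _ = D * ∫⁻ h, ‖φ k h‖ₑ ^ 2 := by
            rw [lintegral_add_left_eq_self (fun h => ‖φ k h‖ₑ ^ 2) x]
        _ ≤ D * C := by gcongr; exact h2 k
    · rw [Set.indicator_of_notMem hx]
      have : ∫ h, φ k (x + h) ∂ν = 0 := by
        apply integral_eq_zero_of_ae
        filter_upwards [hν] with h hh
        by_contra hne
        have h3 : x + h ∈ Metric.ball 0 R := hs k (subset_tsupport _ hne)
        rw [mem_ball_zero_iff] at h3 hx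
        have : ‖x‖ ≤ ‖x + h‖ + ‖h‖ := by
          have := norm_sub_le (x + h) h
          simpa using this
        linarith
      simp [this]
  · rw [lintegral_indicator_const Metric.isOpen_ball.measurableSet]
    exact ENNReal.mul_ne_top (ENNReal.mul_ne_top hD hC) measure_ball_lt_top.ne
  · refine Filter.Eventually.of_forall fun x => ?_
    have := ENNReal.Tendsto.pow (n := 2) ((hw x).enorm)
    simpa using this

lemma rellich_seq 
    (φ : ℕ → Euc n → ℝ) (hφ : ∀ k, ContDiff ℝ 1 (φ k)) (R : ℝ)
    (hs : ∀ k, tsupport (φ k) ⊆ Metric.ball 0 R) (C : ℝ≥0∞) (hC : C ≠ ∞)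
    (h1 : ∀ k, ∫⁻ x, ‖fderiv ℝ (φ k) x‖ₑ ^ 2 ≤ C)
    (h2 : ∀ k, ∫⁻ x, ‖φ k x‖ₑ ^ 2 ≤ C)
    (hw : ∀ x ε, Tendsto (fun k => ∫ y in Metric.ball x ε, φ k y) atTop (𝓝 0)) :
    Tendsto (fun k => ∫⁻ x, ‖φ k x‖ₑ ^ 2) atTop (𝓝 0) := by
  rw [ENNReal.tendsto_nhds_zero]
  intro δ hδ
  obtain ⟨ε, hε, hεδ⟩ : ∃ ε : ℝ, 0 < ε ∧ 2 * (ENNReal.ofReal ε ^ 2 * C) ≤ δ / 2 := by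
    have ht : Tendsto (fun ε : ℝ => 2 * (ENNReal.ofReal ε ^ 2 * C)) (𝓝[>] 0) (𝓝 0) := by
      have h3 : Tendsto (fun ε : ℝ => ENNReal.ofReal ε) (𝓝[>] 0) (𝓝 0) := by
        have := (ENNReal.continuous_ofReal.tendsto (0:ℝ)).mono_left
          (nhdsWithin_le_nhds (s := Set.Ioi 0))
        simpa using this
      have h4 := ENNReal.Tendsto.const_mul (a := 2)
        (ENNReal.Tendsto.mul_const (b := C) (ENNReal.Tendsto.pow (n := 2) h3) (Or.inr hC)) (Or.inr (by simp))
      simpa using h4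
    rw [ENNReal.tendsto_nhds_zero] at ht
    have h5 := ht (δ / 2) (ENNReal.half_pos hδ.ne')
    obtain ⟨ε, h6, h7⟩ := (h5.and self_mem_nhdsWithin).exists
    exact ⟨ε, h7, h6⟩
  set B := Metric.ball (0 : Euc n) ε with hB
  have hB0 : volume B ≠ 0 := (Metric.measure_ball_pos volume 0 hε).ne'
  have hBt : volume B ≠ ∞ := measure_ball_lt_top.ne
  set ν : Measure (Euc n) := (volume B)⁻¹ • volume.restrict B with hνdef
  haveI : IsProbabilityMeasure ν := ⟨by
    simp [hνdef, ENNReal.inv_mul_cancel hB0 hBt]⟩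
  have hν : ∀ᵐ h ∂ν, ‖h‖ ≤ ε := by
    apply Measure.ae_smul_measure
    filter_upwards [ae_restrict_mem Metric.isOpen_ball.measurableSet] with h hh
    rw [mem_ball_zero_iff] at hh
    exact hh.le
  have hνD : ν ≤ (volume B)⁻¹ • volume := by
    rw [hνdef]
    intro s
    simp only [Measure.smul_apply, smul_eq_mul]
    gcongr
    exact Measure.restrict_le_self
  have hw' : ∀ x, Tendsto (fun k => ∫ h, φ k (x + h) ∂ν) atTop (𝓝 0) := by
    intro x
    have h3 := (hw x ε).const_mul ((volume B)⁻¹.toReal)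
    rw [mul_zero] at h3
    refine h3.congr fun k => ?_
    rw [hνdef, integral_smul_measure, smul_eq_mul]
    congr 1
    rw [← integral_indicator Metric.isOpen_ball.measurableSet, 
      ← integral_indicator Metric.isOpen_ball.measurableSet,
      ← integral_add_left_eq_self _ x]
    congr 1
    ext h
    simp [Set.indicator, hB, Metric.mem_ball, dist_eq_norm]
  have hlim := avg_tendsto ν ε hν _ (by simpa using hB0) hνD φ hφ R hs C hC h2 hw'
  rw [ENNReal.tendsto_nhds_zero] at hlim
  have h8 := hlim (δ / 4) (ENNReal.div_pos hδ.ne' (by simp))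
  filter_upwards [h8] with k hk
  have hcs : HasCompactSupport (φ k) := by
    apply HasCompactSupport.of_support_subset_isCompact (isCompact_closedBall (0 : Euc n) R)
    exact (subset_tsupport _).trans ((hs k).trans Metric.ball_subset_closedBall)
  have h9 := avg_est ν ε hν (φ k) (hφ k) hcs
  have hpt : ∀ x, ‖φ k x‖ₑ ^ 2 ≤ 2 * ‖φ k x - ∫ h, φ k (x + h) ∂ν‖ₑ ^ 2 
      + 2 * ‖∫ h, φ k (x + h) ∂ν‖ₑ ^ 2 := by
    intro x
    set a := ∫ h, φ k (x + h) ∂ν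
    have : (φ k x) ^ 2 ≤ 2 * (φ k x - a) ^ 2 + 2 * a ^ 2 := by nlinarith [sq_nonneg (φ k x - 2 * a)]
    have e : ∀ t : ℝ, ‖t‖ₑ ^ 2 = ENNReal.ofReal (t ^ 2) := fun t => by
      rw [← ofReal_norm_eq_enorm, ← ENNReal.ofReal_pow (norm_nonneg _)]; simp
    rw [e, e, e, show (2:ℝ≥0∞) = ENNReal.ofReal 2 by simp, ← ENNReal.ofReal_mul (by norm_num),
      ← ENNReal.ofReal_mul (by norm_num), ← ENNReal.ofReal_add (by positivity) (by positivity)]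
    exact ENNReal.ofReal_le_ofReal this
  have hmeas : Measurable fun x => ‖∫ h, φ k (x + h) ∂ν‖ₑ ^ 2 := by
    have hcp : Continuous fun p : Euc n × Euc n => φ k (p.1 + p.2) := 
      ((hφ k).continuous.comp (by fun_prop : Continuous fun p : Euc n × Euc n => p.1 + p.2))
    have : StronglyMeasurable fun x => ∫ h, φ k (x + h) ∂ν :=
      StronglyMeasurable.integral_prod_right (f := fun x h => φ k (x + h))
        hcp.measurable.stronglyMeasurable
    exact this.measurable.enorm.pow_const 2
  calc ∫⁻ x, ‖φ k x‖ₑ ^ 2 ≤ ∫⁻ x, (2 * ‖φ k x - ∫ h, φ k (x + h) ∂ν‖ₑ ^ 2 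
      + 2 * ‖∫ h, φ k (x + h) ∂ν‖ₑ ^ 2) := lintegral_mono hpt
    _ = 2 * (∫⁻ x, ‖φ k x - ∫ h, φ k (x + h) ∂ν‖ₑ ^ 2)
      + 2 * ∫⁻ x, ‖∫ h, φ k (x + h) ∂ν‖ₑ ^ 2 := by
        rw [lintegral_add_right _ (hmeas.const_mul _), lintegral_const_mul' _ _ (by simp),
          lintegral_const_mul' _ _ (by simp)]
    _ ≤ 2 * (ENNReal.ofReal ε ^ 2 * C) + 2 * (δ / 4) := by
        gcongr
        refine h9.trans ?_
        gcongr
        exact h1 k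
    _ ≤ δ / 2 + δ / 2 := by
        gcongr
        rw [← mul_div_assoc, mul_comm, mul_div_assoc]
        apply le_of_eq
        rw [div_eq_mul_inv, div_eq_mul_inv]
        congr 1
        rw [show (4:ℝ≥0∞) = 2 * 2 by norm_num, ENNReal.mul_inv (by simp) (by simp), ← mul_assoc,
          ENNReal.mul_inv_cancel (by simp) (by simp), one_mul]
    _ = δ := ENNReal.add_halves δ

end Rellich

section SpaceH
open Filter Topology
open scoped ENNReal NNReal
variable {n : ℕ}

abbrev L2 (n : ℕ) := Lp ℝ 2 (volume : Measure (Euc n))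
abbrev XX (n : ℕ) := PiLp 2 (fun _ : Option (Fin n) => L2 n)

/-- compactly supported `C¹` functions in `Ω` -/
def IsTest (Ω : Set (Euc n)) (φ : Euc n → ℝ) : Prop :=
  ContDiff ℝ 1 φ ∧ HasCompactSupport φ ∧ tsupport φ ⊆ Ω

def Anti (θ : ℝ) (φ : Euc n → ℝ) : Prop := ∀ x, φ (rotPt θ x) = -φ x

/-- `x` is the pair (function, gradient) of `φ` -/
def FRep (φ : Euc n → ℝ) (x : XX n) : Prop :=
  x none =ᵐ[volume] φ ∧ ∀ i, x (some i) =ᵐ[volume] fun y => fderiv ℝ φ y (bv i)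

def Gr2 (x : XX n) : ℝ := ∑ i, ‖x (some i)‖ ^ 2

lemma norm_sq_XX (x : XX n) : ‖x‖ ^ 2 = ‖x none‖ ^ 2 + Gr2 x := by
  rw [PiLp.norm_sq_eq_of_L2, Fintype.sum_option]; rfl

lemma Gr2_nonneg (x : XX n) : 0 ≤ Gr2 x := Finset.sum_nonneg fun _ _ => by positivity

lemma eLp2 {α F : Type*} [MeasurableSpace α] [NormedAddCommGroup F] (μ : Measure α) (f : α → F) :
    eLpNorm f 2 μ ^ 2 = ∫⁻ x, ‖f x‖ₑ ^ 2 ∂μ := by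
  have := eLpNorm_nnreal_pow_eq_lintegral (μ := μ) (f := f) (p := 2) (by norm_num)
  simpa using this

lemma L2_lintegral (f : L2 n) : ∫⁻ y, ‖f y‖ₑ ^ 2 = ENNReal.ofReal (‖f‖ ^ 2) := by
  rw [← eLp2, ENNReal.ofReal_pow (norm_nonneg _), Lp.norm_def, ENNReal.ofReal_toReal (Lp.eLpNorm_ne_top f)]

lemma rep_lintegral {φ : Euc n → ℝ} {x : XX n} (h : FRep φ x) :
    ∫⁻ y, ‖φ y‖ₑ ^ 2 = ENNReal.ofReal (‖x none‖ ^ 2) := by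
  rw [← L2_lintegral]
  apply lintegral_congr_ae
  filter_upwards [h.1] with y hy
  rw [hy]

lemma rep_lintegral_fderiv {φ : Euc n → ℝ} {x : XX n} (h : FRep φ x) :
    ∫⁻ y, ‖fderiv ℝ φ y‖ₑ ^ 2 = ENNReal.ofReal (Gr2 x) := by
  have e : ∀ y, ‖fderiv ℝ φ y‖ₑ ^ 2 = ∑ i, ‖fderiv ℝ φ y (bv i)‖ₑ ^ 2 := by
    intro y
    rw [← ofReal_norm_eq_enorm, ← ENNReal.ofReal_pow (norm_nonneg _), dual_norm_sq,
      ENNReal.ofReal_sum_of_nonneg (fun _ _ => by positivity)]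
    apply Finset.sum_congr rfl
    intro i _
    rw [← ofReal_norm_eq_enorm, ← ENNReal.ofReal_pow (norm_nonneg _)]
    simp
  calc _ = ∫⁻ y, ∑ i, ‖(x (some i)) y‖ₑ ^ 2 := by
        apply lintegral_congr_ae
        filter_upwards [ae_all_iff.mpr h.2] with y hy
        rw [e]
        apply Finset.sum_congr rfl
        intro i _
        rw [hy i]
    _ = ∑ i, ∫⁻ y, ‖(x (some i)) y‖ₑ ^ 2 := by
        apply lintegral_finsetSum
        intro i _
        exact (Lp.stronglyMeasurable _).measurable.enorm.pow_const 2
    _ = _ := by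
        simp only [L2_lintegral]
        rw [Gr2, ENNReal.ofReal_sum_of_nonneg (fun _ _ => by positivity)]

lemma rep_exists {Ω : Set (Euc n)} {φ : Euc n → ℝ} (h : IsTest Ω φ) : ∃ x, FRep φ x := by
  have h0 : MemLp φ 2 volume := h.1.continuous.memLp_of_hasCompactSupport h.2.1
  have h1 : ∀ i, MemLp (fun y => fderiv ℝ φ y (bv i)) 2 volume := fun i => by
    apply Continuous.memLp_of_hasCompactSupport
    · exact (h.1.continuous_fderiv (by norm_num)).clm_apply continuous_const
    · exact (h.2.1.fderiv_apply ℝ (bv i))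
  refine ⟨WithLp.toLp 2 fun o => match o with
    | none => h0.toLp
    | some i => (h1 i).toLp, h0.coeFn_toLp, fun i => (h1 i).coeFn_toLp⟩

lemma IsTest.add {Ω : Set (Euc n)} {φ ψ : Euc n → ℝ} (h : IsTest Ω φ) (h' : IsTest Ω ψ) :
    IsTest Ω (φ + ψ) :=
  ⟨h.1.add h'.1, h.2.1.add h'.2.1, (tsupport_add φ ψ).trans (Set.union_subset h.2.2 h'.2.2)⟩

lemma IsTest.smul {Ω : Set (Euc n)} {φ : Euc n → ℝ} (c : ℝ) (h : IsTest Ω φ) :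
    IsTest Ω (c • φ) :=
  ⟨h.1.const_smul c, h.2.1.smul_left (f := fun _ => c), 
    (tsupport_smul_subset_right (fun _ => c) φ).trans h.2.2⟩

lemma FRep.add {φ ψ : Euc n → ℝ} {x y : XX n} (h : FRep φ x) (h' : FRep ψ y)
    (hd : Differentiable ℝ φ) (hd' : Differentiable ℝ ψ) : FRep (φ + ψ) (x + y) := by
  refine ⟨?_, fun i => ?_⟩
  · filter_upwards [h.1, h'.1, Lp.coeFn_add (x none) (y none)] with z h1 h2 h3
    rw [PiLp.add_apply, h3, Pi.add_apply, Pi.add_apply, h1, h2]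
  · filter_upwards [h.2 i, h'.2 i, Lp.coeFn_add (x (some i)) (y (some i))] with z h1 h2 h3
    rw [PiLp.add_apply, h3, Pi.add_apply, h1, h2, fderiv_add (hd z) (hd' z)]
    rfl

lemma FRep.smul {φ : Euc n → ℝ} {x : XX n} (c : ℝ) (h : FRep φ x) : FRep (c • φ) (c • x) := by
  refine ⟨?_, fun i => ?_⟩
  · filter_upwards [h.1, Lp.coeFn_smul c (x none)] with z h1 h3
    rw [PiLp.smul_apply, h3, Pi.smul_apply, Pi.smul_apply, h1]
  · filter_upwards [h.2 i, Lp.coeFn_smul c (x (some i))] with z h1 h3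
    rw [PiLp.smul_apply, h3, Pi.smul_apply, h1, fderiv_const_smul_field]
    rfl

lemma FRep.unique {φ : Euc n → ℝ} {x y : XX n} (h : FRep φ x) (h' : FRep φ y) : x = y := by
  ext1 o
  rcases o with _ | i
  · exact Lp.ext (h.1.trans h'.1.symm)
  · exact Lp.ext ((h.2 i).trans (h'.2 i).symm)

lemma isTest_zero (Ω : Set (Euc n)) : IsTest Ω (0 : Euc n → ℝ) :=
  ⟨contDiff_const, HasCompactSupport.zero, by simp [tsupport]⟩

lemma rep_zero : FRep (0 : Euc n → ℝ) 0 := by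
  refine ⟨?_, fun i => ?_⟩
  · exact Lp.coeFn_zero _ _ _
  · filter_upwards [Lp.coeFn_zero ℝ 2 (volume : Measure (Euc n))] with z h
    rw [PiLp.zero_apply, h]
    simp

/-- the (non closed) space of antisymmetric test functions -/
def Hsub (Ω : Set (Euc n)) (θ : ℝ) : Submodule ℝ (XX n) where
  carrier := {x | ∃ φ, IsTest Ω φ ∧ Anti θ φ ∧ FRep φ x}
  zero_mem' := ⟨0, isTest_zero Ω, fun x => by simp, rep_zero⟩
  add_mem' := by
    rintro x y ⟨φ, h1, h2, h3⟩ ⟨ψ, g1, g2, g3⟩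
    exact ⟨φ + ψ, h1.add g1, fun z => by
      simp only [Pi.add_apply, h2 z, g2 z]; ring, h3.add g3 (h1.1.differentiable (by norm_num))
        (g1.1.differentiable (by norm_num))⟩
  smul_mem' := by
    rintro c x ⟨φ, h1, h2, h3⟩
    exact ⟨c • φ, h1.smul c, fun z => by simp [h2 z], h3.smul c⟩

abbrev HH (Ω : Set (Euc n)) (θ : ℝ) : Submodule ℝ (XX n) := (Hsub Ω θ).topologicalClosure

lemma HH_seq {Ω : Set (Euc n)} {θ : ℝ} {x : XX n} (hx : x ∈ HH Ω θ) :
    ∃ (φ : ℕ → Euc n → ℝ) (y : ℕ → XX n), (∀ k, IsTest Ω (φ k)) ∧ (∀ k, Anti θ (φ k)) ∧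
      (∀ k, FRep (φ k) (y k)) ∧ Tendsto y atTop (𝓝 x) := by
  rw [← SetLike.mem_coe, Submodule.topologicalClosure_coe] at hx
  obtain ⟨y, hy, hlim⟩ := mem_closure_iff_seq_limit.mp hx
  choose φ h1 h2 h3 using hy
  exact ⟨φ, y, h1, h2, h3, hlim⟩

lemma tendsto_comp_XX {y : ℕ → XX n} {x : XX n} (h : Tendsto y atTop (𝓝 x)) (o : Option (Fin n)) :
    Tendsto (fun k => y k o) atTop (𝓝 (x o)) :=
  (PiLp.continuous_apply 2 (fun _ : Option (Fin n) => L2 n) o).continuousAt.tendsto.comp h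

lemma Gr2_continuous : Continuous (Gr2 : XX n → ℝ) := by
  unfold Gr2
  refine continuous_finsetSum _ fun i _ => ?_
  exact ((PiLp.continuous_apply 2 (fun _ : Option (Fin n) => L2 n) (some i)).norm).pow 2

/-- additionally the approximants converge a.e. -/
lemma HH_seq_ae {Ω : Set (Euc n)} {θ : ℝ} {x : XX n} (hx : x ∈ HH Ω θ) :
    ∃ (φ : ℕ → Euc n → ℝ) (y : ℕ → XX n), (∀ k, IsTest Ω (φ k)) ∧ (∀ k, Anti θ (φ k)) ∧
      (∀ k, FRep (φ k) (y k)) ∧ Tendsto y atTop (𝓝 x) ∧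
      ∀ᵐ z, Tendsto (fun k => φ k z) atTop (𝓝 (x none z)) := by
  obtain ⟨φ, y, h1, h2, h3, h4⟩ := HH_seq hx
  obtain ⟨ns, hns, hae⟩ := (tendstoInMeasure_of_tendsto_Lp
    (tendsto_comp_XX h4 none)).exists_seq_tendsto_ae
  refine ⟨fun k => φ (ns k), fun k => y (ns k), fun k => h1 _, fun k => h2 _, fun k => h3 _,
    h4.comp hns.tendsto_atTop, ?_⟩
  filter_upwards [hae, ae_all_iff.mpr fun k => (h3 (ns k)).1] with z hz hz'
  exact hz.congr fun k => hz' k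

lemma HH_anti (hn : n = 2 ∨ n = 3) {Ω : Set (Euc n)} {θ : ℝ} {x : XX n} (hx : x ∈ HH Ω θ) :
    ∀ᵐ z, x none (rotPt θ z) = - x none z := by
  obtain ⟨φ, y, h1, h2, h3, h4, h5⟩ := HH_seq_ae hx
  have h6 := (rotPt_mp hn θ).quasiMeasurePreserving.ae h5
  filter_upwards [h5, h6] with z hz hz'
  refine tendsto_nhds_unique hz' ?_
  simp_rw [h2 _ z]
  exact hz.neg

lemma HH_supp {Ω : Set (Euc n)} {θ : ℝ} {x : XX n} (hx : x ∈ HH Ω θ) :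
    ∀ᵐ z, z ∉ Ω → x none z = 0 := by
  obtain ⟨φ, y, h1, h2, h3, h4, h5⟩ := HH_seq_ae hx
  filter_upwards [h5] with z hz hzΩ
  have : ∀ k, φ k z = 0 := fun k => by
    by_contra hne
    exact hzΩ ((h1 k).2.2 (subset_tsupport _ hne))
  simp_rw [this] at hz
  exact tendsto_nhds_unique hz tendsto_const_nhds

lemma HH_gns (hn : n = 2 ∨ n = 3) (R : ℝ) : ∃ C : ℝ≥0, ∀ q : ℝ≥0, (q = 4 ∨ q = 6) →
    ∀ (Ω : Set (Euc n)) (θ : ℝ), Ω ⊆ Metric.ball 0 R → ∀ x ∈ HH Ω θ,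
      eLpNorm (x none) q volume ≤ C * ENNReal.ofReal (√ (Gr2 x)) := by
  obtain ⟨C, hC⟩ := gns hn R
  refine ⟨C, fun q hq Ω θ hΩ x hx => ?_⟩
  obtain ⟨φ, y, h1, h2, h3, h4, h5⟩ := HH_seq_ae hx
  have hle := Lp.eLpNorm_lim_le_liminf_eLpNorm (p := (q : ℝ≥0∞)) (μ := volume)
    (fun k => (h1 k).1.continuous.aestronglyMeasurable) _ h5
  refine hle.trans ?_
  have hb : ∀ k, eLpNorm (φ k) q volume ≤ C * ENNReal.ofReal (√ (Gr2 (y k))) := fun k => by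
    refine (hC q hq (φ k) (h1 k).1 ((h1 k).2.2.trans hΩ)).trans ?_
    gcongr
    have h7 := rep_lintegral_fderiv (h3 k)
    rw [← eLp2] at h7
    rw [← ENNReal.pow_le_pow_left_iff (n := 2) (by norm_num), h7, ← ENNReal.ofReal_pow (by positivity),
      Real.sq_sqrt (Gr2_nonneg _)]
  have ht : Tendsto (fun k => C * ENNReal.ofReal (√ (Gr2 (y k)))) atTop
      (𝓝 (C * ENNReal.ofReal (√ (Gr2 x)))) := by
    apply ENNReal.Tendsto.const_mul _ (Or.inr (by simp))
    apply ENNReal.tendsto_ofReal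
    exact ((Real.continuous_sqrt.comp Gr2_continuous).tendsto x).comp h4
  rw [← ht.liminf_eq]
  exact liminf_le_liminf (Filter.Eventually.of_forall hb)

lemma HH_rot (hn : n = 2 ∨ n = 3) (R θ : ℝ) (hR : 0 ≤ R) (Ω : Set (Euc n)) (hΩ : Ω ⊆ Metric.ball 0 R)
    (x : XX n) (hx : x ∈ HH Ω θ) : 2 * ‖x none‖ ≤ |θ| * R * √ (Gr2 x) := by
  obtain ⟨φ, y, h1, h2, h3, h4⟩ := HH_seq hx
  have hb : ∀ k, 2 * ‖y k none‖ ≤ |θ| * R * √ (Gr2 (y k)) := fun k => by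
    have := rot_L2 hn (φ k) (h1 k).1 θ R ((h1 k).2.2.trans hΩ)
    rw [rep_lintegral_fderiv (h3 k)] at this
    have e : ∀ z, ‖φ k (rotPt θ z) - φ k z‖ₑ ^ 2 = 4 * ‖φ k z‖ₑ ^ 2 := fun z => by
      rw [h2 k z, show - φ k z - φ k z = (-2 : ℝ) * φ k z by ring, enorm_mul, mul_pow]
      congr 1
      rw [enorm_neg, ← ofReal_norm_eq_enorm]
      norm_num
    simp_rw [e] at this
    rw [lintegral_const_mul' _ _ (by norm_num), rep_lintegral (h3 k), 
      show (4:ℝ≥0∞) = ENNReal.ofReal 4 by simp, ← ENNReal.ofReal_mul (by norm_num),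
      ← ENNReal.ofReal_pow (by positivity), ← ENNReal.ofReal_mul (by positivity),
      ENNReal.ofReal_le_ofReal_iff (by have := Gr2_nonneg (y k); positivity)] at this
    apply le_of_sq_le_sq _ (by positivity)
    rw [mul_pow, mul_pow, Real.sq_sqrt (Gr2_nonneg _)]
    linarith
  have t1 := ((tendsto_comp_XX h4 none).norm).const_mul 2
  have t2 := (((Real.continuous_sqrt.comp Gr2_continuous).tendsto x).comp h4).const_mul (|θ| * R)
  exact le_of_tendsto_of_tendsto' t1 t2 hb

end SpaceH

section OpM
open Filter Topology
open scoped ENNReal NNReal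
variable {n : ℕ}

lemma L2_inner_eq (f g : L2 n) : inner ℝ f g = ∫ x, f x * g x := by
  rw [L2.inner_def]
  apply integral_congr_ae
  refine Filter.Eventually.of_forall fun x => ?_
  simp [mul_comm]

lemma L2_inner_toLp (f : L2 n) {ψ : Euc n → ℝ} (hψ : MemLp ψ 2 volume) :
    inner ℝ f hψ.toLp = ∫ x, f x * ψ x := by
  rw [L2_inner_eq]
  apply integral_congr_ae
  filter_upwards [hψ.coeFn_toLp] with x hx
  rw [hx]

lemma test_memLp {ψ : Euc n → ℝ} (h1 : Continuous ψ) (h2 : HasCompactSupport ψ) (p : ℝ≥0∞) :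
    MemLp ψ p volume := h1.memLp_of_hasCompactSupport h2

lemma test_fderiv_cont {ψ : Euc n → ℝ} (h1 : ContDiff ℝ 1 ψ) (v : Euc n) :
    Continuous fun x => fderiv ℝ ψ x v :=
  (h1.continuous_fderiv (by norm_num)).clm_apply continuous_const

lemma HH_ibp {Ω : Set (Euc n)} {θ : ℝ} {x : XX n} (hx : x ∈ HH Ω θ) (i : Fin n)
    {ψ : Euc n → ℝ} (h1 : ContDiff ℝ 1 ψ) (h2 : HasCompactSupport ψ) :
    ∫ z, x (some i) z * ψ z = - ∫ z, x none z * fderiv ℝ ψ z (bv i) := by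
  obtain ⟨φ, y, g1, g2, g3, g4⟩ := HH_seq hx
  have hψ : MemLp ψ 2 volume := test_memLp h1.continuous h2 2
  have hψ' : MemLp (fun z => fderiv ℝ ψ z (bv i)) 2 volume :=
    test_memLp (test_fderiv_cont h1 _) (h2.fderiv_apply ℝ (bv i)) 2
  rw [← L2_inner_toLp _ hψ, ← L2_inner_toLp _ hψ']
  have t1 := (tendsto_comp_XX g4 (some i)).inner (𝕜 := ℝ) (tendsto_const_nhds (x := hψ.toLp))
  have t2 := ((tendsto_comp_XX g4 none).inner (𝕜 := ℝ) (tendsto_const_nhds (x := hψ'.toLp))).neg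
  refine tendsto_nhds_unique t1 (t2.congr fun k => ?_)
  rw [L2_inner_toLp, L2_inner_toLp]
  have e1 : ∫ z, y k (some i) z * ψ z = ∫ z, fderiv ℝ (φ k) z (bv i) * ψ z := by
    apply integral_congr_ae
    filter_upwards [(g3 k).2 i] with z hz
    rw [hz]
  have e2 : ∫ z, y k none z * fderiv ℝ ψ z (bv i) = ∫ z, φ k z * fderiv ℝ ψ z (bv i) := by
    apply integral_congr_ae
    filter_upwards [(g3 k).1] with z hz
    rw [hz]
  rw [e1, e2]
  have hφc := (g1 k).1.continuous
  have hφd := test_fderiv_cont (g1 k).1 (bv i)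
  rw [integral_mul_fderiv_eq_neg_fderiv_mul_of_integrable (μ := volume)
    ((hφd.mul h1.continuous).integrable_of_hasCompactSupport h2.mul_left)
    ((hφc.mul (test_fderiv_cont h1 _)).integrable_of_hasCompactSupport (g1 k).2.1.mul_right)
    ((hφc.mul h1.continuous).integrable_of_hasCompactSupport h2.mul_left)
    (fun z _ => (g1 k).1.differentiable (by norm_num) z)
    (fun z _ => h1.differentiable (by norm_num) z), neg_neg]

lemma HH_eq_zero {Ω : Set (Euc n)} {θ : ℝ} {x : XX n} (hx : x ∈ HH Ω θ) (h0 : x none = 0) :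
    x = 0 := by
  ext1 o
  rcases o with _ | i
  · exact h0
  · apply Lp.ext
    rw [PiLp.zero_apply]
    refine EventuallyEq.trans ?_ (Lp.coeFn_zero _ _ _).symm
    refine ae_eq_zero_of_integral_contDiff_smul_eq_zero ?_ ?_
    · exact (Lp.memLp (x (some i))).locallyIntegrable (by norm_num)
    · intro g hg hgs
      have := HH_ibp hx i (hg.of_le (by exact_mod_cast le_top)) hgs
      simp only [smul_eq_mul]
      simp_rw [mul_comm (g _)]
      rw [this, neg_eq_zero]
      apply integral_eq_zero_of_ae
      rw [h0]
      filter_upwards [Lp.coeFn_zero ℝ 2 (volume : Measure (Euc n))] with z hz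
      rw [hz]; simp

lemma interp {f : Euc n → ℝ} (hf : AEStronglyMeasurable f volume) :
    eLpNorm f 4 volume ^ 4 ≤ eLpNorm f 2 volume * eLpNorm f 6 volume ^ 3 := by
  have e : ∀ p : ℕ, p ≠ 0 → eLpNorm f p volume ^ p = ∫⁻ x, ‖f x‖ₑ ^ p := fun p hp => by
    have := eLpNorm_nnreal_pow_eq_lintegral (μ := volume) (f := f) (p := p) (by simpa using hp)
    simpa using this
  have h := ENNReal.lintegral_mul_le_Lp_mul_Lq volume (Real.HolderConjugate.two_two) hf.enorm
    (hf.enorm.pow_const 3)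
  have e4 := e 4 (by norm_num)
  have e2 := e 2 (by norm_num)
  have e6 := e 6 (by norm_num)
  norm_num at e4 e2 e6
  rw [e4]
  calc ∫⁻ x, ‖f x‖ₑ ^ 4 = ∫⁻ x, ‖f x‖ₑ * ‖f x‖ₑ ^ 3 := by
        congr 1; ext x; ring
    _ ≤ _ := h
    _ = _ := by
      have a1 : ∀ a : ℝ≥0∞, a ^ (2:ℝ) = a ^ 2 := fun a => by
        rw [← ENNReal.rpow_natCast]; norm_num
      simp_rw [a1, ← pow_mul]
      norm_num
      rw [← e2, ← e6]
      congr 1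
      · rw [← ENNReal.rpow_natCast, ← ENNReal.rpow_mul]; norm_num
      · rw [← ENNReal.rpow_natCast, ← ENNReal.rpow_mul, ← ENNReal.rpow_natCast]; norm_num

instance fact_one_le_four : Fact ((1:ℝ≥0∞) ≤ 4) := ⟨by norm_num⟩

instance holder442 : ENNReal.HolderTriple 4 4 2 := ⟨by
  rw [← two_mul, show (4:ℝ≥0∞) = 2 * 2 by norm_num, ENNReal.mul_inv (by simp) (by simp),
    ← mul_assoc, ENNReal.mul_inv_cancel (by simp) (by simp), one_mul]⟩

lemma HH_L4 (hn : n = 2 ∨ n = 3) (R : ℝ) : ∃ C : ℝ≥0, 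
    ∀ (Ω : Set (Euc n)) (θ : ℝ), Ω ⊆ Metric.ball 0 R → ∀ x ∈ HH Ω θ,
      eLpNorm (x none) 4 volume ≤ C * ENNReal.ofReal ‖x‖ ∧
      eLpNorm (x none) 6 volume ≤ C * ENNReal.ofReal (√ (Gr2 x)) := by
  obtain ⟨C, hC⟩ := HH_gns hn R
  refine ⟨C, fun Ω θ hΩ x hx => ⟨?_, ?_⟩⟩
  · refine (hC 4 (Or.inl rfl) Ω θ hΩ x hx).trans ?_
    gcongr
    apply Real.sqrt_le_iff.mpr ⟨norm_nonneg _, ?_⟩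
    rw [norm_sq_XX]
    nlinarith [sq_nonneg ‖x none‖]
  · exact hC 6 (Or.inr rfl) Ω θ hΩ x hx

lemma T4_exists (hn : n = 2 ∨ n = 3) (R : ℝ) (Ω : Set (Euc n)) (θ : ℝ)
    (hΩ : Ω ⊆ Metric.ball 0 R) :
    ∃ T : HH Ω θ →L[ℝ] Lp ℝ 4 (volume : Measure (Euc n)), 
      ∀ x : HH Ω θ, T x =ᵐ[volume] (x : XX n) none := by
  obtain ⟨C, hC⟩ := HH_L4 hn R
  have hmem : ∀ x : HH Ω θ, MemLp ((x : XX n) none) 4 volume := fun x =>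
    ⟨(Lp.memLp _).1, ((hC Ω θ hΩ x x.2).1).trans_lt (by finiteness)⟩
  let T0 : HH Ω θ →ₗ[ℝ] Lp ℝ 4 (volume : Measure (Euc n)) :=
    { toFun := fun x => (hmem x).toLp
      map_add' := fun x y => by
        rw [← MemLp.toLp_add]
        apply MemLp.toLp_congr
        exact Lp.coeFn_add _ _
      map_smul' := fun c x => by
        rw [RingHom.id_apply, ← MemLp.toLp_const_smul]
        apply MemLp.toLp_congr
        exact Lp.coeFn_smul _ _ }
  refine ⟨T0.mkContinuous C fun x => ?_, fun x => (hmem x).coeFn_toLp⟩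
  change ‖(hmem x).toLp‖ ≤ _
  rw [Lp.norm_toLp]
  have := ENNReal.toReal_mono (by finiteness) (hC Ω θ hΩ x x.2).1
  simpa using this

end OpM

section OpN
open Filter Topology
open scoped ENNReal NNReal
variable {n : ℕ}

instance HH_complete (Ω : Set (Euc n)) (θ : ℝ) : CompleteSpace (HH Ω θ) :=
  Submodule.topologicalClosure.completeSpace _

/-- evaluation of the function component -/
def ev0 (Ω : Set (Euc n)) (θ : ℝ) : HH Ω θ →L[ℝ] L2 n :=
  (PiLp.proj 2 (fun _ : Option (Fin n) => L2 n) none).comp (HH Ω θ).subtypeL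

lemma ev0_apply (Ω : Set (Euc n)) (θ : ℝ) (x : HH Ω θ) : ev0 Ω θ x = (x : XX n) none := rfl

lemma weak_ev0 {Ω : Set (Euc n)} {θ : ℝ} (d : ℕ → HH Ω θ)
    (hw : ∀ y, Tendsto (fun k => inner ℝ (d k) y) atTop (𝓝 0)) (g : L2 n) :
    Tendsto (fun k => inner ℝ g ((d k : XX n) none)) atTop (𝓝 0) := by
  let L : HH Ω θ →L[ℝ] ℝ := (innerSL ℝ g).comp (ev0 Ω θ)
  refine (hw ((InnerProductSpace.toDual ℝ (HH Ω θ)).symm L)).congr fun k => ?_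
  rw [real_inner_comm, InnerProductSpace.toDual_symm_apply]
  rfl

lemma HH_compact (R : ℝ) {Ω : Set (Euc n)} {θ : ℝ} (hΩ : Ω ⊆ Metric.ball 0 R) (d : ℕ → HH Ω θ)
    (C : ℝ) (hC : ∀ k, ‖d k‖ ≤ C)
    (hw : ∀ y, Tendsto (fun k => inner ℝ (d k) y) atTop (𝓝 0)) :
    Tendsto (fun k => ‖(d k : XX n) none‖) atTop (𝓝 0) := by
  have hex : ∀ k : ℕ, ∃ y ∈ Hsub Ω θ, ‖(d k : XX n) - y‖ < 1 / ((k : ℝ) + 1) := fun k => by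
    have h1 := (d k).2
    rw [← SetLike.mem_coe, Submodule.topologicalClosure_coe] at h1
    obtain ⟨y, hy, h2⟩ := Metric.mem_closure_iff.mp h1 (1 / ((k : ℝ) + 1)) (by positivity)
    exact ⟨y, hy, by rwa [← dist_eq_norm]⟩
  choose y hy hdy using hex
  choose φ h1 h2 h3 using hy
  have hd0 : Tendsto (fun k => ‖(d k : XX n) - y k‖) atTop (𝓝 0) :=
    squeeze_zero (fun _ => norm_nonneg _) (fun k => (hdy k).le) tendsto_one_div_add_atTop_nhds_zero_nat
  have hcomp : ∀ k, ‖(d k : XX n) none - y k none‖ ≤ ‖(d k : XX n) - y k‖ := fun k => by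
    have := PiLp.norm_apply_le ((d k : XX n) - y k) none
    exact this
  have hd1 : Tendsto (fun k => ‖(d k : XX n) none - y k none‖) atTop (𝓝 0) :=
    squeeze_zero (fun _ => norm_nonneg _) hcomp hd0
  have hyC : ∀ k, ‖y k‖ ^ 2 ≤ (C + 1) ^ 2 := fun k => by
    have hle : ‖y k‖ ≤ C + 1 := by
      have e : y k = (d k : XX n) - ((d k : XX n) - y k) := by abel
      rw [e]
      refine (norm_sub_le _ _).trans (add_le_add (hC k) ((hdy k).le.trans ?_))
      rw [div_le_one (by positivity)]
      linarith [Nat.cast_nonneg (α := ℝ) k]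
    exact pow_le_pow_left₀ (norm_nonneg _) hle 2
  have key : Tendsto (fun k => ∫⁻ x, ‖φ k x‖ₑ ^ 2) atTop (𝓝 0) := by
    refine rellich_seq φ (fun k => (h1 k).1) R (fun k => (h1 k).2.2.trans hΩ)
      (ENNReal.ofReal ((C + 1) ^ 2)) ENNReal.ofReal_ne_top (fun k => ?_) (fun k => ?_) ?_
    · rw [rep_lintegral_fderiv (h3 k)]
      apply ENNReal.ofReal_le_ofReal
      have := norm_sq_XX (y k)
      nlinarith [hyC k, sq_nonneg ‖y k none‖]
    · rw [rep_lintegral (h3 k)]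
      apply ENNReal.ofReal_le_ofReal
      have := norm_sq_XX (y k)
      nlinarith [hyC k, Gr2_nonneg (y k)]
    · intro x ε
      let g : L2 n := indicatorConstLp 2 (measurableSet_ball (x := x) (ε := ε))
        (measure_ball_lt_top (μ := volume)).ne 1
      have t1 := weak_ev0 d hw g
      have t2 : Tendsto (fun k => inner ℝ g ((d k : XX n) none - y k none)) atTop (𝓝 0) := by
        rw [← tendsto_zero_iff_norm_tendsto_zero] at hd1
        have := (tendsto_const_nhds (x := g)).inner (𝕜 := ℝ) hd1
        simpa using this
      have t3 := t1.sub t2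
      rw [sub_zero] at t3
      refine t3.congr fun k => ?_
      rw [← inner_sub_right, sub_sub_cancel]
      have : inner ℝ g (y k none) = ∫ z in Metric.ball x ε, y k none z :=
        L2.inner_indicatorConstLp_one (𝕜 := ℝ) measurableSet_ball _ _
      rw [this]
      apply integral_congr_ae
      exact ae_restrict_of_ae (h3 k).1
  have hy0 : Tendsto (fun k => ‖y k none‖) atTop (𝓝 0) := by
    have e : ∀ k, ‖y k none‖ = √ ((∫⁻ x, ‖φ k x‖ₑ ^ 2).toReal) := fun k => by
      rw [rep_lintegral (h3 k), ENNReal.toReal_ofReal (by positivity), Real.sqrt_sq (norm_nonneg _)]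
    simp_rw [e]
    have := (ENNReal.tendsto_toReal ENNReal.zero_ne_top).comp key
    have := (Real.continuous_sqrt.tendsto _).comp this
    simp only [ENNReal.toReal_zero, Real.sqrt_zero] at this
    exact this
  have := hd1.add hy0
  rw [add_zero] at this
  refine squeeze_zero (fun _ => norm_nonneg _) (fun k => ?_) this
  have := norm_add_le ((d k : XX n) none - y k none) (y k none)
  rwa [sub_add_cancel] at this

lemma T4_compact (hn : n = 2 ∨ n = 3) (R : ℝ) {Ω : Set (Euc n)} {θ : ℝ}
    (hΩ : Ω ⊆ Metric.ball 0 R) (T : HH Ω θ →L[ℝ] Lp ℝ 4 (volume : Measure (Euc n)))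
    (hT : ∀ x : HH Ω θ, T x =ᵐ[volume] (x : XX n) none) (d : ℕ → HH Ω θ)
    (C : ℝ) (hC : ∀ k, ‖d k‖ ≤ C)
    (hw : ∀ y, Tendsto (fun k => inner ℝ (d k) y) atTop (𝓝 0)) :
    Tendsto (fun k => T (d k)) atTop (𝓝 0) := by
  obtain ⟨D, hD⟩ := HH_L4 hn R
  have h0 := HH_compact R hΩ d C hC hw
  have h4 : ∀ k, ‖T (d k)‖ₑ ^ 4 ≤ ENNReal.ofReal ‖(d k : XX n) none‖ * (D * ENNReal.ofReal C) ^ 3 := fun k => by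
    rw [Lp.enorm_def, eLpNorm_congr_ae (hT (d k))]
    refine (interp (Lp.memLp _).1).trans ?_
    gcongr
    · rw [ofReal_norm_eq_enorm, Lp.enorm_def]
    · refine ((hD Ω θ hΩ _ (d k).2).2).trans ?_
      gcongr
      refine (Real.sqrt_le_iff.mpr ⟨norm_nonneg _, ?_⟩).trans (hC k)
      show _ ≤ ‖(d k : XX n)‖ ^ 2
      rw [norm_sq_XX]
      nlinarith [sq_nonneg ‖(d k : XX n) none‖]
  have ht : Tendsto (fun k => ENNReal.ofReal ‖(d k : XX n) none‖ * (D * ENNReal.ofReal C) ^ 3)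
      atTop (𝓝 0) := by
    have a1 := ENNReal.tendsto_ofReal h0
    have := ENNReal.Tendsto.mul_const (b := (D * ENNReal.ofReal C) ^ 3) a1 (Or.inr (by finiteness))
    simpa using this
  have hT4 : Tendsto (fun k => ‖T (d k)‖ₑ ^ 4) atTop (𝓝 0) :=
    tendsto_of_tendsto_of_tendsto_of_le_of_le tendsto_const_nhds ht (fun _ => zero_le) h4
  rw [tendsto_zero_iff_norm_tendsto_zero]
  have := (ENNReal.tendsto_toReal ENNReal.zero_ne_top).comp hT4
  have := (Real.continuous_sqrt.tendsto _).comp ((Real.continuous_sqrt.tendsto _).comp this)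
  simp only [ENNReal.toReal_zero, Real.sqrt_zero] at this
  refine this.congr fun k => ?_
  simp only [Function.comp, ENNReal.toReal_pow, toReal_enorm]
  rw [show ‖T (d k)‖ ^ 4 = (‖T (d k)‖ ^ 2) ^ 2 by ring, Real.sqrt_sq (by positivity),
    Real.sqrt_sq (norm_nonneg _)]

end OpN

section OpO
open Filter Topology
open scoped ENNReal NNReal
variable {n : ℕ}

instance sep_HH (Ω : Set (Euc n)) (θ : ℝ) : TopologicalSpace.SeparableSpace (HH Ω θ) := by
  haveI : Fact ((2:ℝ≥0∞) ≠ ∞) := ⟨by norm_num⟩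
  haveI : SecondCountableTopology (L2 n) := Lp.SecondCountableTopology
  haveI : SecondCountableTopology (XX n) :=
    (PiLp.homeomorph 2 (fun _ : Option (Fin n) => L2 n)).secondCountableTopology
  haveI : SecondCountableTopology (HH Ω θ) := TopologicalSpace.Subtype.secondCountableTopology _
  infer_instance

def innB (E : Type*) [NormedAddCommGroup E] [InnerProductSpace ℝ E] : E →L[ℝ] E →L[ℝ] ℝ :=
  LinearMap.mkContinuous₂ (innerₗ E) 1 (fun x y => by
    rw [one_mul]; exact norm_inner_le_norm x y)

lemma innB_apply {E : Type*} [NormedAddCommGroup E] [InnerProductSpace ℝ E] (x y : E) :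
    innB E x y = inner ℝ x y := rfl

lemma M_exists (hn : n = 2 ∨ n = 3) (R : ℝ) (Ω : Set (Euc n)) (θ : ℝ)
    (hΩ : Ω ⊆ Metric.ball 0 R) :
    ∃ M : HH Ω θ →L[ℝ] HH Ω θ →L[ℝ] L2 n,
      (∀ x y, M x y =ᵐ[volume] fun z => (x : XX n) none z * (y : XX n) none z) ∧
      ∀ (x:ℕ → HH Ω θ) x' C, (∀ k, ‖x k‖ ≤ C) →
        (∀ y, Tendsto (fun k => inner ℝ (x k) y) atTop (𝓝 (inner ℝ x' y))) →
        Tendsto (fun k => M (x k) (x k)) atTop (𝓝 (M x' x')) := by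
  obtain ⟨T, hT⟩ := T4_exists hn R Ω θ hΩ
  let H := (ContinuousLinearMap.mul ℝ ℝ).holderL (volume : Measure (Euc n)) 4 4 2
  refine ⟨H.bilinearComp T T, fun x y => ?_, fun x x' C hC hw => ?_⟩
  · have := (ContinuousLinearMap.mul ℝ ℝ).coeFn_holder (r := 2) (T x) (T y)
    have h2 : H.bilinearComp T T x y = (ContinuousLinearMap.mul ℝ ℝ).holder 2 (T x) (T y) := rfl
    rw [h2]
    filter_upwards [this, hT x, hT y] with z h1 h2 h3
    rw [h1, h2, h3]
    simp
  · have h1 := T4_compact hn R hΩ T hT (fun k => x k - x') (C + ‖x'‖)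
      (fun k => (norm_sub_le _ _).trans (by linarith [hC k])) (fun y => by
        have := (hw y).sub_const (inner ℝ x' y)
        simp_rw [inner_sub_left]
        simpa using this)
    have h2 : Tendsto (fun k => T (x k)) atTop (𝓝 (T x')) := by
      simp_rw [map_sub] at h1
      exact tendsto_sub_nhds_zero_iff.mp h1
    have h3 : Continuous fun p : Lp ℝ 4 (volume : Measure (Euc n)) => H p p := by fun_prop
    have := (h3.tendsto (T x')).comp h2
    exact this

lemma qD_int {Ω : Set (Euc n)} {θ : ℝ} (M : HH Ω θ →L[ℝ] HH Ω θ →L[ℝ] L2 n)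
    (hM : ∀ x y, M x y =ᵐ[volume] fun z => (x : XX n) none z * (y : XX n) none z)
    (x y z w : HH Ω θ) : inner ℝ (M x y) (M z w) =
      ∫ t, ((x : XX n) none t * (y : XX n) none t) * ((z : XX n) none t * (w : XX n) none t) := by
  rw [L2_inner_eq]
  apply integral_congr_ae
  filter_upwards [hM x y, hM z w] with t h1 h2
  rw [h1, h2]

set_option maxHeartbeats 1000000 in
lemma weak_exists (hn : n = 2 ∨ n = 3) (R : ℝ) (Ω : Set (Euc n)) (θ : ℝ)
    (hΩ : Ω ⊆ Metric.ball 0 R) {ι : Type} [Fintype ι] [DecidableEq ι]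
    (lam : ι → ℝ) (hlam : ∀ j, 0 < lam j) (β : ι → ι → ℝ)
    (hdiag : ∀ j, 0 < β j j) (hoff : ∀ i j, i ≠ j → β i j ≤ 0) (hsym : ∀ i j, β i j = β j i)
    (v : ι → HH Ω θ) (hv : ∀ j, v j ≠ 0)
    (hvd : ∀ i j, i ≠ j → ∀ᵐ z, (v i : XX n) none z * (v j : XX n) none z = 0) :
    ∃ u : ι → HH Ω θ, (∀ j, u j ≠ 0) ∧ ∀ j (φ : HH Ω θ),
      ∑ i, inner ℝ ((u j : XX n) (some i)) ((φ : XX n) (some i))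
        + lam j * inner ℝ ((u j : XX n) none) ((φ : XX n) none) = 
      ∑ k, β j k * ∫ z, ((u j : XX n) none z * (φ : XX n) none z) *
        ((u k : XX n) none z * (u k : XX n) none z) := by
  obtain ⟨M, hM, hMc⟩ := M_exists hn R Ω θ hΩ
  let B : ι → HH Ω θ →L[ℝ] HH Ω θ →L[ℝ] ℝ := fun j =>
    innB _ + (lam j - 1) • (innB (L2 n)).bilinearComp (ev0 Ω θ) (ev0 Ω θ)
  have hBv : ∀ j x y, B j x y = inner ℝ x y +
      (lam j - 1) * inner ℝ ((x : XX n) none) ((y : XX n) none) := fun j x y => rfl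
  have hin : ∀ x y : HH Ω θ, inner ℝ x y = inner ℝ ((x : XX n) none) ((y : XX n) none) +
      ∑ i, inner ℝ ((x : XX n) (some i)) ((y : XX n) (some i)) := fun x y => by
    rw [Submodule.coe_inner, PiLp.inner_apply, Fintype.sum_option]
  obtain ⟨c, hc, hcl⟩ : ∃ c : ℝ, 0 < c ∧ c ≤ 1 ∧ ∀ j, c ≤ lam j := by
    rcases isEmpty_or_nonempty ι with h | h
    · exact ⟨1, one_pos, le_rfl, fun j => isEmptyElim j⟩
    · obtain ⟨j0, h0⟩ := Finite.exists_min lam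
      exact ⟨min 1 (lam j0), lt_min one_pos (hlam j0), min_le_left _ _,
        fun j => (min_le_right _ _).trans (h0 j)⟩
  have k1 : ∀ j x, c * ‖x‖ ^ 2 ≤ B j x x := fun j x => by
    rw [hBv, real_inner_self_eq_norm_sq x, real_inner_self_eq_norm_sq ((x : XX n) none)]
    have h1 := norm_sq_XX (x : XX n)
    have h2 : ‖x‖ = ‖(x : XX n)‖ := rfl
    rw [h2, h1]
    nlinarith [Gr2_nonneg (x : XX n), sq_nonneg ‖(x : XX n) none‖, hcl.1, hcl.2 j]
  have k2 : ∀ j x y, B j x y = B j y x := fun j x y => by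
    rw [hBv, hBv, real_inner_comm x y, real_inner_comm ((x : XX n) none) ((y : XX n) none)]
  have k3 : ∀ x y, M x y = M y x := fun x y => by
    apply Lp.ext
    filter_upwards [hM x y, hM y x] with z h1 h2
    rw [h1, h2, mul_comm]
  have k4 : ∀ x, M x x = 0 → x = 0 := fun x hx => by
    apply Subtype.ext
    apply HH_eq_zero x.2
    apply Lp.ext
    filter_upwards [hM x x, Lp.coeFn_zero ℝ 2 (volume : Measure (Euc n))] with z h1 h2
    rw [hx, h2] at h1
    rw [h2]
    simpa using h1.symm
  have k5 : ∀ x y, 0 ≤ qD M x y := fun x y => by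
    unfold qD
    rw [qD_int M hM]
    exact integral_nonneg fun t => mul_nonneg (mul_self_nonneg _) (mul_self_nonneg _)
  have k6 : ∀ i j, i ≠ j → qD M (v i) (v j) = 0 := fun i j hij => by
    unfold qD
    rw [qD_int M hM]
    apply integral_eq_zero_of_ae
    filter_upwards [hvd i j hij] with z hz
    simp only [Pi.zero_apply]
    linear_combination ((v i : XX n) none z * (v j : XX n) none z) * hz
  obtain ⟨u, hu, hE⟩ := abstract_nehari M B β c hc k1 k2 k3 k4 hMc k5 hdiag hoff hsym v hv k6
  refine ⟨u, hu, fun j φ => ?_⟩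
  have := hE j φ
  rw [hBv, hin] at this
  simp_rw [qD_int M hM] at this
  rw [← this]; ring

end OpO

section OpP
open Filter Topology
open scoped ENNReal NNReal
variable {n : ℕ}

lemma dual_polar (R : Euc n ≃ₗᵢ[ℝ] Euc n) (L L' : Euc n →L[ℝ] ℝ) :
    ∑ i, L (R (bv i)) * L' (R (bv i)) = ∑ i, L (bv i) * L' (bv i) := by
  have h : ∀ A : Euc n →L[ℝ] ℝ, ∑ i, (A (R (bv i))) ^ 2 = ∑ i, (A (bv i)) ^ 2 := fun A => by
    have h1 := dual_norm_sq (A.comp (R.toContinuousLinearEquiv : Euc n →L[ℝ] Euc n))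
    have h2 : ‖A.comp (R.toContinuousLinearEquiv : Euc n →L[ℝ] Euc n)‖ = ‖A‖ :=
      ContinuousLinearMap.opNorm_comp_linearIsometryEquiv A R
    rw [h2, dual_norm_sq] at h1
    exact h1.symm
  have h1 := h (L + L')
  have h2 := h L
  have h3 := h L'
  simp only [ContinuousLinearMap.add_apply, add_sq, Finset.sum_add_distrib] at h1
  have e1 : ∀ (a b : Fin n → ℝ), ∑ i, 2 * a i * b i = 2 * ∑ i, a i * b i := fun a b => by
    rw [Finset.mul_sum]; exact Finset.sum_congr rfl fun i _ => by ring
  rw [e1, e1] at h1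
  linarith

lemma fderiv_rot (hn : n = 2 ∨ n = 3) (a : ℝ) {φ : Euc n → ℝ} (h : Differentiable ℝ φ) (z v : Euc n) :
    fderiv ℝ (fun x => φ (rotPt a x)) z v = fderiv ℝ φ (rotPt a z) (rotE hn a v) := by
  have h1 : HasFDerivAt (fun x : Euc n => rotE hn a x)
      ((rotE hn a).toContinuousLinearEquiv : Euc n →L[ℝ] Euc n) z :=
    ((rotE hn a).toContinuousLinearEquiv : Euc n →L[ℝ] Euc n).hasFDerivAt
  have h2 := (h (rotE hn a z)).hasFDerivAt.comp z h1
  have h3 : (φ ∘ fun x : Euc n => rotE hn a x) = fun x => φ (rotPt a x) := by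
    funext x; simp [rotE_apply]
  rw [h3] at h2
  rw [h2.fderiv, rotE_apply]
  rfl

lemma inner_rep {φ ψ : Euc n → ℝ} {x y : XX n} (hx : FRep φ x) (hy : FRep ψ y) {Ω Ω' : Set (Euc n)}
    (hφ : IsTest Ω φ) (hψ : IsTest Ω' ψ) : inner ℝ y x =
      ∫ z, (ψ z * φ z + ∑ i, fderiv ℝ ψ z (bv i) * fderiv ℝ φ z (bv i)) := by
  rw [PiLp.inner_apply, Fintype.sum_option, integral_add, integral_finsetSum]
  · congr 1
    · rw [L2_inner_eq]
      apply integral_congr_ae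
      filter_upwards [hx.1, hy.1] with z h1 h2
      rw [h1, h2]
    · apply Finset.sum_congr rfl
      intro i _
      rw [L2_inner_eq]
      apply integral_congr_ae
      filter_upwards [hx.2 i, hy.2 i] with z h1 h2
      rw [h1, h2]
  · intro i _
    exact ((test_fderiv_cont hψ.1 _).mul (test_fderiv_cont hφ.1 _)).integrable_of_hasCompactSupport
      (hφ.2.1.fderiv_apply ℝ (bv i)).mul_left
  · exact (hψ.1.continuous.mul hφ.1.continuous).integrable_of_hasCompactSupport hφ.2.1.mul_left
  · apply integrable_finsetSum
    intro i _
    exact ((test_fderiv_cont hψ.1 _).mul (test_fderiv_cont hφ.1 _)).integrable_of_hasCompactSupport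
      (hφ.2.1.fderiv_apply ℝ (bv i)).mul_left

lemma int_rot (hn : n = 2 ∨ n = 3) (a : ℝ) (g : Euc n → ℝ) : ∫ z, g (rotPt a z) = ∫ z, g z :=
  MeasurePreserving.integral_comp (rotPt_mp hn a)
    (rotE hn a).toHomeomorph.measurableEmbedding g

lemma inner_rot (hn : n = 2 ∨ n = 3) {Ω : Set (Euc n)} {θ : ℝ} {u : XX n} (hu : u ∈ HH Ω θ)
    {Ω₁ Ω₂ : Set (Euc n)} {φ : Euc n → ℝ} {x x' : XX n} (hφ : IsTest Ω₁ φ) 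
    (hφ' : IsTest Ω₂ (fun z => φ (rotPt θ z))) (hx : FRep φ x) 
    (hx' : FRep (fun z => φ (rotPt θ z)) x') : inner ℝ u x' = - inner ℝ u x := by
  obtain ⟨ψ, y, h1, h2, h3, h4⟩ := HH_seq hu
  have t1 := h4.inner (𝕜 := ℝ) (tendsto_const_nhds (x := x'))
  have t2 := (h4.inner (𝕜 := ℝ) (tendsto_const_nhds (x := x))).neg
  refine tendsto_nhds_unique t1 (t2.congr fun k => ?_)
  rw [inner_rep hx' (h3 k) hφ' (h1 k), inner_rep hx (h3 k) hφ (h1 k), ← integral_neg]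
  rw [← int_rot hn θ]
  apply integral_congr_ae
  refine Eventually.of_forall fun z => ?_
  have hd := (h1 k).1.differentiable (by norm_num)
  have e1 : ∀ v, fderiv ℝ (ψ k) z v = - fderiv ℝ (ψ k) (rotPt θ z) (rotE hn θ v) := fun v => by
    rw [← fderiv_rot hn θ hd]
    have : (fun x => ψ k (rotPt θ x)) = - ψ k := by
      funext x; exact h2 k x
    rw [this, fderiv_neg]
    simp
  simp only [fderiv_rot hn θ (hφ.1.differentiable (by norm_num)), e1, h2 k z, neg_mul,
    Finset.sum_neg_distrib, dual_polar]
  ring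

lemma isTest_rot (hn : n = 2 ∨ n = 3) {Ω : Set (Euc n)} (hrot : ∀ a, ∀ x ∈ Ω, rotPt a x ∈ Ω)
    {φ : Euc n → ℝ} (hφ : IsTest Ω φ) (a : ℝ) : IsTest Ω (fun z => φ (rotPt a z)) := by
  have e : (fun z => φ (rotPt a z)) = φ ∘ (rotE hn a).toHomeomorph := rfl
  refine ⟨?_, ?_, ?_⟩
  · exact hφ.1.comp (rotE hn a).contDiff
  · rw [e]; exact hφ.2.1.comp_homeomorph _
  · rw [e, tsupport_comp_eq_preimage]
    intro x hx
    have h1 : rotPt a x ∈ Ω := hφ.2.2 hx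
    have := hrot (-a) _ h1
    rwa [rotPt_rotPt hn, neg_add_cancel, rotPt_zero hn] at this

/-- the principle of symmetric criticality -/
lemma sym_crit (hn : n = 2 ∨ n = 3) {Ω : Set (Euc n)} (hrot : ∀ a, ∀ x ∈ Ω, rotPt a x ∈ Ω)
    (K : ℕ) (hK : 1 ≤ K) {u : XX n} (hu : u ∈ HH Ω (π / K)) (f : L2 n)
    (hf : ∀ᵐ z, f (rotPt (π / K) z) = - f z)
    (hE : ∀ x ∈ HH Ω (π / K), inner ℝ u x = inner ℝ f (x none))
    {φ : Euc n → ℝ} (hφ : IsTest Ω φ) {x : XX n} (hx : FRep φ x) :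
    inner ℝ u x = inner ℝ f (x none) := by
  set θ := π / (K : ℝ) with hθ
  have hK' : (K : ℝ) ≠ 0 := by positivity
  have hT : ∀ i : ℕ, IsTest Ω (fun z => φ (rotPt (i * θ) z)) := fun i => isTest_rot hn hrot hφ _
  choose X hX using fun i => rep_exists (hT i)
  have hstep : ∀ (i : ℕ) z, φ (rotPt (i * θ) (rotPt θ z)) = φ (rotPt ((i + 1 : ℕ) * θ) z) := fun i z => by
    rw [rotPt_rotPt hn]; congr 2; push_cast; ring
  let G : XX n → ℝ := fun y => inner ℝ u y - inner ℝ f (y none)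
  have hG : ∀ i, G (X (i + 1)) = - G (X i) := fun i => by
    have e : (fun z => φ (rotPt ((i + 1 : ℕ) * θ) z)) = fun z => (fun w => φ (rotPt (i * θ) w)) (rotPt θ z) := by
      funext z; exact (hstep i z).symm
    have hT' := hT (i + 1)
    have hX' := hX (i + 1)
    rw [e] at hT' hX'
    have e1 := inner_rot hn hu (hT i) hT' (hX i) hX'
    have e2 : inner ℝ f (X (i + 1) none) = - inner ℝ f (X i none) := by
      rw [L2_inner_eq, L2_inner_eq, ← integral_neg, ← int_rot hn θ (fun z => -(f z * X i none z))]
      apply integral_congr_ae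
      filter_upwards [hf, hX'.1, (rotPt_mp hn θ).quasiMeasurePreserving.ae (hX i).1] with z h1 h2 h3
      rw [h1, h2, h3]; ring
    simp only [G, e1, e2]; ring
  have hG0 : ∀ i, G (X i) = (-1) ^ i * G (X 0) := fun i => by
    induction i with
    | zero => simp
    | succ i ih => rw [hG, ih]; ring
  have hS : ∀ m : ℕ, FRep (∑ i ∈ range m, ((-1 : ℝ) ^ i) • (fun z => φ (rotPt (i * θ) z)))
      (∑ i ∈ range m, ((-1 : ℝ) ^ i) • X i) ∧
      IsTest Ω (∑ i ∈ range m, ((-1 : ℝ) ^ i) • (fun z => φ (rotPt (i * θ) z))) ∧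
      G (∑ i ∈ range m, ((-1 : ℝ) ^ i) • X i) = m * G (X 0) := fun m => by
    induction m with
    | zero => simpa using ⟨rep_zero, isTest_zero Ω, by simp [G]⟩
    | succ m ih =>
      obtain ⟨i1, i2, i3⟩ := ih
      simp only [Finset.sum_range_succ]
      refine ⟨i1.add ((hX m).smul _) (i2.1.differentiable (by norm_num))
        (((hT m).smul _).1.differentiable (by norm_num)), i2.add ((hT m).smul _), ?_⟩
      have hadd : ∀ a b (c : ℝ), G (a + c • b) = G a + c * G b := fun a b c => by
        simp only [G, PiLp.add_apply, PiLp.smul_apply, inner_add_right, inner_smul_right]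
        ring
      rw [hadd, i3, hG0 m, ← mul_assoc, ← pow_add, ← two_mul, pow_mul]
      push_cast
      norm_num
      ring
  obtain ⟨s1, s2, s3⟩ := hS (2 * K)
  have hanti : Anti θ (∑ i ∈ range (2 * K), ((-1 : ℝ) ^ i) • (fun z => φ (rotPt (i * θ) z))) := by
    intro z
    simp only [Finset.sum_apply, Pi.smul_apply, smul_eq_mul, hstep]
    have h1 := Finset.sum_range_succ (fun i : ℕ => (-1 : ℝ) ^ i * φ (rotPt (i * θ) z)) (2 * K)
    have h2 := Finset.sum_range_succ' (fun i : ℕ => (-1 : ℝ) ^ i * φ (rotPt (i * θ) z)) (2 * K)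
    have e0 : rotPt ((2 * K : ℕ) * θ) z = z := by
      have : ((2 * K : ℕ) : ℝ) * θ = 2 * π := by rw [hθ]; push_cast; field_simp
      rw [this, rotPt_two_pi hn]
    rw [e0, pow_mul] at h1
    rw [h1] at h2
    simp only [Nat.cast_zero, zero_mul, rotPt_zero hn, pow_zero, one_mul] at h2
    norm_num at h2
    rw [h2, ← Finset.sum_neg_distrib]
    apply Finset.sum_congr rfl
    intro i _
    rw [pow_succ]; push_cast; ring
  have hmem : (∑ i ∈ range (2 * K), ((-1 : ℝ) ^ i) • X i) ∈ HH Ω θ :=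
    Submodule.le_topologicalClosure _ ⟨_, s2, hanti, s1⟩
  have h0 := hE _ hmem
  have h0' : G (∑ i ∈ range (2 * K), ((-1 : ℝ) ^ i) • X i) = 0 := sub_eq_zero.mpr h0
  rw [s3] at h0'
  have hx0 : X 0 = x := by
    have := hX 0
    simp only [Nat.cast_zero, zero_mul, rotPt_zero hn] at this
    exact this.unique hx
  rw [hx0] at h0'
  have : G x = 0 := by
    rcases mul_eq_zero.mp h0' with h | h
    · exfalso; push_cast at h; apply hK'; linarith
    · exact h
  exact sub_eq_zero.mp this

end OpP

section OpQ
open Filter Topology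
open scoped ENNReal NNReal
variable {n : ℕ}

/-- first two coordinates as complex number -/
def cpx (hn : n = 2 ∨ n = 3) (x : Euc n) : ℂ :=
  (x ⟨0, by omega⟩ : ℂ) + (x ⟨1, by omega⟩ : ℂ) * Complex.I

lemma cpx_rot (hn : n = 2 ∨ n = 3) (a : ℝ) (x : Euc n) :
    cpx hn (rotPt a x) = Complex.exp (a * Complex.I) * cpx hn x := by
  rw [Complex.exp_mul_I, ← Complex.ofReal_cos, ← Complex.ofReal_sin]
  unfold cpx
  rcases hn with rfl | rfl
  · apply Complex.ext <;> simp [rotPt]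
    ring
  · apply Complex.ext <;> simp [rotPt]
    ring

lemma cpx_contDiff (hn : n = 2 ∨ n = 3) (K : ℕ) :
    ContDiff ℝ 1 (fun x : Euc n => ((cpx hn x) ^ K).re) := by
  have h1 : ∀ i : Fin n, ContDiff ℝ 1 (fun x : Euc n => ((x i : ℝ) : ℂ)) := fun i =>
    Complex.ofRealCLM.contDiff.comp ((EuclideanSpace.proj i : Euc n →L[ℝ] ℝ).contDiff)
  have h2 : ContDiff ℝ 1 (fun x : Euc n => (cpx hn x) ^ K) :=
    ((h1 _).add ((h1 _).mul contDiff_const)).pow K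
  exact Complex.reCLM.contDiff.comp h2

lemma radial_shell {Ω : Set (Euc n)} (hΩ : RadialDomain Ω) :
    ∃ a b : ℝ, 0 ≤ a ∧ a < b ∧ ∀ x : Euc n, a < ‖x‖ ^ 2 → ‖x‖ ^ 2 < b → x ∈ Ω := by
  rcases hΩ with ⟨R, hR, rfl⟩ | ⟨r, R, hr, hR, rfl⟩
  · refine ⟨0, R ^ 2, le_rfl, by positivity, fun x _ h => ?_⟩
    rw [mem_ball_zero_iff]
    exact lt_of_pow_lt_pow_left₀ 2 hR.le h
  · refine ⟨r ^ 2, R ^ 2, by positivity, by gcongr, fun x h1 h2 => ⟨?_, ?_⟩⟩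
    · exact lt_of_pow_lt_pow_left₀ 2 (norm_nonneg _) h1
    · exact lt_of_pow_lt_pow_left₀ 2 (by linarith) h2

lemma radial_rot (hn : n = 2 ∨ n = 3) {Ω : Set (Euc n)} (hΩ : RadialDomain Ω) (a : ℝ) (x : Euc n)
    (hx : x ∈ Ω) : rotPt a x ∈ Ω := by
  rcases hΩ with ⟨R, hR, rfl⟩ | ⟨r, R, hr, hR, rfl⟩
  · rw [mem_ball_zero_iff] at *; rwa [rotPt_norm hn]
  · simpa [rotPt_norm hn] using hx

lemma radial_bdd {Ω : Set (Euc n)} (hΩ : RadialDomain Ω) :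
    ∃ R : ℝ, 0 < R ∧ Ω ⊆ Metric.ball 0 R := by
  rcases hΩ with ⟨R, hR, rfl⟩ | ⟨r, R, hr, hR, rfl⟩
  · exact ⟨R, hR, subset_rfl⟩
  · exact ⟨R, hr.trans hR, fun x hx => by rw [mem_ball_zero_iff]; exact hx.2⟩

lemma radial_open {Ω : Set (Euc n)} (hΩ : RadialDomain Ω) : IsOpen Ω := by
  rcases hΩ with ⟨R, hR, rfl⟩ | ⟨r, R, hr, hR, rfl⟩
  · exact Metric.isOpen_ball
  · exact (isOpen_lt continuous_const continuous_norm).inter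
      (isOpen_lt continuous_norm continuous_const)

lemma init_exists (hn : n = 2 ∨ n = 3) {Ω : Set (Euc n)} (hΩ : RadialDomain Ω) (K : ℕ) (hK : 1 ≤ K)
    (N : ℕ) : ∃ v : {j // j ∈ Finset.Icc 1 N} → HH Ω (π / K), (∀ j, v j ≠ 0) ∧
      ∀ i j, i ≠ j → ∀ᵐ z, (v i : XX n) none z * (v j : XX n) none z = 0 := by
  obtain ⟨a, b, ha, hab, hsub⟩ := radial_shell hΩ
  set δ : ℝ := (b - a) / (N + 1) with hδ
  have hδ0 : 0 < δ := div_pos (by linarith) (by positivity)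
  have hδN : δ * (N + 1) = b - a := by rw [hδ]; field_simp
  let η : ∀ j : ℕ, ContDiffBump (a + δ * j) := fun j => ⟨δ / 6, δ / 3, by positivity, by linarith⟩
  let φ : ℕ → Euc n → ℝ := fun j x => η j (‖x‖ ^ 2) * ((cpx hn x) ^ K).re
  have hsupp : ∀ j x, φ j x ≠ 0 → |‖x‖ ^ 2 - (a + δ * j)| ≤ δ / 3 := fun j x h => by
    have h1 : η j (‖x‖ ^ 2) ≠ 0 := left_ne_zero_of_mul h
    have h2 : ‖x‖ ^ 2 ∈ Function.support (η j) := h1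
    rw [ContDiffBump.support_eq] at h2
    have := Metric.mem_ball.mp h2
    rw [Real.dist_eq] at this
    exact this.le
  have hts : ∀ j, tsupport (φ j) ⊆ {x | |‖x‖ ^ 2 - (a + δ * j)| ≤ δ / 3} := fun j => by
    apply closure_minimal (fun x hx => hsupp j x hx)
    exact isClosed_le (((continuous_norm.pow 2).sub continuous_const).abs) continuous_const
  have hj : ∀ j ∈ Finset.Icc 1 N, δ ≤ δ * j ∧ δ * j ≤ δ * N := fun j h => by
    rw [Finset.mem_Icc] at h
    have h1 : (1 : ℝ) ≤ j := by exact_mod_cast h.1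
    have h2 : (j : ℝ) ≤ N := by exact_mod_cast h.2
    constructor <;> nlinarith
  have htest : ∀ j ∈ Finset.Icc 1 N, IsTest Ω (φ j) := fun j h => by
    obtain ⟨h1, h2⟩ := hj j h
    refine ⟨?_, ?_, ?_⟩
    · have : ContDiff ℝ 1 (fun x : Euc n => η j (‖x‖ ^ 2)) :=
        (η j).contDiff.comp (contDiff_norm_sq ℝ)
      exact this.mul (cpx_contDiff hn K)
    · refine HasCompactSupport.of_support_subset_isCompact (isCompact_closedBall (0 : Euc n) (√ b)) ?_
      intro x hx
      have := (abs_le.mp (hsupp j x hx)).2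
      rw [mem_closedBall_zero_iff]
      apply Real.le_sqrt_of_sq_le
      nlinarith
    · intro x hx
      have h5 : |‖x‖ ^ 2 - (a + δ * j)| ≤ δ / 3 := hts j hx
      have := abs_le.mp h5
      apply hsub
      · nlinarith
      · nlinarith
  have hanti : ∀ j, Anti (π / K) (φ j) := fun j x => by
    simp only [φ, rotPt_norm hn, cpx_rot, mul_pow]
    rw [← Complex.exp_nat_mul]
    have : (K : ℂ) * (((π / K : ℝ) : ℂ) * Complex.I) = π * Complex.I := by
      push_cast
      have : (K : ℂ) ≠ 0 := by exact_mod_cast (by omega : K ≠ 0)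
      field_simp
    rw [this, Complex.exp_pi_mul_I]
    simp
  have hne : ∀ j ∈ Finset.Icc 1 N, ∃ x, φ j x ≠ 0 := fun j h => by
    obtain ⟨h1, h2⟩ := hj j h
    have hc : 0 < a + δ * j := by linarith
    refine ⟨EuclideanSpace.single ⟨0, by omega⟩ (√ (a + δ * j)), ?_⟩
    have e1 : ‖(EuclideanSpace.single ⟨0, by omega⟩ (√ (a + δ * j)) : Euc n)‖ ^ 2 = a + δ * j := by
      rw [EuclideanSpace.norm_single, Real.norm_eq_abs, sq_abs, Real.sq_sqrt hc.le]
    have e2 : cpx hn (EuclideanSpace.single ⟨0, by omega⟩ (√ (a + δ * j)) : Euc n) = (√ (a + δ * j) : ℝ) := by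
      simp [cpx]
    simp only [φ]
    rw [e1, e2, (η j).one_of_mem_closedBall (Metric.mem_closedBall_self (η j).rIn_pos.le), ← Complex.ofReal_pow,
      Complex.ofReal_re, one_mul]
    exact (pow_pos (Real.sqrt_pos.mpr hc) K).ne'
  choose X hX using fun j : {j // j ∈ Finset.Icc 1 N} => rep_exists (htest j j.2)
  refine ⟨fun j => ⟨X j, Submodule.le_topologicalClosure _ ⟨_, htest j j.2, hanti j, hX j⟩⟩,
    fun j h0 => ?_, fun i j hij => ?_⟩
  · have h1 : X j = 0 := congrArg Subtype.val h0
    have h2 := (hX j).1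
    rw [h1] at h2
    have h3 : φ j =ᵐ[volume] (0 : Euc n → ℝ) := h2.symm.trans (Lp.coeFn_zero ℝ 2 _)
    rw [(htest j j.2).1.continuous.ae_eq_iff_eq _ continuous_zero] at h3
    obtain ⟨x, hx⟩ := hne j j.2
    exact hx (congrFun h3 x)
  · filter_upwards [(hX i).1, (hX j).1] with z h1 h2
    show X i none z * X j none z = 0
    rw [h1, h2]
    by_contra h
    have k1 := abs_le.mp (hsupp _ z (left_ne_zero_of_mul h))
    have k2 := abs_le.mp (hsupp _ z (right_ne_zero_of_mul h))
    have hne : (i : ℕ) ≠ (j : ℕ) := fun h => hij (Subtype.ext h)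
    rcases Nat.lt_or_gt_of_ne hne with h | h
    · have : ((i : ℕ) : ℝ) + 1 ≤ (j : ℕ) := by exact_mod_cast h
      nlinarith
    · have : ((j : ℕ) : ℝ) + 1 ≤ (i : ℕ) := by exact_mod_cast h
      nlinarith

instance holder663 : ENNReal.HolderTriple 6 6 3 := ⟨by
  rw [← ENNReal.toReal_eq_toReal_iff' (by finiteness) (by finiteness), ENNReal.toReal_add (by finiteness) (by finiteness)]
  simp; norm_num⟩

instance holder362 : ENNReal.HolderTriple 3 6 2 := ⟨by
  rw [← ENNReal.toReal_eq_toReal_iff' (by finiteness) (by finiteness), ENNReal.toReal_add (by finiteness) (by finiteness)]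
  simp; norm_num⟩

lemma prod3 {a b c : Euc n → ℝ} (ha : MemLp a 6 volume) (hb : MemLp b 6 volume)
    (hc : MemLp c 6 volume) : MemLp (fun z => a z * b z * c z) 2 volume := by
  have h1 : MemLp (a * b) 3 volume := hb.mul ha
  have h2 : MemLp (a * b * c) 2 volume := hc.mul h1
  exact h2

end OpQ

section OpR
open Filter Topology
open scoped ENNReal NNReal
variable {n : ℕ}

lemma quart_bound (hn : n = 2 ∨ n = 3) (R : ℝ) : ∃ D : ℝ, 0 ≤ D ∧ ∀ (Ω : Set (Euc n)) (θ : ℝ),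
    Ω ⊆ Metric.ball 0 R → ∀ x ∈ HH Ω θ,
    ∫ z, (x none z * x none z) * (x none z * x none z) ≤ D * ‖x none‖ * (√ (Gr2 x)) ^ 3 := by
  obtain ⟨D, hD⟩ := HH_L4 hn R
  refine ⟨(D : ℝ) ^ 3, by positivity, fun Ω θ hΩ x hx => ?_⟩
  rw [integral_eq_lintegral_of_nonneg_ae
    (Eventually.of_forall fun t => mul_nonneg (mul_self_nonneg _) (mul_self_nonneg _))
    (by have := (Lp.memLp (x none)).1; exact (this.mul this).mul (this.mul this))]
  have e : ∫⁻ z, ENNReal.ofReal ((x none z * x none z) * (x none z * x none z)) =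
      eLpNorm (x none) 4 volume ^ 4 := by
    have := eLpNorm_nnreal_pow_eq_lintegral (μ := volume) (f := x none) (p := 4) (by norm_num)
    have h2 : eLpNorm (x none) 4 volume ^ 4 = ∫⁻ z, ‖x none z‖ₑ ^ 4 := by simpa using this
    rw [h2]
    apply lintegral_congr
    intro z
    rw [← ofReal_norm_eq_enorm, ← ENNReal.ofReal_pow (norm_nonneg _), Real.norm_eq_abs]
    congr 1
    rw [show |x none z| ^ 4 = (|x none z| ^ 2) ^ 2 by ring, sq_abs]; ring
  rw [e]
  have hle := (interp (Lp.memLp (x none)).1).trans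
    (mul_le_mul' le_rfl (pow_le_pow_left' (hD Ω θ hΩ x hx).2 3))
  have := ENNReal.toReal_mono (by have := Lp.eLpNorm_ne_top (x none); finiteness) hle
  refine this.trans_eq ?_
  rw [ENNReal.toReal_mul, ENNReal.toReal_pow, ENNReal.toReal_mul, ← Lp.norm_def,
    ENNReal.toReal_ofReal (Real.sqrt_nonneg _)]
  simp only [ENNReal.coe_toReal]
  ring

set_option maxHeartbeats 1000000 in
theorem weak_sol (hn : n = 2 ∨ n = 3) {Ω : Set (Euc n)} (hΩ : RadialDomain Ω) (N : ℕ)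
    (lam mu : ℕ → ℝ) (beta : ℕ → ℕ → ℝ) (hlam : ∀ j ∈ Finset.Icc 1 N, 0 < lam j)
    (hmu : ∀ j ∈ Finset.Icc 1 N, 0 < mu j)
    (hb : ∀ i ∈ Finset.Icc 1 N, ∀ j ∈ Finset.Icc 1 N, i ≠ j → beta i j = beta j i ∧ beta i j ≤ 0) :
    ∃ C : ℝ, 0 < C ∧ ∀ K : ℕ, 1 ≤ K → ∃ (u : ℕ → XX n) (f : ℕ → L2 n), ∀ j ∈ Finset.Icc 1 N,
      u j ∈ HH Ω (π / K) ∧ u j ≠ 0 ∧ (K : ℝ) ≤ C * Gr2 (u j) ∧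
      (f j =ᵐ[volume] fun z => u j none z - lam j * u j none z + (mu j * (u j none z) ^ 3 +
        ∑ m ∈ (Finset.Icc 1 N).erase j, beta j m * u j none z * (u m none z) ^ 2)) ∧
      ∀ φ x, IsTest Ω φ → FRep φ x → inner ℝ (u j) x = inner ℝ (f j) (x none) := by
  obtain ⟨R, hR, hΩR⟩ := radial_bdd hΩ
  obtain ⟨D, hD0, hD⟩ := quart_bound hn R
  obtain ⟨D6, hD6⟩ := HH_L4 hn R
  have hmuS : ∀ j ∈ Finset.Icc 1 N, mu j ≤ ∑ j ∈ Finset.Icc 1 N, mu j := fun j hj =>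
    Finset.single_le_sum (f := mu) (fun i hi => (hmu i hi).le) hj
  refine ⟨1 + (∑ j ∈ Finset.Icc 1 N, mu j) * (D * (π * R)), ?_, fun K hK => ?_⟩
  · have : 0 ≤ ∑ j ∈ Finset.Icc 1 N, mu j := Finset.sum_nonneg fun i hi => (hmu i hi).le
    positivity
  have hK0 : (0 : ℝ) < K := by positivity
  obtain ⟨v, hv, hvd⟩ := init_exists hn hΩ K hK N
  let Bc : ℕ → ℕ → ℝ := fun i j => if i = j then mu i else beta i j
  obtain ⟨w, hw0, hw⟩ := weak_exists hn R Ω (π / K) hΩR (ι := {j // j ∈ Finset.Icc 1 N})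
    (fun j => lam j) (fun j => hlam j j.2) (fun i j => Bc i j)
    (fun j => by simpa [Bc] using hmu j j.2)
    (fun i j hij => by
      have hne : (i : ℕ) ≠ (j : ℕ) := fun h => hij (Subtype.ext h)
      simpa [Bc, hne] using (hb i i.2 j j.2 hne).2)
    (fun i j => by
      by_cases hne : (i : ℕ) = (j : ℕ)
      · simp [Bc, hne]
      · simp only [Bc, if_neg hne, if_neg (Ne.symm hne)]; exact (hb i i.2 j j.2 hne).1)
    v hv hvd
  let u : ℕ → XX n := fun j => if h : j ∈ Finset.Icc 1 N then (w ⟨j, h⟩ : XX n) else 0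
  have huw : ∀ j (h : j ∈ Finset.Icc 1 N), u j = w ⟨j, h⟩ := fun j h => by simp only [u, dif_pos h]
  have huH : ∀ j, u j ∈ HH Ω (π / K) := fun j => by
    by_cases h : j ∈ Finset.Icc 1 N
    · rw [huw j h]; exact (w ⟨j, h⟩).2
    · simp only [u, dif_neg h]; exact Submodule.zero_mem _
  have hu6 : ∀ j, MemLp (u j none) 6 volume := fun j =>
    ⟨(Lp.memLp _).1, ((hD6 Ω _ hΩR _ (huH j)).2).trans_lt (by finiteness)⟩
  have hsum : ∀ j ∈ Finset.Icc 1 N, ∀ g : ℕ → ℝ, ∑ m ∈ Finset.Icc 1 N, Bc j m * g m =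
      mu j * g j + ∑ m ∈ (Finset.Icc 1 N).erase j, beta j m * g m := fun j hj g => by
    rw [← Finset.add_sum_erase _ _ hj]
    congr 1
    · simp [Bc]
    · apply Finset.sum_congr rfl
      intro m hm
      have : j ≠ m := (Finset.ne_of_mem_erase hm).symm
      simp [Bc, this]
  -- the equation on `HH`
  have hE : ∀ j ∈ Finset.Icc 1 N, ∀ x ∈ HH Ω (π / K),
      ∑ i, inner ℝ (u j (some i)) (x (some i)) + lam j * inner ℝ (u j none) (x none) =
      ∑ m ∈ Finset.Icc 1 N, Bc j m * ∫ z, (u j none z * x none z) * (u m none z * u m none z) := by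
    intro j hj x hx
    have := hw ⟨j, hj⟩ ⟨x, hx⟩
    rw [← huw j hj] at this
    rw [this, ← Finset.sum_coe_sort (Finset.Icc 1 N)]
    apply Finset.sum_congr rfl
    intro m _
    rw [huw m m.2]
  let P : ℕ → ℕ → L2 n := fun j m => (prod3 (hu6 j) (hu6 m) (hu6 m)).toLp
  let f : ℕ → L2 n := fun j => u j none - lam j • u j none + ∑ m ∈ Finset.Icc 1 N, Bc j m • P j m
  have hP : ∀ j m, P j m =ᵐ[volume] fun z => u j none z * u m none z * u m none z := fun j m =>
    MemLp.coeFn_toLp _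
  have hsumae : ∀ (s : Finset ℕ) (g : ℕ → L2 n), (∑ m ∈ s, g m : L2 n) =ᵐ[volume] fun z => ∑ m ∈ s, g m z := by
    intro s g
    induction s using Finset.induction_on with
    | empty => simp only [Finset.sum_empty]; exact Lp.coeFn_zero ℝ 2 (volume : Measure (Euc n))
    | insert a s ha ih =>
      rw [Finset.sum_insert ha]
      filter_upwards [ih, Lp.coeFn_add (g a) (∑ m ∈ s, g m)] with z h1 h2
      rw [h2, Pi.add_apply, h1, Finset.sum_insert ha]
  have hfae : ∀ j ∈ Finset.Icc 1 N, f j =ᵐ[volume] fun z => u j none z - lam j * u j none z + 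
      (mu j * (u j none z) ^ 3 +
        ∑ m ∈ (Finset.Icc 1 N).erase j, beta j m * u j none z * (u m none z) ^ 2) := by
    intro j hj
    have a1 : ∀ᵐ z, ∀ m, P j m z = u j none z * u m none z * u m none z := ae_all_iff.mpr fun m => hP j m
    have a2 : ∀ᵐ z, ∀ m, (Bc j m • P j m : L2 n) z = Bc j m * P j m z := ae_all_iff.mpr fun m => by
      filter_upwards [Lp.coeFn_smul (Bc j m) (P j m)] with z hz
      rw [hz]; rfl
    filter_upwards [a1, a2, hsumae (Finset.Icc 1 N) fun m => Bc j m • P j m,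
      Lp.coeFn_add (u j none - lam j • u j none) (∑ m ∈ Finset.Icc 1 N, Bc j m • P j m),
      Lp.coeFn_sub (u j none) (lam j • u j none), Lp.coeFn_smul (lam j) (u j none)] with z h1 h2 h3 h4 h5 h6
    simp only [f]
    rw [h4, Pi.add_apply, h5, Pi.sub_apply, h6, h3]
    simp only [h2, h1]
    rw [hsum j hj fun m => u j none z * u m none z * u m none z]
    simp only [Pi.smul_apply, smul_eq_mul]
    congr 2
    · ring
    · exact Finset.sum_congr rfl fun m _ => by ring
  have hEin : ∀ j ∈ Finset.Icc 1 N, ∀ x ∈ HH Ω (π / K), inner ℝ (u j) x = inner ℝ (f j) (x none) := by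
    intro j hj x hx
    have e1 := hE j hj x hx
    have e2 : inner ℝ (u j) x = inner ℝ (u j none) (x none) +
      ∑ i, inner ℝ (u j (some i)) (x (some i)) := by
      rw [PiLp.inner_apply, Fintype.sum_option]
    have e3 : inner ℝ (f j) (x none) = inner ℝ (u j none) (x none) - lam j * inner ℝ (u j none) (x none)
        + ∑ m ∈ Finset.Icc 1 N, Bc j m * inner ℝ (P j m) (x none) := by
      simp only [f]
      rw [inner_add_left, inner_sub_left, real_inner_smul_left, sum_inner]
      simp only [real_inner_smul_left]
    have e4 : ∀ m, inner ℝ (P j m) (x none) = ∫ z, (u j none z * x none z) * (u m none z * u m none z) := by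
      intro m
      rw [L2_inner_eq]
      apply integral_congr_ae
      filter_upwards [hP j m] with z hz
      rw [hz]; ring
    rw [e2, e3]
    simp only [e4]
    rw [← e1]; ring
  refine ⟨u, f, fun j hj => ⟨huH j, ?_, ?_, hfae j hj, fun φ x hφ hx => ?_⟩⟩
  · rw [huw j hj]
    intro h
    exact hw0 ⟨j, hj⟩ (Subtype.ext h)
  · have hne : u j ≠ 0 := by
      rw [huw j hj]
      intro h
      exact hw0 ⟨j, hj⟩ (Subtype.ext h)
    have h1 := hE j hj _ (huH j)
    rw [hsum j hj fun m => ∫ z, (u j none z * u j none z) * (u m none z * u m none z)] at h1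
    have h2 : ∑ m ∈ (Finset.Icc 1 N).erase j, beta j m *
        ∫ z, (u j none z * u j none z) * (u m none z * u m none z) ≤ 0 := by
      apply Finset.sum_nonpos
      intro m hm
      refine mul_nonpos_of_nonpos_of_nonneg (hb j hj m (Finset.mem_of_mem_erase hm) (Finset.ne_of_mem_erase hm).symm).2 ?_
      exact integral_nonneg fun t => mul_nonneg (mul_self_nonneg _) (mul_self_nonneg _)
    have h3 : ∑ i, inner ℝ (u j (some i)) (u j (some i)) = Gr2 (u j) := by
      unfold Gr2
      exact Finset.sum_congr rfl fun i _ => real_inner_self_eq_norm_sq _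
    have h4 := hD Ω _ hΩR _ (huH j)
    have h5 := HH_rot hn R (π / K) hR.le Ω hΩR _ (huH j)
    rw [abs_of_pos (by positivity)] at h5
    rw [h3, real_inner_self_eq_norm_sq] at h1
    set s := √ (Gr2 (u j)) with hs
    have hs2 : Gr2 (u j) = s ^ 2 := (Real.sq_sqrt (Gr2_nonneg _)).symm
    have hs0 : 0 ≤ s := Real.sqrt_nonneg _
    have hspos : 0 < s := by
      rcases hs0.lt_or_eq with h | h
      · exact h
      · exfalso
        rw [← h, mul_zero] at h5
        apply hne
        apply HH_eq_zero (huH j)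
        rw [← norm_le_zero_iff]; linarith
    have h6 : s ^ 2 ≤ mu j * (D * ‖u j none‖ * s ^ 3) := by
      have := mul_le_mul_of_nonneg_left h4 (hmu j hj).le
      have := mul_nonneg (hlam j hj).le (sq_nonneg ‖u j none‖)
      linarith
    have h7 : ‖u j none‖ * K ≤ π * R * s := by
      have h8 : π / K * R * s * K = π * R * s := by field_simp
      have := mul_le_mul_of_nonneg_right h5 hK0.le
      rw [h8] at this
      nlinarith [norm_nonneg (u j none)]
    have h8 : s ^ 2 * K ≤ s ^ 2 * (mu j * (D * (π * R)) * s ^ 2) := by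
      calc s ^ 2 * K ≤ mu j * (D * ‖u j none‖ * s ^ 3) * K := by gcongr
        _ = mu j * D * s ^ 3 * (‖u j none‖ * K) := by ring
        _ ≤ mu j * D * s ^ 3 * (π * R * s) := by
            have := hmu j hj
            gcongr
        _ = _ := by ring
    have h9 := le_of_mul_le_mul_left h8 (by positivity)
    rw [hs2]
    refine h9.trans ?_
    have h10 : mu j * (D * (π * R)) ≤ (∑ j ∈ Finset.Icc 1 N, mu j) * (D * (π * R)) :=
      mul_le_mul_of_nonneg_right (hmuS j hj) (by positivity)
    nlinarith [sq_nonneg s]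
  · refine sym_crit hn (radial_rot hn hΩ) K hK (huH j) (f j) ?_ (hEin j hj) hφ hx
    have hanti : ∀ᵐ z, ∀ m, u m none (rotPt (π / K) z) = - u m none z :=
      ae_all_iff.mpr fun m => HH_anti hn (huH m)
    filter_upwards [hanti, hfae j hj, (rotPt_mp hn (π / K)).quasiMeasurePreserving.ae (hfae j hj)] with z h1 h2 h3
    rw [h3, h2]
    simp only [h1]
    have : ∑ m ∈ (Finset.Icc 1 N).erase j, beta j m * -u j none z * (-u m none z) ^ 2 =
      - ∑ m ∈ (Finset.Icc 1 N).erase j, beta j m * u j none z * (u m none z) ^ 2 := by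
      rw [← Finset.sum_neg_distrib]
      exact Finset.sum_congr rfl fun m _ => by ring
    rw [this]; ring

end OpR

section Op14
open Filter Topology
open scoped ENNReal NNReal FourierTransform SchwartzMap Convolution ContDiff
variable {n : ℕ}

theorem ae_eq_of_schwartz {f g : Euc n → ℂ} (hf : LocallyIntegrable f) (hg : LocallyIntegrable g)
    (h : ∀ φ : 𝓢(Euc n, ℂ), ∫ x, f x * φ x = ∫ x, g x * φ x) : f =ᵐ[volume] g := by
  refine ae_eq_of_integral_contDiff_smul_eq hf hg (fun φ h1 h2 => ?_)
  have h2' : HasCompactSupport (fun x => (φ x : ℂ)) :=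
    h2.comp_left (g := fun t : ℝ => (t : ℂ)) (by simp)
  have h1' : ContDiff ℝ ∞ (fun x => (φ x : ℂ)) := Complex.ofRealCLM.contDiff.comp h1
  have := h (h2'.toSchwartzMap h1')
  have e : ∀ x, (h2'.toSchwartzMap h1') x = (φ x : ℂ) := fun x => rfl
  simp only [e] at this
  simp only [Complex.real_smul]
  calc _ = ∫ x, f x * φ x := by congr 1; ext x; ring
    _ = _ := this
    _ = _ := by congr 1; ext x; ring

theorem fourier_selfadj {f g : Euc n → ℂ} (hf : Integrable f) (hg : Integrable g) :
    ∫ x, 𝓕 f x * g x = ∫ x, f x * 𝓕 g x := by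
  have := VectorFourier.integral_fourierIntegral_smul_eq_flip (L := innerₗ (Euc n))
    Real.continuous_fourierChar (by exact continuous_inner) hf hg (μ := volume) (ν := volume)
  have e : (innerₗ (Euc n)).flip = innerₗ (Euc n) := by
    ext x y; simp [real_inner_comm]
  rw [e] at this
  exact this

theorem fourier_continuous {f : Euc n → ℂ} (hf : Integrable f) : Continuous (𝓕 f) :=
  VectorFourier.fourierIntegral_continuous Real.continuous_fourierChar
    (by exact continuous_inner) hf

theorem fourier_norm_le {f : Euc n → ℂ} (x : Euc n) : ‖𝓕 f x‖ ≤ ∫ z, ‖f z‖ :=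
  VectorFourier.norm_fourierIntegral_le_integral_norm _ _ _ _ _

theorem fourierInv_continuous {f : Euc n → ℂ} (hf : Integrable f) : Continuous (𝓕⁻ f) := by
  have : (𝓕⁻ f) = fun x => 𝓕 f (-x) := by
    ext x; exact Real.fourierInv_eq_fourier_neg f x
  rw [this]; exact (fourier_continuous hf).comp continuous_neg

theorem fourierInv_norm_le {f : Euc n → ℂ} (x : Euc n) : ‖𝓕⁻ f x‖ ≤ ∫ z, ‖f z‖ := by
  rw [Real.fourierInv_eq_fourier_neg]; exact fourier_norm_le _

theorem fourierInv_selfadj {f g : Euc n → ℂ} (hf : Integrable f) (hg : Integrable g) :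
    ∫ x, 𝓕⁻ f x * g x = ∫ x, f x * 𝓕⁻ g x := by
  have h1 : ∀ x, 𝓕⁻ f x = 𝓕 f (-x) := fun x => Real.fourierInv_eq_fourier_neg f x
  have h2 : 𝓕⁻ g = 𝓕 (fun x => g (-x)) := by
    have := Real.fourierInv_eq_fourier_comp_neg g
    exact this
  rw [h2, ← fourier_selfadj hf hg.comp_neg, ← integral_neg_eq_self]
  simp only [h1, neg_neg]

theorem F1 {a b : Euc n → ℂ} (ha : Integrable a) (hb : Integrable b) (h : a =ᵐ[volume] 𝓕⁻ b) :
    𝓕 a =ᵐ[volume] b := by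
  refine ae_eq_of_schwartz (fourier_continuous ha).locallyIntegrable hb.locallyIntegrable
    (fun φ => ?_)
  rw [fourier_selfadj ha φ.integrable]
  have e1 : ∫ x, a x * 𝓕 (φ : Euc n → ℂ) x = ∫ x, 𝓕⁻ b x * 𝓕 (φ : Euc n → ℂ) x := by
    refine integral_congr_ae ?_
    filter_upwards [h] with x hx; rw [hx]
  have i2 : Integrable (𝓕 (φ : Euc n → ℂ)) := (𝓕 φ : 𝓢(Euc n, ℂ)).integrable
  rw [e1, fourierInv_selfadj hb i2]
  rw [Continuous.fourierInv_fourier_eq φ.continuous φ.integrable i2]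

theorem F2 {a : Euc n → ℂ} (ha : Integrable a) (hb : Integrable (𝓕 a)) : a =ᵐ[volume] 𝓕⁻ (𝓕 a) := by
  refine ae_eq_of_schwartz ha.locallyIntegrable (fourierInv_continuous hb).locallyIntegrable
    (fun φ => ?_)
  have i2 : Integrable (𝓕⁻ (φ : Euc n → ℂ)) := by
    rw [← SchwartzMap.fourierInv_coe]; exact (𝓕⁻ φ : 𝓢(Euc n, ℂ)).integrable
  rw [fourierInv_selfadj hb φ.integrable, fourier_selfadj ha i2]
  have i3 : Integrable (𝓕 (φ : Euc n → ℂ)) := (𝓕 φ : 𝓢(Euc n, ℂ)).integrable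
  rw [Continuous.fourier_fourierInv_eq φ.continuous φ.integrable i3]

theorem F3 {a : Euc n → ℂ} (ha : Integrable a) (h2 : MemLp a 2) : MemLp (𝓕 a) 2 := by
  set A : Lp ℂ 2 (volume : Measure (Euc n)) := h2.toLp a
  set G : Lp ℂ 2 (volume : Measure (Euc n)) := 𝓕 A with hG
  have key : (G : Euc n → ℂ) =ᵐ[volume] 𝓕 a := by
    refine ae_eq_of_schwartz ((Lp.memLp G).locallyIntegrable (by norm_num))
      (fourier_continuous ha).locallyIntegrable (fun φ => ?_)
    have h := congrArg (fun T : 𝓢'(Euc n, ℂ) => T φ) (Lp.fourier_toTemperedDistribution_eq A)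
    simp only [TemperedDistribution.fourier_apply, Lp.toTemperedDistribution_apply, smul_eq_mul] at h
    rw [fourier_selfadj ha φ.integrable]
    calc _ = ∫ x, φ x * G x := by congr 1; ext x; ring
      _ = _ := h.symm
      _ = _ := by
        refine integral_congr_ae ?_
        filter_upwards [h2.coeFn_toLp] with x hx
        have : A x = a x := hx
        rw [this, mul_comm]; rfl
  exact (memLp_congr_ae key).1 (Lp.memLp G)

theorem F4 {a b : Euc n → ℂ} (ha : Integrable a) (hb : Integrable b) (hfa : Integrable (𝓕 a))
    (hfb : Integrable (𝓕 b)) : Integrable (fun x => a x * b x) ∧ Integrable (𝓕 (fun x => a x * b x)) := by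
  have ea := F2 ha hfa
  have eb := F2 hb hfb
  have i1 : Integrable (fun x => a x * b x) := by
    refine Integrable.mul_bdd (c := ∫ z, ‖𝓕 b z‖) ha hb.1 ?_
    filter_upwards [eb] with x hx
    rw [hx]; exact fourierInv_norm_le x
  refine ⟨i1, ?_⟩
  have ic := hfa.integrable_convolution (ContinuousLinearMap.mul ℂ ℂ) hfb
  refine ic.congr (F1 i1 ic ?_).symm
  filter_upwards [ea, eb] with x h1 h2
  rw [h1, h2, Real.fourierInv_eq_fourier_neg, Real.fourierInv_eq_fourier_neg, Real.fourierInv_eq_fourier_neg,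
    Real.fourier_mul_convolution_eq hfa hfb]

theorem F5 {b : Euc n → ℂ} (hb : Integrable (fun ξ => (1 + ‖ξ‖)^2 * ‖b ξ‖)) (hm : AEStronglyMeasurable b) :
    ContDiff ℝ 2 (𝓕⁻ b) := by
  have h : ContDiff ℝ ((2:ℕ∞):WithTop ℕ∞) (𝓕 b) := by
    refine Real.contDiff_fourier (fun k hk => ?_)
    refine hb.mono' (by fun_prop) (Eventually.of_forall fun ξ => ?_)
    have hk' : k ≤ 2 := by exact_mod_cast hk
    have h0 := norm_nonneg ξ
    rw [Real.norm_of_nonneg (by positivity)]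
    gcongr
    calc ‖ξ‖^k ≤ (1+‖ξ‖)^k := by gcongr; linarith
      _ ≤ (1+‖ξ‖)^2 := pow_le_pow_right₀ (by linarith) hk'
  have e : (𝓕⁻ b) = fun x => 𝓕 b (-x) := by
    ext x; exact Real.fourierInv_eq_fourier_neg b x
  rw [e]; exact (ContDiff.comp h contDiff_neg)
end Op14

section Op15
open Filter Topology
open scoped ENNReal NNReal FourierTransform ContDiff Manifold
variable {n : ℕ}

def TestI (Ω : Set (Euc n)) (χ : Euc n → ℝ) : Prop :=
  ContDiff ℝ ∞ χ ∧ HasCompactSupport χ ∧ tsupport χ ⊆ Ω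

theorem cutoff_exists {Ω K : Set (Euc n)} (hΩ : IsOpen Ω) (hK : IsCompact K) (hKΩ : K ⊆ Ω) :
    ∃ χ, TestI Ω χ ∧ ∃ V, IsOpen V ∧ K ⊆ V ∧ ∀ x ∈ V, χ x = 1 := by
  obtain ⟨L, hL, hKL, hLΩ⟩ := exists_compact_between hK hΩ hKΩ
  obtain ⟨f, h1, h2, -⟩ := exists_contMDiffMap_one_nhds_of_subset_interior (n := (⊤ : ℕ∞)) 𝓘(ℝ, Euc n)
    hK.isClosed hKL
  have hs : tsupport f ⊆ L := by
    refine closure_minimal ?_ hL.isClosed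
    intro x hx; by_contra h; exact hx (h2 x h)
  obtain ⟨V, hV, hKV, hV1⟩ := mem_nhdsSet_iff_exists.1 h1
  refine ⟨f, ⟨f.contMDiff.contDiff, ?_, hs.trans hLΩ⟩, V, hV, hKV, fun x hx => hV1 hx⟩
  exact hL.of_isClosed_subset (isClosed_tsupport _) hs

theorem TestI.deriv {Ω : Set (Euc n)} {χ : Euc n → ℝ} (h : TestI Ω χ) (i : Fin n) :
    TestI Ω (fun x => fderiv ℝ χ x (bv i)) := by
  refine ⟨?_, h.2.1.fderiv_apply ℝ _, (tsupport_fderiv_apply_subset ℝ _).trans h.2.2⟩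
  exact (h.1.fderiv_right (m := ∞) (by simp)).clm_apply contDiff_const

theorem TestI.sum {Ω : Set (Euc n)} {ι : Type*} (s : Finset ι) {χ : ι → Euc n → ℝ}
    (h : ∀ i ∈ s, TestI Ω (χ i)) : TestI Ω (fun x => ∑ i ∈ s, χ i x) := by
  classical
  induction s using Finset.induction_on with
  | empty =>
    simp only [Finset.sum_empty]
    refine ⟨contDiff_const, HasCompactSupport.zero, ?_⟩
    have : tsupport (fun _ : Euc n => (0:ℝ)) = ∅ := tsupport_eq_empty_iff.2 rfl
    rw [this]; exact Set.empty_subset _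
  | insert a s ha ih =>
    have h1 := h a (by simp)
    have h2 := ih (fun i hi => h i (by simp [hi]))
    simp only [Finset.sum_insert ha]
    exact ⟨h1.1.add h2.1, h1.2.1.add h2.2.1, (tsupport_add _ _).trans (Set.union_subset h1.2.2 h2.2.2)⟩

theorem TestI.lap {Ω : Set (Euc n)} {χ : Euc n → ℝ} (h : TestI Ω χ) : TestI Ω (lap χ) :=
  TestI.sum _ (fun i _ => (h.deriv i).deriv i)

theorem lap_mul {f g : Euc n → ℝ} (hf : ContDiff ℝ 2 f) (hg : ContDiff ℝ 2 g) (x : Euc n) :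
    lap (fun y => f y * g y) x = lap f x * g x +
      2 * ∑ i, fderiv ℝ f x (bv i) * fderiv ℝ g x (bv i) + f x * lap g x := by
  have df := hf.differentiable (by norm_num)
  have dg := hg.differentiable (by norm_num)
  have df' : ∀ i, Differentiable ℝ (fun y => fderiv ℝ f y (bv i)) := fun i =>
    ((hf.fderiv_right (m := 1) (by norm_num)).clm_apply contDiff_const).differentiable (by norm_num)
  have dg' : ∀ i, Differentiable ℝ (fun y => fderiv ℝ g y (bv i)) := fun i =>
    ((hg.fderiv_right (m := 1) (by norm_num)).clm_apply contDiff_const).differentiable (by norm_num)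
  have e : ∀ i : Fin n, (fun y => fderiv ℝ (fun y => f y * g y) y (bv i)) =
      fun y => f y * fderiv ℝ g y (bv i) + fderiv ℝ f y (bv i) * g y := by
    intro i; ext y
    rw [fderiv_fun_mul (df y) (dg y)]; simp; ring
  unfold _root_.lap
  rw [Finset.sum_mul, Finset.mul_sum, Finset.mul_sum, ← Finset.sum_add_distrib, ← Finset.sum_add_distrib]
  refine Finset.sum_congr rfl (fun i _ => ?_)
  have e' := e i
  simp only [bv] at e' df' dg' ⊢
  rw [e', fderiv_fun_add ((df x).fun_mul (dg' i x)) ((df' i x).fun_mul (dg x)),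
    fderiv_fun_mul (df x) (dg' i x), fderiv_fun_mul (df' i x) (dg x)]
  simp; ring

def wv (ξ : Euc n) (a : ℝ) (x : Euc n) : ℝ := Real.cos (2 * π * inner ℝ x ξ + a)

theorem wv_contDiff (ξ : Euc n) (a : ℝ) {m : WithTop ℕ∞} : ContDiff ℝ m (wv ξ a) := by
  unfold wv
  exact ((contDiff_const.mul (contDiff_id.inner ℝ contDiff_const)).add contDiff_const).cos

theorem wv_deriv (ξ : Euc n) (a : ℝ) (x : Euc n) (i : Fin n) :
    fderiv ℝ (wv ξ a) x (bv i) = 2 * π * ξ i * wv ξ (a + π / 2) x := by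
  have h1 : HasFDerivAt (fun x : Euc n => 2 * π * inner ℝ x ξ + a) ((2 * π) • (innerSL ℝ ξ)) x := by
    have : HasFDerivAt (fun x : Euc n => inner ℝ ξ x) (innerSL ℝ ξ) x := (innerSL ℝ ξ).hasFDerivAt
    have e : (fun x : Euc n => 2 * π * inner ℝ x ξ + a) = fun x => 2 * π * inner ℝ ξ x + a := by
      ext x; rw [real_inner_comm]
    rw [e]
    exact (this.const_mul (2 * π)).add_const a
  unfold wv
  rw [h1.cos.fderiv]
  have : Real.cos (2 * π * inner ℝ x ξ + (a + π / 2)) = - Real.sin (2 * π * inner ℝ x ξ + a) := by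
    rw [← add_assoc, Real.cos_add_pi_div_two]
  rw [this]
  simp [bv, EuclideanSpace.inner_single_right]; ring

theorem wv_lap (ξ : Euc n) (a : ℝ) (x : Euc n) :
    lap (wv ξ a) x = - (4 * π ^ 2 * ‖ξ‖ ^ 2) * wv ξ a x := by
  have e : ∀ i : Fin n, (fun y => fderiv ℝ (wv ξ a) y (bv i)) = fun y => 2 * π * ξ i * wv ξ (a + π / 2) y :=
    fun i => funext fun y => wv_deriv ξ a y i
  have h2 : wv ξ (a + π / 2 + π / 2) x = - wv ξ a x := by
    unfold wv
    rw [show 2 * π * inner ℝ x ξ + (a + π / 2 + π / 2) = (2 * π * inner ℝ x ξ + a) + π by ring, Real.cos_add_pi]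
  unfold _root_.lap
  have : ∀ i : Fin n, fderiv ℝ (fun y => fderiv ℝ (wv ξ a) y (bv i)) x (bv i) =
      - (4 * π ^ 2 * (ξ i)^2) * wv ξ a x := by
    intro i
    rw [e i, fderiv_const_mul ((wv_contDiff ξ _ (m := 1)).differentiable (by norm_num) x)]
    simp only [FunLike.coe_smul, Pi.smul_apply, smul_eq_mul]
    rw [wv_deriv, h2]; ring
  simp only [bv] at this
  simp only [this]
  rw [EuclideanSpace.norm_sq_eq, ← Finset.sum_mul, ← mul_neg_one, Finset.sum_congr rfl (fun i _ => by
    rw [neg_eq_neg_one_mul]), ← Finset.mul_sum, ← Finset.mul_sum]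
  simp
end Op15

section Op16
open Filter Topology
open scoped ENNReal NNReal FourierTransform ContDiff Manifold
variable {n : ℕ}

def DistEq (Ω : Set (Euc n)) (u f : Euc n → ℝ) : Prop :=
  ∀ φ : Euc n → ℝ, ContDiff ℝ 2 φ → HasCompactSupport φ → tsupport φ ⊆ Ω →
    (∫ x, u x * φ x) - (∫ x, u x * lap φ x) = ∫ x, f x * φ x

def cut (χ g : Euc n → ℝ) (x : Euc n) : ℂ := ((χ x * g x : ℝ) : ℂ)

theorem wv_bound (ξ : Euc n) (a : ℝ) (x : Euc n) : ‖wv ξ a x‖ ≤ 1 := by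
  rw [Real.norm_eq_abs]; exact Real.abs_cos_le_one _

theorem int_wv {g : Euc n → ℝ} (hg : Integrable g) (ξ : Euc n) (a : ℝ) :
    Integrable (fun x => g x * wv ξ a x) :=
  Integrable.mul_bdd (c := 1) hg (wv_contDiff ξ a (m := 0)).continuous.aestronglyMeasurable
    (Eventually.of_forall (wv_bound ξ a))

theorem testI_int {Ω : Set (Euc n)} {χ u : Euc n → ℝ} (h : TestI Ω χ) (hu : MemLp u 2) :
    Integrable (fun x => χ x * u x) :=
  MemLp.integrable_mul (p := 2) (q := 2) (test_memLp h.1.continuous h.2.1 2) hu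

theorem fourier_wv {g : Euc n → ℝ} (hg : Integrable g) (ξ : Euc n) :
    𝓕 (fun x => (g x : ℂ)) ξ = ((∫ x, g x * wv ξ 0 x : ℝ) : ℂ) + Complex.I * ((∫ x, g x * wv ξ (π/2) x : ℝ) : ℂ) := by
  rw [Real.fourier_eq']
  rw [← integral_complex_ofReal, ← integral_complex_ofReal, ← integral_const_mul, ← integral_add]
  · refine integral_congr_ae (Eventually.of_forall fun x => ?_)
    simp only [smul_eq_mul]
    rw [Complex.exp_mul_I, ← Complex.ofReal_cos, ← Complex.ofReal_sin]
    have h1 : wv ξ 0 x = Real.cos (-2 * π * inner ℝ x ξ) := by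
      unfold wv; rw [← Real.cos_neg]; congr 1; ring
    have h2 : wv ξ (π/2) x = Real.sin (-2 * π * inner ℝ x ξ) := by
      unfold wv
      rw [Real.cos_add_pi_div_two, ← Real.sin_neg]; congr 1; ring
    rw [h1, h2]; push_cast; ring
  · exact (int_wv hg ξ 0).ofReal
  · exact ((int_wv hg ξ (π/2)).ofReal).const_mul _

theorem real_id {Ω : Set (Euc n)} {u f χ : Euc n → ℝ} (hu : MemLp u 2) (hD : DistEq Ω u f)
    (h : TestI Ω χ) (ξ : Euc n) (a : ℝ) :
    (1 + 4 * π^2 * ‖ξ‖^2) * (∫ x, χ x * u x * wv ξ a x) = (∫ x, χ x * f x * wv ξ a x) +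
      (∫ x, lap χ x * u x * wv ξ a x) +
      4 * π * ∑ i, ξ i * ∫ x, fderiv ℝ χ x (bv i) * u x * wv ξ (a + π/2) x := by
  have c2 : ContDiff ℝ 2 χ := h.1.of_le (by norm_cast)
  have hd := hD (fun x => χ x * wv ξ a x) (c2.mul (wv_contDiff ξ a)) h.2.1.mul_right
    ((tsupport_mul_subset_left).trans h.2.2)
  have e : ∀ x, u x * lap (fun x => χ x * wv ξ a x) x = lap χ x * u x * wv ξ a x +
      4 * π * (∑ i, ξ i * (fderiv ℝ χ x (bv i) * u x * wv ξ (a + π/2) x)) -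
      4 * π^2 * ‖ξ‖^2 * (χ x * u x * wv ξ a x) := by
    intro x
    rw [lap_mul c2 (wv_contDiff ξ a), wv_lap]
    simp only [wv_deriv]
    rw [Finset.mul_sum, Finset.mul_sum]
    have : u x * ∑ i, 2 * (fderiv ℝ χ x (bv i) * (2 * π * ξ i * wv ξ (a + π/2) x)) =
      ∑ i, 4 * π * (ξ i * (fderiv ℝ χ x (bv i) * u x * wv ξ (a + π/2) x)) := by
      rw [Finset.mul_sum]; refine Finset.sum_congr rfl (fun i _ => ?_); ring
    rw [← this]; ring
  simp only [e] at hd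
  have i1 := int_wv (testI_int h.lap hu) ξ a
  have i2 : ∀ i, Integrable (fun x => ξ i * (fderiv ℝ χ x (bv i) * u x * wv ξ (a + π/2) x)) := fun i =>
    (int_wv (testI_int (h.deriv i) hu) ξ (a + π/2)).const_mul (ξ i)
  have i3 := (int_wv (testI_int h hu) ξ a).const_mul (4 * π^2 * ‖ξ‖^2)
  have i4 : Integrable (fun x => 4 * π * (∑ i, ξ i * (fderiv ℝ χ x (bv i) * u x * wv ξ (a + π/2) x))) :=
    (integrable_finsetSum _ (fun i _ => i2 i)).const_mul _
  have i14 : Integrable (fun x => lap χ x * u x * wv ξ a x + 4 * π * (∑ i, ξ i * (fderiv ℝ χ x (bv i) * u x * wv ξ (a + π/2) x))) := i1.add i4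
  rw [integral_sub i14 i3, integral_add i1 i4, integral_const_mul, integral_const_mul,
    integral_finsetSum _ (fun i _ => i2 i)] at hd
  simp only [integral_const_mul] at hd
  have e1 : ∫ x, u x * (χ x * wv ξ a x) = ∫ x, χ x * u x * wv ξ a x := by congr 1; ext x; ring
  have e2 : ∫ x, f x * (χ x * wv ξ a x) = ∫ x, χ x * f x * wv ξ a x := by congr 1; ext x; ring
  rw [e1, e2] at hd
  linarith

theorem fourier_id {Ω : Set (Euc n)} {u f χ : Euc n → ℝ} (hu : MemLp u 2) (hf : MemLp f 2) (hD : DistEq Ω u f)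
    (h : TestI Ω χ) (ξ : Euc n) :
    ((1 + 4 * π^2 * ‖ξ‖^2 : ℝ) : ℂ) * 𝓕 (cut χ u) ξ = 𝓕 (cut χ f) ξ + 𝓕 (cut (lap χ) u) ξ
      - 4 * π * Complex.I * ∑ i, (ξ i : ℂ) * 𝓕 (cut (fun x => fderiv ℝ χ x (bv i)) u) ξ := by
  have h0 := real_id hu hD h ξ 0
  have h1 := real_id hu hD h ξ (π/2)
  have hpi : ∀ x, wv ξ (π/2 + π/2) x = - wv ξ 0 x := by
    intro x; unfold wv
    rw [show 2 * π * inner ℝ x ξ + (π / 2 + π / 2) = (2 * π * inner ℝ x ξ + 0) + π by ring, Real.cos_add_pi]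
  simp only [hpi, mul_neg, integral_neg, zero_add, Finset.sum_neg_distrib] at h0 h1
  unfold cut
  rw [fourier_wv (testI_int h hu), fourier_wv (testI_int h hf), fourier_wv (testI_int h.lap hu)]
  have e : ∀ i : Fin n, 𝓕 (fun x => ((fderiv ℝ χ x (bv i) * u x : ℝ) : ℂ)) ξ = _ := fun i =>
    fourier_wv (testI_int (h.deriv i) hu) ξ
  simp only [e, mul_add, Finset.sum_add_distrib]
  have h0' := congrArg (fun t : ℝ => (t : ℂ)) h0
  have h1' := congrArg (fun t : ℝ => (t : ℂ)) h1
  push_cast at h0' h1' ⊢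
  have e3 : ∀ i : Fin n, (ξ i : ℂ) * (Complex.I * ((∫ x, fderiv ℝ χ x (bv i) * u x * wv ξ (π/2) x : ℝ) : ℂ)) =
    Complex.I * ((ξ i : ℂ) * ((∫ x, fderiv ℝ χ x (bv i) * u x * wv ξ (π/2) x : ℝ) : ℂ)) := fun i => by ring
  simp only [e3, ← Finset.mul_sum]
  linear_combination h0' + Complex.I * h1' + (4 * π * ∑ i, (ξ i : ℂ) * ((∫ x, fderiv ℝ χ x (bv i) * u x * wv ξ (π/2) x : ℝ) : ℂ)) * Complex.I_sq
end Op16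

section Op17
open Filter Topology
open scoped ENNReal NNReal FourierTransform ContDiff Manifold
variable {n : ℕ}

def WT (Ω : Set (Euc n)) (p : ℝ≥0∞) (m : ℕ) (g : Euc n → ℝ) : Prop :=
  ∀ χ, TestI Ω χ → Integrable (cut χ g) ∧ MemLp (fun ξ => (1 + ‖ξ‖)^m * ‖𝓕 (cut χ g) ξ‖) p

theorem WT_bound {Ω : Set (Euc n)} {u f χ : Euc n → ℝ} (hu : MemLp u 2) (hf : MemLp f 2) (hD : DistEq Ω u f)
    (h : TestI Ω χ) (ξ : Euc n) {m : ℕ} (hm : m ≤ 1) :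
    (1 + ‖ξ‖)^(m+1) * ‖𝓕 (cut χ u) ξ‖ ≤ 8 * π * (‖𝓕 (cut χ f) ξ‖ + (1 + ‖ξ‖)^m * ‖𝓕 (cut (lap χ) u) ξ‖ +
      ∑ i, (1 + ‖ξ‖)^m * ‖𝓕 (cut (fun x => fderiv ℝ χ x (bv i)) u) ξ‖) := by
  have key := congrArg norm (fourier_id hu hf hD h ξ)
  have hr := norm_nonneg ξ
  have hp : (3:ℝ) < π := Real.pi_gt_three
  set r := ‖ξ‖ with hrdef
  set A := ‖𝓕 (cut χ u) ξ‖
  set B := ‖𝓕 (cut χ f) ξ‖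
  set C := ‖𝓕 (cut (lap χ) u) ξ‖
  set D : Fin n → ℝ := fun i => ‖𝓕 (cut (fun x => fderiv ℝ χ x (bv i)) u) ξ‖ with hDdef
  have hB : 0 ≤ B := norm_nonneg _
  have hC : 0 ≤ C := norm_nonneg _
  have hA : 0 ≤ A := norm_nonneg _
  have hDs : 0 ≤ ∑ i, D i := Finset.sum_nonneg fun i _ => norm_nonneg _
  have h1 : (1 + 4 * π^2 * r^2) * A ≤ B + C + 4 * π * (r * ∑ i, D i) := by
    calc (1 + 4 * π^2 * r^2) * A = ‖((1 + 4 * π^2 * r^2 : ℝ) : ℂ) * 𝓕 (cut χ u) ξ‖ := by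
          rw [norm_mul, Complex.norm_real, Real.norm_of_nonneg (by positivity)]
      _ = _ := key
      _ ≤ (B + C) + ‖4 * π * Complex.I * ∑ i, (ξ i : ℂ) * 𝓕 (cut (fun x => fderiv ℝ χ x (bv i)) u) ξ‖ :=
          (norm_sub_le _ _).trans (by gcongr; exact norm_add_le _ _)
      _ ≤ _ := by
          gcongr
          rw [norm_mul]
          have : ‖(4:ℂ) * π * Complex.I‖ = 4 * π := by
            simp [abs_of_pos Real.pi_pos]
          rw [this]
          gcongr
          refine (norm_sum_le _ _).trans ?_
          rw [Finset.mul_sum]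
          refine Finset.sum_le_sum fun i _ => ?_
          rw [norm_mul, Complex.norm_real]
          gcongr
          exact PiLp.norm_apply_le ξ i
  have h2 : (1 + r)^2 * A ≤ 8 * π * (B + C + (1 + r) * ∑ i, D i) := by
    have : (1 + r)^2 * A ≤ 2 * ((1 + 4 * π^2 * r^2) * A) := by
      rw [← mul_assoc]; gcongr; nlinarith [sq_nonneg (r - 1), sq_nonneg r, mul_nonneg (sq_nonneg r) (by nlinarith : 0 ≤ 4 * π^2 - 1)]
    nlinarith [mul_nonneg hr hDs, mul_nonneg Real.pi_pos.le hDs, mul_nonneg (by linarith : 0 ≤ π - 3) hB, mul_nonneg (by linarith : 0 ≤ π - 3) hC]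
  rw [← Finset.mul_sum]
  have hm0 : (1 + r)^m ≤ 1 + r := by
    calc (1+r)^m ≤ (1+r)^1 := pow_le_pow_right₀ (by linarith) hm
      _ = _ := pow_one _
  have hm1 : 0 ≤ (1 + r)^m := by positivity
  refine le_of_mul_le_mul_left ?_ (by linarith : 0 < 1 + r)
  calc (1 + r) * ((1 + r)^(m+1) * A) = (1 + r)^m * ((1 + r)^2 * A) := by ring
    _ ≤ (1 + r)^m * (8 * π * (B + C + (1 + r) * ∑ i, D i)) := by gcongr
    _ = 8 * π * ((1+r)^m * B + 1 * ((1+r)^m * C) + (1+r) * ((1+r)^m * ∑ i, D i)) := by ring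
    _ ≤ 8 * π * ((1+r) * B + (1+r) * ((1+r)^m * C) + (1+r) * ((1+r)^m * ∑ i, D i)) := by
        gcongr; linarith
    _ = _ := by ring

theorem WT_meas {χ g : Euc n → ℝ} (h : Integrable (cut χ g)) (m : ℕ) :
    AEStronglyMeasurable (fun ξ => (1 + ‖ξ‖)^m * ‖𝓕 (cut χ g) ξ‖) := by
  have := fourier_continuous h
  exact Continuous.aestronglyMeasurable (by fun_prop)

theorem WT_step {Ω : Set (Euc n)} {u f : Euc n → ℝ} {p : ℝ≥0∞} (hp : 1 ≤ p) (hu : MemLp u 2) (hf : MemLp f 2) (hD : DistEq Ω u f)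
    {m : ℕ} (hm : m ≤ 1) (h1 : WT Ω p 0 f) (h2 : WT Ω p m u) : WT Ω p (m+1) u := by
  intro χ hχ
  have hi : Integrable (cut χ u) := (testI_int hχ hu).ofReal
  refine ⟨hi, ?_⟩
  have m1 := (h1 χ hχ).2
  have m2 := (h2 _ hχ.lap).2
  have m3 := memLp_finsetSum Finset.univ (fun i _ => (h2 _ (hχ.deriv i)).2)
  have m4 := ((m1.add m2).add m3).const_mul (8 * π)
  refine m4.mono (WT_meas hi _) (Eventually.of_forall fun ξ => ?_)
  have hb := WT_bound hu hf hD hχ ξ hm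
  have hr := norm_nonneg ξ
  rw [Real.norm_of_nonneg (by positivity)]
  refine hb.trans ((le_of_eq ?_).trans (le_abs_self _))
  simp

theorem WT_L2 {Ω : Set (Euc n)} {u : Euc n → ℝ} (hu : MemLp u 2) : WT Ω 2 0 u := by
  intro χ hχ
  have hi : Integrable (cut χ u) := (testI_int hχ hu).ofReal
  refine ⟨hi, ?_⟩
  have hb : MemLp χ ⊤ := test_memLp hχ.1.continuous hχ.2.1 ⊤
  have h2 : MemLp (fun x => χ x * u x) 2 := MemLp.mul (p := ⊤) (q := 2) hu hb
  have h3 : MemLp (cut χ u) 2 := h2.ofReal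
  simpa using (F3 hi h3).norm

theorem WT_2_1 (hn : n = 2 ∨ n = 3) {Ω : Set (Euc n)} {u : Euc n → ℝ} (h : WT Ω 2 2 u) : WT Ω 1 0 u := by
  intro χ hχ
  obtain ⟨hi, h2⟩ := h χ hχ
  refine ⟨hi, ?_⟩
  have hw : MemLp (fun ξ : Euc n => ((1 + ‖ξ‖)^2)⁻¹) 2 := by
    rw [memLp_two_iff_integrable_sq (by
      refine Continuous.aestronglyMeasurable (Continuous.inv₀ (by fun_prop) (fun x => ?_))
      positivity)]
    have := integrable_one_add_norm (E := Euc n) (μ := volume) (r := 4) (by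
      rw [finrank_euclideanSpace_fin]; rcases hn with rfl | rfl <;> norm_num)
    refine this.congr (Eventually.of_forall fun ξ => ?_)
    have hr := norm_nonneg ξ
    simp only
    rw [Real.rpow_neg (by positivity), show (4:ℝ) = ((4:ℕ):ℝ) by norm_num, Real.rpow_natCast, inv_pow, ← pow_mul]
  have := MemLp.mul (r := 1) (p := 2) (q := 2) h2 hw
  refine (memLp_congr_ae (Eventually.of_forall fun ξ => ?_)).1 this
  have hr := norm_nonneg ξ
  simp only [Pi.mul_apply]
  field_simp

theorem cut_congr {χ g h : Euc n → ℝ} (e : g =ᵐ[volume] h) : cut χ g =ᵐ[volume] cut χ h := by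
  filter_upwards [e] with x hx; simp [cut, hx]

theorem fourier_congr {a b : Euc n → ℂ} (h : a =ᵐ[volume] b) : 𝓕 a = 𝓕 b := by
  ext ξ
  rw [Real.fourier_eq', Real.fourier_eq']
  refine integral_congr_ae ?_
  filter_upwards [h] with x hx; rw [hx]

theorem WT10 {Ω : Set (Euc n)} {g : Euc n → ℝ} : WT Ω 1 0 g ↔ ∀ χ, TestI Ω χ → Integrable (cut χ g) ∧ Integrable (𝓕 (cut χ g)) := by
  refine forall_congr' fun χ => forall_congr' fun hχ => and_congr_right fun hi => ?_
  simp only [pow_zero, one_mul]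
  rw [memLp_one_iff_integrable, integrable_norm_iff (fourier_continuous hi).aestronglyMeasurable]

theorem WT_congr {Ω : Set (Euc n)} {g h : Euc n → ℝ} (e : g =ᵐ[volume] h) (hg : WT Ω 1 0 g) : WT Ω 1 0 h := by
  rw [WT10] at *
  intro χ hχ
  rw [← fourier_congr (cut_congr e)]
  exact ⟨(hg χ hχ).1.congr (cut_congr e), (hg χ hχ).2⟩

theorem WT_add {Ω : Set (Euc n)} {g h : Euc n → ℝ} (hg : WT Ω 1 0 g) (hh : WT Ω 1 0 h) :
    WT Ω 1 0 (fun x => g x + h x) := by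
  rw [WT10] at *
  intro χ hχ
  have e : cut χ (fun x => g x + h x) = cut χ g + cut χ h := by
    ext x; simp [cut]; ring
  have : 𝓕 (cut χ g + cut χ h) = 𝓕 (cut χ g) + 𝓕 (cut χ h) :=
    (VectorFourier.fourierIntegral_add (L := innerₗ (Euc n)) Real.continuous_fourierChar (by exact continuous_inner)
      (hg χ hχ).1 (hh χ hχ).1)
  rw [e, this]
  exact ⟨(hg χ hχ).1.add (hh χ hχ).1, (hg χ hχ).2.add (hh χ hχ).2⟩

theorem WT_smul {Ω : Set (Euc n)} {g : Euc n → ℝ} (c : ℝ) (hg : WT Ω 1 0 g) :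
    WT Ω 1 0 (fun x => c * g x) := by
  rw [WT10] at *
  intro χ hχ
  have e : cut χ (fun x => c * g x) = (c:ℂ) • cut χ g := by
    ext x; simp [cut]; ring
  have e2 : 𝓕 ((c:ℂ) • cut χ g) = (c:ℂ) • 𝓕 (cut χ g) := by
    ext ξ
    simp only [Real.fourier_eq', Pi.smul_apply, smul_eq_mul]
    rw [← integral_const_mul]; congr 1; ext x; ring
  rw [e, e2]
  exact ⟨(hg χ hχ).1.smul _, (hg χ hχ).2.smul _⟩

theorem WT_mul {Ω : Set (Euc n)} (hΩ : IsOpen Ω) {g h : Euc n → ℝ} (hg : WT Ω 1 0 g) (hh : WT Ω 1 0 h) :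
    WT Ω 1 0 (fun x => g x * h x) := by
  rw [WT10] at *
  intro χ hχ
  obtain ⟨χ', hχ', V, -, hV, h1⟩ := cutoff_exists hΩ hχ.2.1 hχ.2.2
  have e : cut χ (fun x => g x * h x) = fun x => cut χ g x * cut χ' h x := by
    ext x
    by_cases hx : x ∈ tsupport χ
    · simp [cut, h1 x (hV hx)]; ring
    · simp [cut, image_eq_zero_of_notMem_tsupport hx]
  rw [e]
  exact F4 (hg χ hχ).1 (hh χ' hχ').1 (hg χ hχ).2 (hh χ' hχ').2

theorem WT_zero {Ω : Set (Euc n)} : WT Ω 1 0 (fun _ => (0:ℝ)) := by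
  rw [WT10]
  intro χ hχ
  have : cut χ (fun _ => (0:ℝ)) = 0 := by ext x; simp [cut]
  have e2 : 𝓕 (0 : Euc n → ℂ) = 0 := by ext ξ; simp [Real.fourier_eq']
  rw [this, e2]
  exact ⟨integrable_zero _ _ _, integrable_zero _ _ _⟩

theorem WT_sum {Ω : Set (Euc n)} {ι : Type*} (s : Finset ι) {g : ι → Euc n → ℝ} (hg : ∀ i ∈ s, WT Ω 1 0 (g i)) :
    WT Ω 1 0 (fun x => ∑ i ∈ s, g i x) := by
  classical
  induction s using Finset.induction_on with
  | empty => simpa using WT_zero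
  | insert a s ha ih =>
    simp only [Finset.sum_insert ha]
    exact WT_add (hg a (by simp)) (ih fun i hi => hg i (by simp [hi]))

theorem WT_C2 {Ω : Set (Euc n)} {u : Euc n → ℝ} (h : WT Ω 1 2 u) {χ} (hχ : TestI Ω χ) :
    ∃ W : Euc n → ℝ, ContDiff ℝ 2 W ∧ W =ᵐ[volume] fun x => χ x * u x := by
  obtain ⟨h1, h2⟩ := h χ hχ
  rw [memLp_one_iff_integrable] at h2
  have hm := (fourier_continuous h1).aestronglyMeasurable (μ := volume)
  have hi : Integrable (𝓕 (cut χ u)) := by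
    refine h2.mono hm (Eventually.of_forall fun ξ => ?_)
    have hr := norm_nonneg ξ
    rw [Real.norm_of_nonneg (by positivity)]
    have : 1 ≤ (1 + ‖ξ‖)^2 := one_le_pow₀ (by linarith)
    nlinarith [norm_nonneg (𝓕 (cut χ u) ξ)]
  have hc := F5 h2 hm
  refine ⟨fun x => (𝓕⁻ (𝓕 (cut χ u)) x).re, Complex.reCLM.contDiff.comp hc, ?_⟩
  filter_upwards [F2 h1 hi] with x hx
  rw [← hx]; simp [cut]
end Op17

section Op18
open Filter Topology
open scoped ENNReal NNReal FourierTransform ContDiff Manifold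
variable {n : ℕ}

theorem ibp_test {w ψ : Euc n → ℝ} (hw : ContDiff ℝ 1 w) (hψ : ContDiff ℝ 1 ψ) (hc : HasCompactSupport ψ) (i : Fin n) :
    ∫ z, w z * fderiv ℝ ψ z (bv i) = - ∫ z, fderiv ℝ w z (bv i) * ψ z := by
  have hφc := hw.continuous
  have hφd := test_fderiv_cont hw (bv i)
  exact integral_mul_fderiv_eq_neg_fderiv_mul_of_integrable (μ := volume)
    ((hφd.mul hψ.continuous).integrable_of_hasCompactSupport hc.mul_left)
    ((hφc.mul (test_fderiv_cont hψ _)).integrable_of_hasCompactSupport (hc.fderiv_apply ℝ (bv i)).mul_left)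
    ((hφc.mul hψ.continuous).integrable_of_hasCompactSupport hc.mul_left)
    (fun z _ => hw.differentiable (by norm_num) z)
    (fun z _ => hψ.differentiable (by norm_num) z)

def NL (N : ℕ) (lam mu : ℕ → ℝ) (beta : ℕ → ℕ → ℝ) (w : ℕ → ℝ) (j : ℕ) : ℝ :=
  w j - lam j * w j + (mu j * (w j)^3 + ∑ m ∈ (Icc 1 N).erase j, beta j m * w j * (w m)^2)

def WS (Ω : Set (Euc n)) (θ : ℝ) (N : ℕ) (lam mu : ℕ → ℝ) (beta : ℕ → ℕ → ℝ) (u : ℕ → XX n) (f : ℕ → L2 n) : Prop :=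
  ∀ j ∈ Icc 1 N, u j ∈ HH Ω θ ∧
    (f j =ᵐ[volume] fun z => NL N lam mu beta (fun m => u m none z) j) ∧
    ∀ φ x, IsTest Ω φ → FRep φ x → inner ℝ (u j) x = inner ℝ (f j) (x none)

theorem d1 {φ : Euc n → ℝ} (h : ContDiff ℝ 2 φ) (i : Fin n) : ContDiff ℝ 1 (fun y => fderiv ℝ φ y (bv i)) :=
  (h.fderiv_right (m := 1) (by norm_num)).clm_apply contDiff_const

theorem inner_split {x u : XX n} {φ : Euc n → ℝ} (h : FRep φ x) :
    inner ℝ u x = (∫ z, u none z * φ z) + ∑ i, ∫ z, u (some i) z * fderiv ℝ φ z (bv i) := by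
  rw [PiLp.inner_apply, Fintype.sum_option]
  congr 1
  · rw [L2_inner_eq]
    apply integral_congr_ae
    filter_upwards [h.1] with z h1
    rw [h1]
  · apply Finset.sum_congr rfl
    intro i _
    rw [L2_inner_eq]
    apply integral_congr_ae
    filter_upwards [h.2 i] with z h1
    rw [h1]

theorem L2_test_int (g : L2 n) {ψ : Euc n → ℝ} (hc : Continuous ψ) (hs : HasCompactSupport ψ) :
    Integrable (fun z => g z * ψ z) :=
  MemLp.integrable_mul (p := 2) (q := 2) (Lp.memLp g) (test_memLp hc hs 2)

theorem distEq_of_weak {Ω : Set (Euc n)} {θ : ℝ} {u : XX n} {f : L2 n} (hu : u ∈ HH Ω θ)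
    (h : ∀ φ x, IsTest Ω φ → FRep φ x → inner ℝ u x = inner ℝ f (x none)) :
    DistEq Ω (u none) f := by
  intro φ h1 h2 h3
  have ht : IsTest Ω φ := ⟨h1.of_le (by norm_num), h2, h3⟩
  obtain ⟨x, hx⟩ := rep_exists ht
  have := h φ x ht hx
  rw [inner_split hx, L2_inner_eq] at this
  have e1 : ∫ z, f z * x none z = ∫ z, f z * φ z := by
    apply integral_congr_ae
    filter_upwards [hx.1] with z h1
    rw [h1]
  rw [e1] at this
  rw [← this]
  have e2 : ∀ i, ∫ z, u (some i) z * fderiv ℝ φ z (bv i) = - ∫ z, u none z * fderiv ℝ (fun y => fderiv ℝ φ y (bv i)) z (bv i) :=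
    fun i => HH_ibp hu i (d1 h1 i) (h2.fderiv_apply ℝ _)
  simp only [e2, Finset.sum_neg_distrib, sub_eq_add_neg]
  rw [← integral_finsetSum]
  · congr 2
    refine integral_congr_ae (Eventually.of_forall fun z => ?_)
    simp only [lap, bv, Finset.mul_sum]
  · intro i _
    exact L2_test_int _ (test_fderiv_cont (d1 h1 i) _) ((h2.fderiv_apply ℝ _).fderiv_apply ℝ _)

theorem reg_local (hn : n = 2 ∨ n = 3) {Ω : Set (Euc n)} (hΩ : IsOpen Ω) {θ : ℝ} {N : ℕ} {lam mu : ℕ → ℝ} {beta : ℕ → ℕ → ℝ}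
    {u : ℕ → XX n} {f : ℕ → L2 n} (h : WS Ω θ N lam mu beta u f) (x0 : Euc n) (hx0 : x0 ∈ Ω) :
    ∃ U : Set (Euc n), IsOpen U ∧ x0 ∈ U ∧ U ⊆ Ω ∧ ∃ W : ℕ → Euc n → ℝ, ∀ j ∈ Icc 1 N,
      ContDiff ℝ 2 (W j) ∧ ∀ᵐ x, x ∈ U → W j x = u j none x := by
  have hD : ∀ j ∈ Icc 1 N, DistEq Ω (u j none) (f j) := fun j hj => distEq_of_weak (h j hj).1 (h j hj).2.2
  have a1 : ∀ j ∈ Icc 1 N, WT Ω 1 0 (u j none) := by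
    intro j hj
    have q0 := WT_L2 (Ω := Ω) (Lp.memLp (u j none))
    have q1 := WT_L2 (Ω := Ω) (Lp.memLp (f j))
    have q2 := WT_step (by norm_num) (Lp.memLp _) (Lp.memLp _) (hD j hj) (by norm_num) q1 q0
    have q3 := WT_step (by norm_num) (Lp.memLp _) (Lp.memLp _) (hD j hj) (by norm_num) q1 q2
    exact WT_2_1 hn q3
  have a2 : ∀ j ∈ Icc 1 N, WT Ω 1 0 (f j) := by
    intro j hj
    refine WT_congr (h j hj).2.1.symm ?_
    have w1 := a1 j hj
    have w3 := WT_mul hΩ w1 (WT_mul hΩ w1 w1)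
    have ws := WT_sum ((Icc 1 N).erase j) (g := fun m z => beta j m * (u j none z * (u m none z * u m none z)))
      (fun m hm => WT_smul _ (WT_mul hΩ w1 (WT_mul hΩ (a1 m (Finset.mem_of_mem_erase hm)) (a1 m (Finset.mem_of_mem_erase hm)))))
    have := WT_add (WT_add w1 (WT_smul (-lam j) w1)) (WT_add (WT_smul (mu j) w3) ws)
    convert this using 2 with z
    unfold NL
    have : ∀ m, beta j m * (u j none z * (u m none z * u m none z)) = beta j m * u j none z * (u m none z)^2 := fun m => by ring
    simp only [this]; ring
  have a3 : ∀ j ∈ Icc 1 N, WT Ω 1 2 (u j none) := by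
    intro j hj
    have q2 := WT_step (by norm_num) (Lp.memLp _) (Lp.memLp _) (hD j hj) (by norm_num) (a2 j hj) (a1 j hj)
    exact WT_step (by norm_num) (Lp.memLp _) (Lp.memLp _) (hD j hj) (by norm_num) (a2 j hj) q2
  obtain ⟨χ, hχ, V, hV, hxV, h1⟩ := cutoff_exists hΩ (isCompact_singleton (x := x0)) (by simpa using hx0)
  have : ∀ j, ∃ W : Euc n → ℝ, j ∈ Icc 1 N → ContDiff ℝ 2 W ∧ W =ᵐ[volume] fun x => χ x * u j none x := by
    intro j
    by_cases hj : j ∈ Icc 1 N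
    · obtain ⟨W, hW⟩ := WT_C2 (a3 j hj) hχ
      exact ⟨W, fun _ => hW⟩
    · exact ⟨0, fun hj' => absurd hj' hj⟩
  choose W hW using this
  refine ⟨V ∩ Ω, hV.inter hΩ, ⟨hxV rfl, hx0⟩, Set.inter_subset_right, W, fun j hj => ⟨(hW j hj).1, ?_⟩⟩
  filter_upwards [(hW j hj).2] with x hx hxU
  rw [hx, h1 x hxU.1, one_mul]

theorem lap_congr {f g : Euc n → ℝ} {x : Euc n} (h : f =ᶠ[𝓝 x] g) : lap f x = lap g x := by
  unfold lap
  refine Finset.sum_congr rfl fun i _ => ?_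
  have : (fun y => fderiv ℝ f y (EuclideanSpace.single i 1)) =ᶠ[𝓝 x] (fun y => fderiv ℝ g y (EuclideanSpace.single i 1)) := by
    filter_upwards [h.fderiv (𝕜 := ℝ)] with y hy; rw [hy]
  rw [this.fderiv_eq]

theorem lap_cont {f : Euc n → ℝ} (h : ContDiff ℝ 2 f) : Continuous (lap f) := by
  unfold lap
  exact continuous_finsetSum _ fun i _ => test_fderiv_cont (d1 h i) _

theorem lap_ibp {w φ : Euc n → ℝ} (hw : ContDiff ℝ 2 w) (h1 : ContDiff ℝ 2 φ) (h2 : HasCompactSupport φ) :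
    ∫ z, w z * lap φ z = ∫ z, lap w z * φ z := by
  have e0 : ∀ i : Fin n, ∫ z, w z * fderiv ℝ (fun y => fderiv ℝ φ y (bv i)) z (bv i) =
      ∫ z, fderiv ℝ (fun y => fderiv ℝ w y (bv i)) z (bv i) * φ z := by
    intro i
    rw [ibp_test (hw.of_le (by norm_num)) (d1 h1 i) (h2.fderiv_apply ℝ _), ibp_test (d1 hw i) (h1.of_le (by norm_num)) h2, neg_neg]
  unfold lap
  simp only [Finset.mul_sum, Finset.sum_mul]
  rw [integral_finsetSum, integral_finsetSum]
  · exact Finset.sum_congr rfl fun i _ => e0 i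
  · intro i _
    exact ((test_fderiv_cont (d1 hw i) _).mul h1.continuous).integrable_of_hasCompactSupport h2.mul_left
  · intro i _
    exact (hw.continuous.mul (test_fderiv_cont (d1 h1 i) _)).integrable_of_hasCompactSupport ((h2.fderiv_apply ℝ _).fderiv_apply ℝ _).mul_left

theorem int_eq_on {U : Set (Euc n)} {a b φ : Euc n → ℝ} (h : ∀ᵐ x, x ∈ U → a x = b x) (hs : tsupport φ ⊆ U) :
    ∫ z, a z * φ z = ∫ z, b z * φ z := by
  apply integral_congr_ae
  filter_upwards [h] with z hz
  by_cases hzs : z ∈ tsupport φ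
  · rw [hz (hs hzs)]
  · simp [image_eq_zero_of_notMem_tsupport hzs]

theorem grad_eq {Ω U : Set (Euc n)} (hU : IsOpen U) {θ : ℝ} {u : XX n} (hu : u ∈ HH Ω θ) {W : Euc n → ℝ} (hW : ContDiff ℝ 2 W)
    (h : ∀ᵐ x, x ∈ U → W x = u none x) (i : Fin n) : ∀ᵐ x, x ∈ U → u (some i) x = fderiv ℝ W x (bv i) := by
  have hW1 : ContDiff ℝ 1 W := hW.of_le (by norm_num)
  have hl : LocallyIntegrable (fun x => u (some i) x - fderiv ℝ W x (bv i)) :=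
    ((Lp.memLp (u (some i))).locallyIntegrable (by norm_num)).sub (test_fderiv_cont hW1 _).locallyIntegrable
  have := hU.ae_eq_zero_of_integral_contDiff_smul_eq_zero (hl.locallyIntegrableOn U) (fun g g1 g2 g3 => by
    have g1' : ContDiff ℝ 1 g := g1.of_le (by norm_cast)
    have e1 := HH_ibp hu i g1' g2
    have e2 := ibp_test hW1 g1' g2 i
    have e3 := int_eq_on (φ := fun z => fderiv ℝ g z (bv i)) h ((tsupport_fderiv_apply_subset ℝ _).trans g3)
    have e4 : ∫ x, g x • (u (some i) x - fderiv ℝ W x (bv i)) = (∫ x, u (some i) x * g x) - ∫ x, fderiv ℝ W x (bv i) * g x := by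
      have j2 : Integrable (fun x => fderiv ℝ W x (bv i) * g x) := ((test_fderiv_cont hW1 _).mul g1'.continuous).integrable_of_hasCompactSupport g2.mul_left
      rw [← integral_sub (L2_test_int _ g1'.continuous g2) j2]
      congr 1; ext x; simp; ring
    rw [e4, e1, ← e3, e2]; ring)
  filter_upwards [this] with x hx hxU
  linarith [hx hxU]

theorem eq_local {Ω U : Set (Euc n)} (hU : IsOpen U) (hUΩ : U ⊆ Ω) {u f : L2 n} (hD : DistEq Ω u f)
    {W : Euc n → ℝ} (hW : ContDiff ℝ 2 W) (h : ∀ᵐ x, x ∈ U → W x = u x) {F : Euc n → ℝ} (hF : Continuous F)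
    (hf : ∀ᵐ x, x ∈ U → F x = f x) : ∀ x ∈ U, W x - lap W x = F x := by
  have hc : Continuous (fun x => W x - lap W x - F x) := (hW.continuous.sub (lap_cont hW)).sub hF
  have := hU.ae_eq_zero_of_integral_contDiff_smul_eq_zero (hc.locallyIntegrable.locallyIntegrableOn U (μ := volume)) (fun g g1 g2 g3 => by
    have g1' : ContDiff ℝ 2 g := g1.of_le (by norm_cast)
    have e1 := hD g g1' g2 (g3.trans hUΩ)
    have e2 := lap_ibp hW g1' g2
    have hsup : tsupport (lap g) ⊆ U := (TestI.lap ⟨g1, g2, g3⟩).2.2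
    rw [← int_eq_on h g3, ← int_eq_on h hsup, ← int_eq_on hf g3, e2] at e1
    have j1 : Integrable (fun x => W x * g x) := (hW.continuous.mul g1.continuous).integrable_of_hasCompactSupport g2.mul_left
    have j2 : Integrable (fun x => lap W x * g x) := ((lap_cont hW).mul g1.continuous).integrable_of_hasCompactSupport g2.mul_left
    have j3 : Integrable (fun x => F x * g x) := (hF.mul g1.continuous).integrable_of_hasCompactSupport g2.mul_left
    have j4 : Integrable (fun x => W x * g x - lap W x * g x) := j1.sub j2
    have e4 : ∫ x, g x • (W x - lap W x - F x) = (∫ x, W x * g x) - (∫ x, lap W x * g x) - ∫ x, F x * g x := by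
      rw [← integral_sub j1 j2, ← integral_sub j4 j3]
      congr 1; ext x; simp; ring
    rw [e4, e1]; ring)
  have h2 : (fun x => W x - lap W x - F x) =ᵐ[volume.restrict U] fun _ => 0 := by
    rw [EventuallyEq, ae_restrict_iff' hU.measurableSet]
    exact this
  have h3 := Measure.eqOn_open_of_ae_eq h2 hU hc.continuousOn continuousOn_const
  intro x hx
  have := h3 hx
  simp only at this
  linarith
end Op18

section Op19
open Filter Topology
open scoped ENNReal NNReal
variable {n : ℕ}

theorem ae_of_local {Ω : Set (Euc n)} {P : Euc n → Prop}
    (h : ∀ x ∈ Ω, ∃ U : Set (Euc n), IsOpen U ∧ x ∈ U ∧ ∀ᵐ y, y ∈ U → P y) : ∀ᵐ y, y ∈ Ω → P y := by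
  rw [ae_iff]
  refine measure_null_of_locally_null _ (fun x hx => ?_)
  simp only [Classical.not_imp, Set.mem_setOf_eq] at hx
  obtain ⟨U, hU, hxU, hP⟩ := h x hx.1
  refine ⟨U ∩ {a | ¬ (a ∈ Ω → P a)}, inter_mem_nhdsWithin' hU hxU, ?_⟩
  rw [ae_iff] at hP
  refine measure_mono_null ?_ hP
  rintro y ⟨hy1, hy2⟩
  simp only [Classical.not_imp, Set.mem_setOf_eq] at hy2 ⊢
  exact ⟨hy1, hy2.2⟩
where
  inter_mem_nhdsWithin' {U S : Set (Euc n)} {x : Euc n} (hU : IsOpen U) (hx : x ∈ U) : U ∩ S ∈ 𝓝[S] x :=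
    inter_mem (mem_nhdsWithin_of_mem_nhds (hU.mem_nhds hx)) self_mem_nhdsWithin

theorem reg_global (hn : n = 2 ∨ n = 3) {Ω : Set (Euc n)} (hΩ : IsOpen Ω) {θ : ℝ} {N : ℕ} {lam mu : ℕ → ℝ} {beta : ℕ → ℕ → ℝ}
    {u : ℕ → XX n} {f : ℕ → L2 n} (h : WS Ω θ N lam mu beta u f) :
    ∃ w : ℕ → Euc n → ℝ, ∀ j ∈ Icc 1 N, (∀ x ∈ Ω, ContDiffAt ℝ 2 (w j) x) ∧ (∀ x, x ∉ Ω → w j x = 0) ∧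
      (w j =ᵐ[volume] u j none) ∧ (∀ x ∈ Ω, w j x - lap (w j) x = NL N lam mu beta (fun m => w m x) j) ∧
      (∀ i, ∀ᵐ x, x ∈ Ω → u j (some i) x = fderiv ℝ (w j) x (bv i)) := by
  classical
  choose! U hU hxU hUΩ W hW using reg_local hn hΩ h
  set w : ℕ → Euc n → ℝ := fun j x => if x ∈ Ω then W x j x else 0 with hw
  have key : ∀ j ∈ Icc 1 N, ∀ x0 ∈ Ω, ∀ x ∈ U x0, w j x = W x0 j x := by
    intro j hj x0 hx0 x hx
    have hxΩ := hUΩ x0 hx0 hx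
    simp only [hw, hxΩ, if_true]
    have hO : IsOpen (U x ∩ U x0) := (hU x hxΩ).inter (hU x0 hx0)
    have h2 : W x j =ᵐ[volume.restrict (U x ∩ U x0)] W x0 j := by
      rw [EventuallyEq, ae_restrict_iff' hO.measurableSet]
      filter_upwards [(hW x hxΩ j hj).2, (hW x0 hx0 j hj).2] with y h1 h2 hy
      rw [h1 hy.1, h2 hy.2]
    exact Measure.eqOn_open_of_ae_eq h2 hO (hW x hxΩ j hj).1.continuous.continuousOn
      (hW x0 hx0 j hj).1.continuous.continuousOn ⟨hxU x hxΩ, hx⟩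
  have keyE : ∀ j ∈ Icc 1 N, ∀ x0 ∈ Ω, ∀ x ∈ U x0, w j =ᶠ[𝓝 x] W x0 j := by
    intro j hj x0 hx0 x hx
    filter_upwards [(hU x0 hx0).mem_nhds hx] with y hy
    exact key j hj x0 hx0 y hy
  refine ⟨w, fun j hj => ⟨fun x hx => ?_, fun x hx => ?_, ?_, fun x hx => ?_, fun i => ?_⟩⟩
  · exact ((hW x hx j hj).1.contDiffAt).congr_of_eventuallyEq (keyE j hj x hx x (hxU x hx))
  · simp [hw, hx]
  · have h1 : ∀ᵐ y, y ∈ Ω → w j y = u j none y := by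
      refine ae_of_local fun x hx => ⟨U x, hU x hx, hxU x hx, ?_⟩
      filter_upwards [(hW x hx j hj).2] with y hy hyU
      rw [key j hj x hx y hyU, hy hyU]
    filter_upwards [h1, HH_supp (h j hj).1] with y h1 h2
    by_cases hy : y ∈ Ω
    · exact h1 hy
    · rw [h2 hy]; simp [hw, hy]
  · have hWc : ∀ m ∈ Icc 1 N, Continuous (W x m) := fun m hm => (hW x hx m hm).1.continuous
    have hF : Continuous (fun y => NL N lam mu beta (fun m => W x m y) j) := by
      unfold NL
      have := hWc j hj
      refine (this.sub (continuous_const.mul this)).add ((continuous_const.mul (this.pow 3)).add ?_)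
      refine continuous_finsetSum _ fun m hm => (continuous_const.mul this).mul ((hWc m (Finset.mem_of_mem_erase hm)).pow 2)
    have := eq_local (hU x hx) (hUΩ x hx) (distEq_of_weak (h j hj).1 (h j hj).2.2) (hW x hx j hj).1 (hW x hx j hj).2 hF (by
      have hall : ∀ᵐ y, ∀ m ∈ Icc 1 N, y ∈ U x → W x m y = u m none y := by
        rw [Finset.eventually_all]
        intro m hm; exact (hW x hx m hm).2
      filter_upwards [hall, (h j hj).2.1] with y h1 h2 hy
      rw [h2]
      unfold NL
      simp only
      rw [h1 j hj hy]
      congr 2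
      refine Finset.sum_congr rfl fun m hm => ?_
      rw [h1 m (Finset.mem_of_mem_erase hm) hy]) x (hxU x hx)
    rw [lap_congr (keyE j hj x hx x (hxU x hx)), key j hj x hx x (hxU x hx), this]
    unfold NL
    simp only
    rw [key j hj x hx x (hxU x hx)]
    congr 2
    refine Finset.sum_congr rfl fun m hm => ?_
    rw [key m (Finset.mem_of_mem_erase hm) x hx x (hxU x hx)]
  · refine ae_of_local fun x hx => ⟨U x, hU x hx, hxU x hx, ?_⟩
    filter_upwards [grad_eq (hU x hx) (h j hj).1 (hW x hx j hj).1 (hW x hx j hj).2 i] with y hy hyU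
    rw [hy hyU, (keyE j hj x hx y hyU).fderiv_eq]
end Op19

section Op20
open Filter Topology
open scoped ENNReal NNReal ContDiff
variable {n : ℕ}

def Th (t : ℝ) : ℝ := Real.smoothTransition t

theorem Th_contDiff : ContDiff ℝ 1 Th := Real.smoothTransition.contDiff

theorem Th_mono : Monotone Th := Real.smoothTransition.monotone

theorem Th_deriv_nonneg (t : ℝ) : 0 ≤ deriv Th t := Th_mono.deriv_nonneg

theorem Th_zero {t : ℝ} (h : t ≤ 0) : Th t = 0 := Real.smoothTransition.zero_of_nonpos h

theorem Th_nonneg (t : ℝ) : 0 ≤ Th t := Real.smoothTransition.nonneg t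

theorem Th_abs (t : ℝ) : ‖Th t‖ ≤ 1 := by
  rw [Real.norm_eq_abs, abs_of_nonneg (Th_nonneg t)]
  exact Real.smoothTransition.le_one _

theorem Th_deriv_bdd : ∃ L, 0 ≤ L ∧ ∀ t, |deriv Th t| ≤ L := by
  have hc : Continuous (deriv Th) := Th_contDiff.continuous_deriv (by norm_num)
  obtain ⟨L, hL⟩ := (isCompact_Icc (a := (0:ℝ)) (b := 1)).exists_bound_of_continuousOn hc.continuousOn
  refine ⟨|L|, abs_nonneg _, fun t => ?_⟩
  by_cases h0 : t < 0
  · have : Th =ᶠ[𝓝 t] fun _ => 0 := by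
      filter_upwards [Iio_mem_nhds h0] with s hs
      exact Th_zero (le_of_lt hs)
    rw [this.deriv_eq]; simp
  by_cases h1 : 1 < t
  · have : Th =ᶠ[𝓝 t] fun _ => 1 := by
      filter_upwards [Ioi_mem_nhds h1] with s hs
      exact Real.smoothTransition.one_of_one_le (le_of_lt hs)
    rw [this.deriv_eq]; simp
  · exact (hL t ⟨not_lt.1 h0, not_lt.1 h1⟩).trans (le_abs_self L)

theorem comp_test {Ω : Set (Euc n)} (hΩ : IsOpen Ω) {φ v : Euc n → ℝ} (hφ : IsTest Ω φ) (hv : ContDiff ℝ 2 v)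
    (hv0 : ∀ z ∈ Ω, 0 ≤ v z) : ∃ ψ, IsTest Ω ψ ∧ (∀ z ∈ Ω, ψ z = Th (φ z - v z)) ∧ (∀ z, z ∉ Ω → ψ z = 0) ∧
      (∀ z ∈ Ω, ∀ i, fderiv ℝ ψ z (bv i) = deriv Th (φ z - v z) * (fderiv ℝ φ z (bv i) - fderiv ℝ v z (bv i))) ∧
      (∀ z, z ∉ Ω → ∀ i, fderiv ℝ ψ z (bv i) = 0) := by
  obtain ⟨χ, hχ, V, hV, hKV, h1⟩ := cutoff_exists hΩ hφ.2.1.isCompact hφ.2.2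
  have hv1 : ContDiff ℝ 1 v := hv.of_le (by norm_num)
  have hsup : tsupport (fun z => χ z * Th (φ z - v z)) ⊆ Ω := (tsupport_mul_subset_left).trans hχ.2.2
  have hψ : IsTest Ω (fun z => χ z * Th (φ z - v z)) := by
    refine ⟨?_, hχ.2.1.mul_right, hsup⟩
    exact (hχ.1.of_le (by norm_cast)).mul (Th_contDiff.comp (hφ.1.sub hv1))
  have heq : ∀ z ∈ Ω, χ z * Th (φ z - v z) = Th (φ z - v z) := by
    intro z hz
    by_cases hzV : z ∈ V
    · rw [h1 z hzV, one_mul]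
    · have : φ z = 0 := by
        by_contra hne
        exact hzV (hKV (subset_tsupport _ hne))
      rw [this, Th_zero (by linarith [hv0 z hz]), mul_zero]
  refine ⟨_, hψ, heq, fun z hz => ?_, fun z hz i => ?_, fun z hz i => ?_⟩
  · exact image_eq_zero_of_notMem_tsupport (f := fun z => χ z * Th (φ z - v z)) (fun h => hz (hsup h))
  · have e : (fun z => χ z * Th (φ z - v z)) =ᶠ[𝓝 z] fun z => Th (φ z - v z) := by
      filter_upwards [hΩ.mem_nhds hz] with y hy using heq y hy
    rw [e.fderiv_eq]
    have d1 : HasDerivAt Th (deriv Th (φ z - v z)) (φ z - v z) :=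
      (Th_contDiff.differentiable (by norm_num) _).hasDerivAt
    have d2 : HasFDerivAt (fun z => φ z - v z) (fderiv ℝ φ z - fderiv ℝ v z) z :=
      ((hφ.1.differentiable (by norm_num) z).hasFDerivAt).sub ((hv1.differentiable (by norm_num) z).hasFDerivAt)
    have := d1.comp_hasFDerivAt z d2
    have e2 := this.fderiv
    simp only [Function.comp_def] at e2
    rw [e2]; simp
  · have := image_eq_zero_of_notMem_tsupport (f := fderiv ℝ (fun z => χ z * Th (φ z - v z))) (x := z)
      (fun h => hz (hsup (tsupport_fderiv_subset ℝ h)))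
    rw [this]; simp

theorem comp_step {Ω : Set (Euc n)} {θ : ℝ} {u y : XX n} {f : L2 n} {φ v ψ : Euc n → ℝ} (hφ : IsTest Ω φ)
    (hy : FRep φ y) (hv : ContDiff ℝ 2 v)
    (h : ∀ φ x, IsTest Ω φ → FRep φ x → inner ℝ u x = inner ℝ f (x none))
    (hψ : IsTest Ω ψ)
    (hd : ∀ z ∈ Ω, ∀ i, fderiv ℝ ψ z (bv i) = deriv Th (φ z - v z) * (fderiv ℝ φ z (bv i) - fderiv ℝ v z (bv i)))
    (hd0 : ∀ z, z ∉ Ω → ∀ i, fderiv ℝ ψ z (bv i) = 0) {L : ℝ} (hL : 0 ≤ L) (hLb : ∀ t, |deriv Th t| ≤ L)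
    {V : Fin n → L2 n} (hV : ∀ i, ∀ᵐ z, z ∈ Ω → V i z = fderiv ℝ v z (bv i)) :
    ∫ z, (u none z - f z - lap v z) * ψ z ≤ ∑ i, ‖u (some i) - y (some i)‖ * (L * ‖y (some i) - V i‖) := by
  obtain ⟨x, hx⟩ := rep_exists hψ
  have hw := h ψ x hψ hx
  rw [inner_split hx, L2_inner_eq] at hw
  have e1 : ∫ z, f z * x none z = ∫ z, f z * ψ z := by
    apply integral_congr_ae
    filter_upwards [hx.1] with z hz; rw [hz]
  rw [e1] at hw
  have i1 : Integrable (fun z => u none z * ψ z) := L2_test_int _ hψ.1.continuous hψ.2.1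
  have i2 : Integrable (fun z => f z * ψ z) := L2_test_int _ hψ.1.continuous hψ.2.1
  have i3 : Integrable (fun z => lap v z * ψ z) :=
    ((lap_cont hv).mul hψ.1.continuous).integrable_of_hasCompactSupport hψ.2.1.mul_left
  have hdc : ∀ i, Continuous (fun z => fderiv ℝ ψ z (bv i)) := fun i => test_fderiv_cont hψ.1 _
  have hds : ∀ i, HasCompactSupport (fun z => fderiv ℝ ψ z (bv i)) := fun i => hψ.2.1.fderiv_apply ℝ _
  have hv1 : ContDiff ℝ 1 v := hv.of_le (by norm_num)
  have e2 : ∫ z, lap v z * ψ z = - ∑ i, ∫ z, fderiv ℝ v z (bv i) * fderiv ℝ ψ z (bv i) := by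
    have : ∀ i, ∫ z, fderiv ℝ v z (bv i) * fderiv ℝ ψ z (bv i) =
        - ∫ z, fderiv ℝ (fun y => fderiv ℝ v y (bv i)) z (bv i) * ψ z := fun i => ibp_test (d1 hv i) hψ.1 hψ.2.1 i
    rw [Finset.sum_congr rfl (fun i _ => this i), Finset.sum_neg_distrib, neg_neg, ← integral_finsetSum]
    · apply integral_congr_ae
      refine Eventually.of_forall fun z => ?_
      simp only [lap, Finset.sum_mul]; rfl
    · intro i _
      exact ((test_fderiv_cont (d1 hv i) _).mul hψ.1.continuous).integrable_of_hasCompactSupport hψ.2.1.mul_left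
  have e3 : ∫ z, (u none z - f z - lap v z) * ψ z =
      (∫ z, u none z * ψ z) - (∫ z, f z * ψ z) - ∫ z, lap v z * ψ z := by
    have i12 : Integrable (fun z => u none z * ψ z - f z * ψ z) := i1.sub i2
    rw [← integral_sub i1 i2, ← integral_sub i12 i3]
    apply integral_congr_ae
    refine Eventually.of_forall fun z => ?_
    ring
  have key : ∀ i, (∫ z, fderiv ℝ v z (bv i) * fderiv ℝ ψ z (bv i)) - ∫ z, u (some i) z * fderiv ℝ ψ z (bv i) ≤
      ‖u (some i) - y (some i)‖ * (L * ‖y (some i) - V i‖) := by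
    intro i
    have j1 : Integrable (fun z => u (some i) z * fderiv ℝ ψ z (bv i)) := L2_test_int _ (hdc i) (hds i)
    have j2 : Integrable (fun z => y (some i) z * fderiv ℝ ψ z (bv i)) := L2_test_int _ (hdc i) (hds i)
    have j3 : Integrable (fun z => fderiv ℝ v z (bv i) * fderiv ℝ ψ z (bv i)) :=
      ((test_fderiv_cont hv1 _).mul (hdc i)).integrable_of_hasCompactSupport (hds i).mul_left
    have s1 : 0 ≤ (∫ z, y (some i) z * fderiv ℝ ψ z (bv i)) - ∫ z, fderiv ℝ v z (bv i) * fderiv ℝ ψ z (bv i) := by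
      rw [← integral_sub j2 j3]
      apply integral_nonneg_of_ae
      filter_upwards [hy.2 i] with z hz
      simp only [hz, Pi.zero_apply]
      by_cases hzΩ : z ∈ Ω
      · rw [hd z hzΩ]
        have := Th_deriv_nonneg (φ z - v z)
        nlinarith [mul_nonneg this (sq_nonneg (fderiv ℝ φ z (bv i) - fderiv ℝ v z (bv i)))]
      · rw [hd0 z hzΩ]; simp
    have s2 : (∫ z, u (some i) z * fderiv ℝ ψ z (bv i)) - ∫ z, y (some i) z * fderiv ℝ ψ z (bv i) =
        inner ℝ (u (some i) - y (some i)) (x (some i)) := by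
      rw [inner_sub_left, L2_inner_eq, L2_inner_eq]
      congr 1 <;>
      · apply integral_congr_ae
        filter_upwards [hx.2 i] with z hz
        rw [hz]
    have s3 : ‖x (some i)‖ ≤ L * ‖y (some i) - V i‖ := by
      apply Lp.norm_le_mul_norm_of_ae_le_mul
      filter_upwards [hx.2 i, hy.2 i, hV i, Lp.coeFn_sub (y (some i)) (V i)] with z h1 h2 h3 h4
      rw [h1, h4, Pi.sub_apply, h2]
      by_cases hzΩ : z ∈ Ω
      · rw [hd z hzΩ, h3 hzΩ, norm_mul]
        exact mul_le_mul_of_nonneg_right (hLb _) (norm_nonneg _)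
      · rw [hd0 z hzΩ, norm_zero]; positivity
    have s4 := abs_real_inner_le_norm (u (some i) - y (some i)) (x (some i))
    have s5 := mul_le_mul_of_nonneg_left s3 (norm_nonneg (u (some i) - y (some i)))
    have := neg_abs_le (inner ℝ (u (some i) - y (some i)) (x (some i)))
    linarith
  have := Finset.sum_le_sum (fun i (_ : i ∈ Finset.univ) => key i)
  rw [Finset.sum_sub_distrib] at this
  linarith

theorem comp {Ω : Set (Euc n)} (hΩ : IsOpen Ω) {R : ℝ} (hR : Ω ⊆ Metric.ball 0 R) {θ : ℝ} {u : XX n} {f : L2 n}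
    (hu : u ∈ HH Ω θ) {v : Euc n → ℝ} (hv : ContDiff ℝ 2 v) (hv0 : ∀ z ∈ Ω, 0 ≤ v z)
    (h : ∀ φ x, IsTest Ω φ → FRep φ x → inner ℝ u x = inner ℝ f (x none)) :
    IntegrableOn (fun z => u none z - f z - lap v z) Ω ∧
    ∫ z in Ω, (u none z - f z - lap v z) * Th (u none z - v z) ≤ 0 := by
  have hfin : volume Ω < ⊤ := (measure_mono hR).trans_lt Metric.isBounded_ball.measure_lt_top
  haveI : IsFiniteMeasure (volume.restrict Ω) := ⟨by simpa using hfin⟩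
  have hl2 : ∀ g : L2 n, IntegrableOn (fun z => g z) Ω := fun g =>
    ((Lp.memLp g).restrict Ω).integrable (by norm_num)
  have hl3 : IntegrableOn (lap v) Ω :=
    ((lap_cont hv).continuousOn.integrableOn_compact (isCompact_closedBall (0 : Euc n) R)).mono_set
      (hR.trans Metric.ball_subset_closedBall)
  have hG : IntegrableOn (fun z => u none z - f z - lap v z) Ω := ((hl2 _).sub (hl2 _)).sub hl3
  refine ⟨hG, ?_⟩
  obtain ⟨L, hL, hLb⟩ := Th_deriv_bdd
  obtain ⟨φ, y, h1, -, h3, h4, h5⟩ := HH_seq_ae hu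
  have hψ := fun k => comp_test hΩ (h1 k) hv hv0
  choose ψ p1 p2 p3 p4 p5 using hψ
  obtain ⟨χ, hχ, W, hW, hKW, hχ1⟩ := cutoff_exists isOpen_univ (isCompact_closedBall (0 : Euc n) R) (Set.subset_univ _)
  have hv1 : ContDiff ℝ 1 v := hv.of_le (by norm_num)
  have hVm : ∀ i : Fin n, MemLp (fun z => χ z * fderiv ℝ v z (bv i)) 2 volume := fun i =>
    test_memLp (hχ.1.continuous.mul (test_fderiv_cont hv1 _)) hχ.2.1.mul_right 2
  have hV : ∀ i : Fin n, ∀ᵐ z, z ∈ Ω → ((hVm i).toLp : L2 n) z = fderiv ℝ v z (bv i) := by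
    intro i
    filter_upwards [(hVm i).coeFn_toLp] with z hz hzΩ
    rw [hz, hχ1 z (hKW (Metric.ball_subset_closedBall (hR hzΩ))), one_mul]
  have st := fun k => comp_step (θ := θ) (h1 k) (h3 k) hv h (p1 k) (p4 k) (p5 k) hL hLb hV
  have eq : ∀ k, ∫ z, (u none z - f z - lap v z) * ψ k z = ∫ z in Ω, (u none z - f z - lap v z) * Th (φ k z - v z) := by
    intro k
    rw [← setIntegral_eq_integral_of_forall_compl_eq_zero (s := Ω) (fun z hz => by rw [p3 k z hz, mul_zero])]
    exact setIntegral_congr_fun hΩ.measurableSet (fun z hz => by simp only [p2 k z hz])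
  have lim1 : Tendsto (fun k => ∑ i, ‖u (some i) - y k (some i)‖ * (L * ‖y k (some i) - (hVm i).toLp‖)) atTop (𝓝 0) := by
    have : ∀ i : Fin n, Tendsto (fun k => ‖u (some i) - y k (some i)‖ * (L * ‖y k (some i) - (hVm i).toLp‖)) atTop
        (𝓝 (‖u (some i) - u (some i)‖ * (L * ‖u (some i) - (hVm i).toLp‖))) := fun i =>
      ((tendsto_const_nhds.sub (tendsto_comp_XX h4 (some i))).norm).mul
        ((((tendsto_comp_XX h4 (some i)).sub tendsto_const_nhds).norm).const_mul L)
    have := tendsto_finsetSum Finset.univ (fun i _ => this i)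
    simpa using this
  have lim2 : Tendsto (fun k => ∫ z in Ω, (u none z - f z - lap v z) * Th (φ k z - v z)) atTop
      (𝓝 (∫ z in Ω, (u none z - f z - lap v z) * Th (u none z - v z))) := by
    refine tendsto_integral_of_dominated_convergence (fun z => ‖u none z - f z - lap v z‖) (fun k => ?_) hG.norm
      (fun k => ?_) ?_
    · exact hG.aestronglyMeasurable.mul
        ((Th_contDiff.continuous.comp ((h1 k).1.continuous.sub hv.continuous)).aestronglyMeasurable)
    · refine Eventually.of_forall fun z => ?_
      rw [norm_mul]
      refine mul_le_of_le_one_right (norm_nonneg _) ?_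
      exact Th_abs _
    · filter_upwards [ae_restrict_of_ae h5] with z hz
      exact (((Th_contDiff.continuous.tendsto _).comp (hz.sub tendsto_const_nhds))).const_mul _
  exact le_of_tendsto_of_tendsto' lim2 lim1 (fun k => by rw [← eq k]; exact st k)

theorem comp_le {Ω : Set (Euc n)} (hΩ : IsOpen Ω) {R : ℝ} (hR : Ω ⊆ Metric.ball 0 R) {θ : ℝ} {u : XX n} {f : L2 n}
    (hu : u ∈ HH Ω θ) {v : Euc n → ℝ} (hv : ContDiff ℝ 2 v) (hv0 : ∀ z ∈ Ω, 0 ≤ v z)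
    (h : ∀ φ x, IsTest Ω φ → FRep φ x → inner ℝ u x = inner ℝ f (x none))
    (hf : ∀ᵐ z, z ∈ Ω → f z ≤ v z - lap v z) : ∀ᵐ z, z ∈ Ω → u none z ≤ v z := by
  obtain ⟨hG, hI⟩ := comp hΩ hR hu hv hv0 h
  have hnn : 0 ≤ᵐ[volume.restrict Ω] fun z => (u none z - f z - lap v z) * Th (u none z - v z) := by
    filter_upwards [(ae_restrict_iff' hΩ.measurableSet).2 hf] with z hz
    simp only [Pi.zero_apply]
    by_cases hz2 : u none z - v z ≤ 0
    · rw [Th_zero hz2, mul_zero]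
    · push Not at hz2
      exact mul_nonneg (by linarith) (Real.smoothTransition.nonneg _)
  have hint : IntegrableOn (fun z => (u none z - f z - lap v z) * Th (u none z - v z)) Ω := by
    refine Integrable.mono hG (hG.aestronglyMeasurable.mul ?_) (Eventually.of_forall fun z => ?_)
    · exact Th_contDiff.continuous.comp_aestronglyMeasurable
        ((Lp.aestronglyMeasurable (u none)).restrict.sub hv.continuous.aestronglyMeasurable)
    · rw [norm_mul]
      refine mul_le_of_le_one_right (norm_nonneg _) ?_
      exact Th_abs _
  have h0 := (integral_eq_zero_iff_of_nonneg_ae hnn hint).1 (le_antisymm hI (integral_nonneg_of_ae hnn))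
  have := (ae_restrict_iff' hΩ.measurableSet).1 h0
  filter_upwards [this, hf] with z hz hfz hzΩ
  by_contra hlt
  push Not at hlt
  have hp : 0 < Th (u none z - v z) := Real.smoothTransition.pos_of_pos (by linarith)
  have := hz hzΩ
  simp only [Pi.zero_apply] at this
  have h2 := hfz hzΩ
  rcases mul_eq_zero.1 this with h3 | h3 <;> linarith

end Op20

section Op21
open Filter Topology
open scoped ENNReal NNReal ContDiff FourierTransform LineDeriv SchwartzMap Laplacian
variable {n : ℕ}

def rsv (ξ : Euc n) : ℝ := (1 + ‖(2 * π) • ξ‖ ^ 2) ^ (-1 : ℝ)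

theorem rsv_eq (ξ : Euc n) : rsv ξ = (1 + (2 * π) ^ 2 * ‖ξ‖ ^ 2)⁻¹ := by
  unfold rsv
  rw [Real.rpow_neg_one, norm_smul, mul_pow, Real.norm_eq_abs, sq_abs]

theorem rsv_tg : (rsv : Euc n → ℝ).HasTemperateGrowth := by
  have := Function.hasTemperateGrowth_one_add_norm_sq_rpow (Euc n) (-1)
  exact this.comp (f := fun ξ : Euc n => (2 * π) • ξ) (by fun_prop)

theorem rsv_memLp (hn : n = 2 ∨ n = 3) : MemLp (rsv : Euc n → ℝ) 2 := by
  have hw : MemLp (fun ξ : Euc n => ((1 + ‖ξ‖)^2)⁻¹) 2 := by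
    rw [memLp_two_iff_integrable_sq (by
      refine Continuous.aestronglyMeasurable (Continuous.inv₀ (by fun_prop) (fun x => ?_))
      positivity)]
    have := integrable_one_add_norm (E := Euc n) (μ := volume) (r := 4) (by
      rw [finrank_euclideanSpace_fin]; rcases hn with rfl | rfl <;> norm_num)
    refine this.congr (Eventually.of_forall fun ξ => ?_)
    have hr := norm_nonneg ξ
    simp only
    rw [Real.rpow_neg (by positivity), show (4:ℝ) = ((4:ℕ):ℝ) by norm_num, Real.rpow_natCast, inv_pow, ← pow_mul]
  refine (hw.const_mul 2).mono rsv_tg.1.continuous.aestronglyMeasurable (Eventually.of_forall fun ξ => ?_)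
  rw [rsv_eq, Real.norm_eq_abs, Real.norm_eq_abs, abs_of_nonneg (by positivity), abs_of_nonneg (by positivity),
    ← div_eq_mul_inv, inv_eq_one_div, div_le_div_iff₀ (by positivity) (by positivity)]
  have h1 : (1:ℝ) ≤ (2 * π) ^ 2 := by nlinarith [Real.pi_gt_three]
  nlinarith [sq_nonneg (‖ξ‖ - 1), sq_nonneg ‖ξ‖, mul_le_mul_of_nonneg_right h1 (sq_nonneg ‖ξ‖)]

theorem lap_re (V : 𝓢(Euc n, ℂ)) (x : Euc n) : lap (fun y => (V y).re) x = (Δ V x).re := by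
  have e1 : ∀ (W : 𝓢(Euc n, ℂ)) (y m : Euc n), fderiv ℝ (fun y => (W y).re) y m = ((∂_{m} W) y).re := by
    intro W y m
    have h1 : HasFDerivAt (fun y => (W y).re) (Complex.reCLM.comp (fderiv ℝ W y)) y :=
      Complex.reCLM.hasFDerivAt.comp y (W.differentiable y).hasFDerivAt
    rw [h1.fderiv, SchwartzMap.lineDerivOp_apply_eq_fderiv]
    simp
  rw [SchwartzMap.laplacian_eq_sum (EuclideanSpace.basisFun (Fin n) ℝ)]
  unfold lap
  rw [SchwartzMap.sum_apply, Complex.re_sum]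
  refine Finset.sum_congr rfl fun i _ => ?_
  have : (fun y => fderiv ℝ (fun y => (V y).re) y (EuclideanSpace.single i 1)) =
      fun y => ((∂_{(EuclideanSpace.single i 1 : Euc n)} V) y).re := funext fun y => e1 V y _
  rw [this, e1]
  simp

theorem rsv_exists (hn : n = 2 ∨ n = 3) : ∃ K0 : ℝ, 0 ≤ K0 ∧ ∀ g : 𝓢(Euc n, ℝ), ∃ v : Euc n → ℝ,
    ContDiff ℝ 2 v ∧ (∀ x, |v x| ≤ K0 * ‖g.toLp 2‖) ∧ ∀ x, v x - lap v x = g x := by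
  refine ⟨‖(rsv_memLp hn).toLp‖, norm_nonneg _, fun g => ?_⟩
  set G : 𝓢(Euc n, ℂ) := g.postcompCLM (Complex.ofRealCLM) with hG
  set V : 𝓢(Euc n, ℂ) := SchwartzMap.fourierMultiplierCLM ℂ rsv G with hV
  have hGn : ‖G.toLp 2‖ = ‖g.toLp 2‖ := by
    rw [SchwartzMap.norm_toLp, SchwartzMap.norm_toLp]
    congr 1
    apply eLpNorm_congr_norm_ae
    refine Eventually.of_forall fun x => ?_
    simp [hG]
  have hΔ : V - Δ V = G := by
    rw [SchwartzMap.laplacian_eq_fourierMultiplierCLM, hV,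
      SchwartzMap.fourierMultiplierCLM_fourierMultiplierCLM_apply (by fun_prop) rsv_tg,
      SchwartzMap.fourierMultiplierCLM_apply, SchwartzMap.fourierMultiplierCLM_apply]
    have : G = 𝓕⁻ (𝓕 G) := by simp
    conv_rhs => rw [this]
    have e2 : (-(2 * π) ^ 2) • 𝓕⁻ (SchwartzMap.smulLeftCLM ℂ ((fun ξ : Euc n => ‖ξ‖ ^ 2) * rsv) (𝓕 G)) =
        𝓕⁻ ((-(2 * π) ^ 2) • SchwartzMap.smulLeftCLM ℂ ((fun ξ : Euc n => ‖ξ‖ ^ 2) * rsv) (𝓕 G)) := by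
      rw [FourierTransform.fourierInv_smul]
    have ht : ((fun ξ : Euc n => ‖ξ‖ ^ 2) * rsv).HasTemperateGrowth :=
      Function.HasTemperateGrowth.mul (by fun_prop) rsv_tg
    refine Eq.trans (congrArg (fun t => _ - t) e2) ?_
    rw [sub_eq_iff_eq_add, ← FourierTransform.fourierInv_add]
    congr 1
    ext z
    rw [SchwartzMap.add_apply, ← sub_eq_iff_eq_add, SchwartzMap.smul_apply, SchwartzMap.smulLeftCLM_apply_apply rsv_tg,
      SchwartzMap.smulLeftCLM_apply_apply ht, smul_smul, ← sub_smul, Pi.mul_apply, rsv_eq]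
    have : (1 + (2 * π) ^ 2 * ‖z‖ ^ 2)⁻¹ - -(2 * π) ^ 2 * (‖z‖ ^ 2 * (1 + (2 * π) ^ 2 * ‖z‖ ^ 2)⁻¹) = 1 := by
      have : (1 + (2 * π) ^ 2 * ‖z‖ ^ 2) ≠ 0 := by positivity
      field_simp
      ring
    rw [this, one_smul]
  refine ⟨fun x => (V x).re, ?_, fun x => ?_, fun x => ?_⟩
  · exact Complex.reCLM.contDiff.comp (V.smooth 2)
  · refine (Complex.abs_re_le_norm _).trans ?_
    rw [hV, SchwartzMap.fourierMultiplierCLM_apply, SchwartzMap.fourierInv_coe]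
    refine (fourierInv_norm_le x).trans ?_
    have e : ∀ z, ‖(SchwartzMap.smulLeftCLM ℂ rsv (𝓕 G)) z‖ = rsv z * ‖(𝓕 G) z‖ := by
      intro z
      rw [SchwartzMap.smulLeftCLM_apply_apply rsv_tg, norm_smul, Real.norm_of_nonneg]
      rw [rsv_eq]; positivity
    simp_rw [e]
    have hm : MemLp (fun z => ‖(𝓕 G) z‖) 2 := ((𝓕 G).memLp 2 volume).norm
    rw [← hGn, ← SchwartzMap.norm_fourier_toL2_eq]
    have h1 := L2_inner_toLp ((rsv_memLp hn).toLp) hm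
    have h2 := real_inner_le_norm ((rsv_memLp hn).toLp : L2 n) hm.toLp
    have h3 : ‖hm.toLp‖ = ‖(𝓕 G).toLp 2‖ := by
      rw [SchwartzMap.norm_toLp, Lp.norm_toLp]
      congr 1
      exact eLpNorm_norm _
    rw [h3, h1] at h2
    refine le_trans (le_of_eq ?_) h2
    apply integral_congr_ae
    filter_upwards [(rsv_memLp hn).coeFn_toLp] with z hz
    rw [hz]
  · rw [lap_re, ← Complex.sub_re, ← SchwartzMap.sub_apply, hΔ]
    simp [hG]

end Op21

section Op22
open Filter Topology
open scoped ENNReal NNReal ContDiff SchwartzMap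
variable {n : ℕ}

theorem tTh_nonneg (t : ℝ) : 0 ≤ t * Th t := by
  by_cases h : t ≤ 0
  · rw [Th_zero h, mul_zero]
  · exact mul_nonneg (le_of_not_ge h) (Th_nonneg t)

theorem tTh_mono {s t : ℝ} (h : s ≤ t) : s * Th s ≤ t * Th t := by
  by_cases hs : s ≤ 0
  · rw [Th_zero hs, mul_zero]; exact tTh_nonneg t
  · push Not at hs
    exact mul_le_mul h (Th_mono h) (Th_nonneg s) (by linarith)

theorem L1_le_L2 {Ω : Set (Euc n)} (hΩ : MeasurableSet Ω) (hfin : volume Ω < ⊤) :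
    ∃ c : ℝ, 0 ≤ c ∧ ∀ h : L2 n, ∫ z in Ω, ‖h z‖ ≤ c * ‖h‖ := by
  have hi : MemLp (Ω.indicator (fun _ => (1:ℝ))) 2 (volume : Measure (Euc n)) :=
    memLp_indicator_const 2 hΩ 1 (Or.inr hfin.ne)
  refine ⟨‖hi.toLp‖, norm_nonneg _, fun h => ?_⟩
  have hm : MemLp (fun z => ‖h z‖) 2 := (Lp.memLp h).norm
  have h1 := L2_inner_toLp (hm.toLp) hi
  have h2 := real_inner_le_norm (hm.toLp : L2 n) hi.toLp
  have h3 : ‖hm.toLp‖ = ‖h‖ := by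
    rw [Lp.norm_toLp, Lp.norm_def, eLpNorm_norm]
  rw [h3, h1, mul_comm] at h2
  refine le_trans (le_of_eq ?_) h2
  rw [← integral_indicator hΩ]
  apply integral_congr_ae
  filter_upwards [hm.coeFn_toLp] with z hz
  rw [hz]
  by_cases hzΩ : z ∈ Ω <;> simp [hzΩ]

theorem lap_add_const (v : Euc n → ℝ) (c : ℝ) (x : Euc n) : lap (fun y => v y + c) x = lap v x := by
  unfold lap
  simp only [fderiv_add_const]

theorem sup_bound (hn : n = 2 ∨ n = 3) {Ω : Set (Euc n)} (hΩ : IsOpen Ω) {R : ℝ} (hR : Ω ⊆ Metric.ball 0 R) {θ : ℝ} {u : XX n} {f : L2 n}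
    (hu : u ∈ HH Ω θ) (h : ∀ φ x, IsTest Ω φ → FRep φ x → inner ℝ u x = inner ℝ f (x none)) :
    ∃ M : ℝ, ∀ᵐ z, z ∈ Ω → u none z ≤ M := by
  have hfin : volume Ω < ⊤ := (measure_mono hR).trans_lt Metric.isBounded_ball.measure_lt_top
  haveI : IsFiniteMeasure (volume.restrict Ω) := ⟨by simpa using hfin⟩
  obtain ⟨K0, hK0, hK⟩ := rsv_exists hn
  obtain ⟨c, hc, hc1⟩ := L1_le_L2 hΩ.measurableSet hfin
  set K := K0 * (‖f‖ + 1) with hKd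
  have hKn : 0 ≤ K := by positivity
  refine ⟨2 * K, ?_⟩
  have hl2 : ∀ g : L2 n, IntegrableOn (fun z => g z) Ω := fun g =>
    ((Lp.memLp g).restrict Ω).integrable (by norm_num)
  have hTm : ∀ v : Euc n → ℝ, Continuous v → AEStronglyMeasurable (fun z => Th (u none z - v z)) (volume.restrict Ω) := fun v hv =>
    Th_contDiff.continuous.comp_aestronglyMeasurable
        ((Lp.aestronglyMeasurable (u none)).restrict.sub hv.aestronglyMeasurable)
  have hTi : ∀ (v G : Euc n → ℝ), Continuous v → IntegrableOn G Ω → IntegrableOn (fun z => G z * Th (u none z - v z)) Ω := by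
    intro v G hv hG
    refine Integrable.mono hG (hG.aestronglyMeasurable.mul (hTm v hv)) (Eventually.of_forall fun z => ?_)
    rw [norm_mul]
    exact mul_le_of_le_one_right (norm_nonneg _) (Th_abs _)
  have i0 : IntegrableOn (fun z => (u none z - 2 * K) * Th (u none z - 2 * K)) Ω :=
    hTi (fun _ => 2 * K) _ continuous_const ((hl2 _).sub (integrable_const _))
  have step : ∀ ε > 0, ∫ z in Ω, (u none z - 2 * K) * Th (u none z - 2 * K) ≤ c * ε := by
    intro ε hε
    obtain ⟨g, hg⟩ : ∃ g : 𝓢(Euc n, ℝ), dist f (g.toLp 2 volume) < min ε 1 := by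
      have := (SchwartzMap.denseRange_toLpCLM (E := Euc n) (F := ℝ) (p := 2) (by norm_num) (μ := volume)).exists_dist_lt f
        (ε := min ε 1) (by positivity)
      exact this
    rw [dist_eq_norm] at hg
    obtain ⟨v, v1, v2, v3⟩ := hK g
    have hgn : ‖g.toLp 2 volume‖ ≤ ‖f‖ + 1 := by
      have := norm_sub_norm_le (g.toLp 2 volume) f
      rw [norm_sub_rev] at this
      have := hg.trans_le (min_le_right _ _)
      linarith
    have hvK : ∀ x, |v x| ≤ K := fun x => (v2 x).trans (mul_le_mul_of_nonneg_left hgn hK0)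
    have hv' : ContDiff ℝ 2 (fun x => v x + K) := v1.add contDiff_const
    obtain ⟨c1, c2⟩ := comp hΩ hR hu hv' (fun z _ => by have := neg_abs_le (v z); have := hvK z; linarith) h
    have i1 := hTi _ _ hv'.continuous c1
    have i2 : IntegrableOn (fun z => ‖(f - g.toLp 2 volume : L2 n) z‖) Ω := (hl2 _).norm
    have i12 : IntegrableOn (fun z => (u none z - f z - lap (fun x => v x + K) z) * Th (u none z - (v z + K)) + ‖(f - g.toLp 2 volume : L2 n) z‖) Ω :=
      i1.add i2
    have mono : ∫ z in Ω, (u none z - 2 * K) * Th (u none z - 2 * K) ≤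
        ∫ z in Ω, ((u none z - f z - lap (fun x => v x + K) z) * Th (u none z - (v z + K)) + ‖(f - g.toLp 2 volume : L2 n) z‖) := by
      refine integral_mono_ae i0 i12 ?_
      filter_upwards [ae_restrict_of_ae (Lp.coeFn_sub f (g.toLp 2 volume)), ae_restrict_of_ae (g.coeFn_toLp 2 volume)] with z h1 h2
      show _ ≤ _
      rw [h1, Pi.sub_apply, h2, lap_add_const]
      have e1 := v3 z
      have e2 : u none z - 2 * K ≤ u none z - (v z + K) := by have := le_abs_self (v z); have := hvK z; linarith
      have e3 := tTh_mono e2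
      have e4 := Th_nonneg (u none z - (v z + K))
      have e5 : Th (u none z - (v z + K)) ≤ 1 := (le_abs_self _).trans (Th_abs _)
      have e6 : u none z - f z - lap v z = (u none z - (v z + K)) + K - (f z - g z) := by linarith
      rw [e6]
      have e7 : (f z - g z) * Th (u none z - (v z + K)) ≤ ‖f z - g z‖ :=
        (le_abs_self _).trans (by rw [abs_mul]; exact mul_le_of_le_one_right (abs_nonneg _) (Th_abs _))
      nlinarith [mul_nonneg hKn e4]
    rw [integral_add i1 i2] at mono
    have := hc1 (f - g.toLp 2 volume)
    have h9 := mul_le_mul_of_nonneg_left ((hg.trans_le (min_le_left _ _)).le) hc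
    linarith
  have hI : ∫ z in Ω, (u none z - 2 * K) * Th (u none z - 2 * K) ≤ 0 := by
    refine le_of_forall_pos_le_add fun ε hε => ?_
    have := step (ε / (c + 1)) (by positivity)
    have h2 : c * (ε / (c + 1)) ≤ ε := by
      rw [mul_div_assoc', div_le_iff₀ (by positivity)]; nlinarith
    linarith
  have hnn : 0 ≤ᵐ[volume.restrict Ω] fun z => (u none z - 2 * K) * Th (u none z - 2 * K) :=
    Eventually.of_forall fun z => tTh_nonneg _
  have h0 := (integral_eq_zero_iff_of_nonneg_ae hnn i0).1 (le_antisymm hI (integral_nonneg_of_ae hnn))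
  have := (ae_restrict_iff' hΩ.measurableSet).1 h0
  filter_upwards [this] with z hz hzΩ
  by_contra hlt
  push Not at hlt
  have hp : 0 < Th (u none z - 2 * K) := Real.smoothTransition.pos_of_pos (by linarith)
  have := hz hzΩ
  simp only [Pi.zero_apply] at this
  rcases mul_eq_zero.1 this with h3 | h3 <;> linarith

theorem weak_neg {Ω : Set (Euc n)} {u : XX n} {f : L2 n}
    (h : ∀ φ x, IsTest Ω φ → FRep φ x → inner ℝ u x = inner ℝ f (x none)) :
    ∀ φ x, IsTest Ω φ → FRep φ x → inner ℝ (-u) x = inner ℝ (-f) (x none) := by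
  intro φ x h1 h2
  rw [inner_neg_left, inner_neg_left, h φ x h1 h2]

theorem neg_none_ae (u : XX n) : ∀ᵐ z, (-u) none z = - u none z := by
  filter_upwards [Lp.coeFn_neg (u none)] with z hz
  rw [PiLp.neg_apply, hz]; rfl

theorem abs_bound (hn : n = 2 ∨ n = 3) {Ω : Set (Euc n)} (hΩ : IsOpen Ω) {R : ℝ} (hR : Ω ⊆ Metric.ball 0 R) {θ : ℝ} {u : XX n} {f : L2 n}
    (hu : u ∈ HH Ω θ) (h : ∀ φ x, IsTest Ω φ → FRep φ x → inner ℝ u x = inner ℝ f (x none)) :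
    ∃ M : ℝ, 0 ≤ M ∧ ∀ᵐ z, |u none z| ≤ M := by
  obtain ⟨M1, h1⟩ := sup_bound hn hΩ hR hu h
  obtain ⟨M2, h2⟩ := sup_bound hn hΩ hR (Submodule.neg_mem _ hu) (weak_neg h)
  refine ⟨max 0 (max M1 M2), le_max_left _ _, ?_⟩
  filter_upwards [h1, h2, neg_none_ae u, HH_supp hu] with z g1 g2 g3 g4
  by_cases hz : z ∈ Ω
  · have a1 := g1 hz
    have a2 := g2 hz
    rw [g3] at a2
    refine abs_le.2 ⟨?_, ?_⟩
    · have := (le_max_right M1 M2).trans (le_max_right 0 _); linarith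
    · have := (le_max_left M1 M2).trans (le_max_right 0 _); linarith
  · rw [g4 hz, abs_zero]; exact le_max_left _ _

/-- two sided comparison with a barrier -/
theorem barrier {Ω : Set (Euc n)} (hΩ : IsOpen Ω) {R : ℝ} (hR : Ω ⊆ Metric.ball 0 R) {θ : ℝ} {u : XX n} {f : L2 n}
    (hu : u ∈ HH Ω θ) (h : ∀ φ x, IsTest Ω φ → FRep φ x → inner ℝ u x = inner ℝ f (x none))
    {v : Euc n → ℝ} (hv : ContDiff ℝ 2 v) (hv0 : ∀ z ∈ Ω, 0 ≤ v z) {M : ℝ} (hM : ∀ᵐ z, |f z| ≤ M)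
    (hl : ∀ z ∈ Ω, M ≤ - lap v z) : ∀ᵐ z, z ∈ Ω → |u none z| ≤ v z := by
  have h1 := comp_le hΩ hR hu hv hv0 h (by
    filter_upwards [hM] with z hz hzΩ
    have := hl z hzΩ; have := hv0 z hzΩ; have := (abs_le.1 hz).2; linarith)
  have h2 := comp_le hΩ hR (Submodule.neg_mem _ hu) hv hv0 (weak_neg h) (by
    filter_upwards [hM, Lp.coeFn_neg f] with z hz hz2 hzΩ
    rw [hz2, Pi.neg_apply]
    have := hl z hzΩ; have := hv0 z hzΩ; have := (abs_le.1 hz).1; linarith)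
  filter_upwards [h1, h2, neg_none_ae u] with z g1 g2 g3 hz
  have a2 := g2 hz
  rw [g3] at a2
  exact abs_le.2 ⟨by linarith, g1 hz⟩

end Op22

section Op23
open Filter Topology
open scoped ENNReal NNReal ContDiff
variable {n : ℕ}

theorem lap_radial {g g1 g2 : ℝ → ℝ} (h1 : ∀ t, HasDerivAt g (g1 t) t) (h2 : ∀ t, HasDerivAt g1 (g2 t) t) (x : Euc n) :
    lap (fun y => g (‖y‖ ^ 2)) x = 4 * ‖x‖ ^ 2 * g2 (‖x‖ ^ 2) + 2 * n * g1 (‖x‖ ^ 2) := by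
  have hq : ∀ y : Euc n, HasFDerivAt (fun y : Euc n => ‖y‖ ^ 2) (2 • innerSL ℝ y) y := fun y =>
    (hasStrictFDerivAt_norm_sq y).hasFDerivAt
  have e1 : ∀ i : Fin n, (fun y => fderiv ℝ (fun y : Euc n => g (‖y‖ ^ 2)) y (EuclideanSpace.single i 1)) =
      fun y => g1 (‖y‖ ^ 2) * (2 * y i) := by
    intro i; ext y
    have := (h1 (‖y‖ ^ 2)).comp_hasFDerivAt y (hq y)
    have e := this.fderiv
    simp only [Function.comp_def] at e
    rw [e]
    simp [EuclideanSpace.inner_single_right]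
  have e2 : ∀ i : Fin n, fderiv ℝ (fun y : Euc n => g1 (‖y‖ ^ 2) * (2 * y i)) x (EuclideanSpace.single i 1) =
      4 * (x i) ^ 2 * g2 (‖x‖ ^ 2) + 2 * g1 (‖x‖ ^ 2) := by
    intro i
    have a1 : HasFDerivAt (fun y : Euc n => g1 (‖y‖ ^ 2)) (g2 (‖x‖ ^ 2) • (2 • innerSL ℝ x)) x :=
      (h2 (‖x‖ ^ 2)).comp_hasFDerivAt x (hq x)
    have a2 : HasFDerivAt (fun y : Euc n => 2 * y i) ((2:ℝ) • (EuclideanSpace.proj i : Euc n →L[ℝ] ℝ)) x :=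
      ((EuclideanSpace.proj i : Euc n →L[ℝ] ℝ).hasFDerivAt).const_mul 2
    have := (a1.mul a2).fderiv
    have e' : (fun y : Euc n => g1 (‖y‖ ^ 2) * (2 * y i)) = (fun y : Euc n => g1 (‖y‖ ^ 2)) * (fun y : Euc n => 2 * y i) := rfl
    rw [e', this]
    simp [EuclideanSpace.inner_single_right]
    ring
  unfold lap
  rw [Finset.sum_congr rfl (fun i _ => by rw [e1 i, e2 i]), Finset.sum_add_distrib, ← Finset.sum_mul, ← Finset.mul_sum,
    EuclideanSpace.norm_sq_eq]
  simp
  ring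

theorem barrier_exists (hn : n = 2 ∨ n = 3) {Ω : Set (Euc n)} (hΩ : RadialDomain Ω) {M : ℝ} (hM : 0 ≤ M) {x0 : Euc n}
    (hx0 : x0 ∈ frontier Ω) : ∃ v : Euc n → ℝ, ContDiff ℝ 2 v ∧ (∀ z ∈ Ω, 0 ≤ v z) ∧ (∀ z ∈ Ω, M ≤ - lap v z) ∧ v x0 = 0 := by
  have hn0 : (0:ℝ) < n := by rcases hn with rfl | rfl <;> norm_num
  have hop := radial_open hΩ
  have hx1 : x0 ∉ Ω := by rw [hop.frontier_eq] at hx0; exact hx0.2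
  have hx2 : x0 ∈ closure Ω := frontier_subset_closure hx0
  have outer : ∀ R : ℝ, 0 < R → (∀ z ∈ Ω, ‖z‖ < R) → ‖x0‖ = R →
      ∃ v : Euc n → ℝ, ContDiff ℝ 2 v ∧ (∀ z ∈ Ω, 0 ≤ v z) ∧ (∀ z ∈ Ω, M ≤ - lap v z) ∧ v x0 = 0 := by
    intro R hR hz hx
    refine ⟨fun x => M / (2 * n) * (R ^ 2 - ‖x‖ ^ 2), ?_, fun z hz' => ?_, fun z _ => ?_, ?_⟩
    · exact contDiff_const.mul (contDiff_const.sub (contDiff_norm_sq ℝ))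
    · have := hz z hz'
      have h0 := norm_nonneg z
      exact mul_nonneg (by positivity) (by nlinarith)
    · rw [lap_radial (g := fun t => M / (2 * n) * (R ^ 2 - t)) (g1 := fun _ => - (M / (2 * n))) (g2 := fun _ => 0)]
      · simp only [mul_zero, zero_add]
        apply le_of_eq; field_simp
      · intro t
        have := ((hasDerivAt_id t).const_sub (R ^ 2)).const_mul (M / (2 * n))
        simpa using this
      · intro t; exact hasDerivAt_const _ _
    · simp [hx]
  rcases hΩ with ⟨R, hR, rfl⟩ | ⟨r, R, hr, hrR, rfl⟩
  · refine outer R hR (fun z hz => by simpa using hz) ?_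
    have h1 := Metric.closure_ball_subset_closedBall hx2
    simp at h1 hx1
    linarith
  · have hcl : closure {x : Euc n | r < ‖x‖ ∧ ‖x‖ < R} ⊆ {x : Euc n | r ≤ ‖x‖ ∧ ‖x‖ ≤ R} := by
      refine closure_minimal (fun x hx => ⟨hx.1.le, hx.2.le⟩) ?_
      exact (isClosed_le continuous_const continuous_norm).inter (isClosed_le continuous_norm continuous_const)
    have h1 := hcl hx2
    by_cases hxR : ‖x0‖ = R
    · exact outer R (hr.trans hrR) (fun z hz => hz.2) hxR
    · have hxr : ‖x0‖ = r := by
        by_contra hne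
        exact hx1 ⟨lt_of_le_of_ne h1.1 (Ne.symm hne), lt_of_le_of_ne h1.2 hxR⟩
      set α : ℝ := n / r ^ 2 with hα
      have hα0 : 0 < α := by positivity
      set c : ℝ := M * Real.exp (α * R ^ 2) / (2 * n * α) with hc
      have hc0 : 0 ≤ c := by positivity
      refine ⟨fun x => c * (Real.exp (-α * r ^ 2) - Real.exp (-α * ‖x‖ ^ 2)), ?_, fun z hz' => ?_, fun z hz => ?_, ?_⟩
      · exact contDiff_const.mul (contDiff_const.sub (contDiff_const.mul (contDiff_norm_sq ℝ)).exp)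
      · refine mul_nonneg hc0 (sub_nonneg.2 (Real.exp_le_exp.2 ?_))
        have := hz'.1
        have : r ^ 2 ≤ ‖z‖ ^ 2 := by nlinarith
        nlinarith
      · rw [lap_radial (g := fun t => c * (Real.exp (-α * r ^ 2) - Real.exp (-α * t)))
          (g1 := fun t => c * α * Real.exp (-α * t)) (g2 := fun t => - (c * α ^ 2 * Real.exp (-α * t)))]
        · have h1 : r ^ 2 ≤ ‖z‖ ^ 2 := by have := hz.1; nlinarith
          have h2 : ‖z‖ ^ 2 ≤ R ^ 2 := by have := hz.2; have := norm_nonneg z; nlinarith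
          have h3 : Real.exp (-α * R ^ 2) ≤ Real.exp (-α * ‖z‖ ^ 2) := Real.exp_le_exp.2 (by nlinarith)
          have h4 : α * r ^ 2 = n := by rw [hα]; field_simp
          have h5 : (n:ℝ) ≤ α * ‖z‖ ^ 2 := by rw [← h4]; exact mul_le_mul_of_nonneg_left h1 hα0.le
          have h6 : M = c * (2 * n * α) * Real.exp (-α * R ^ 2) := by
            rw [hc, neg_mul, Real.exp_neg]
            field_simp
          have h7 : c * (2 * n * α) * Real.exp (-α * R ^ 2) ≤ c * (2 * n * α) * Real.exp (-α * ‖z‖ ^ 2) :=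
            mul_le_mul_of_nonneg_left h3 (by positivity)
          have h8 : 0 ≤ c * α * Real.exp (-α * ‖z‖ ^ 2) := by positivity
          have h9 := mul_le_mul_of_nonneg_left h5 h8
          nlinarith
        · intro t
          have := ((((hasDerivAt_id t).const_mul (-α)).exp).const_sub (Real.exp (-α * r ^ 2))).const_mul c
          refine this.congr_deriv ?_
          simp; ring
        · intro t
          have := (((hasDerivAt_id t).const_mul (-α)).exp).const_mul (c * α)
          refine this.congr_deriv ?_
          simp; ring
      · simp [hxr]

theorem cont_ae {Ω : Set (Euc n)} (hΩ : IsOpen Ω) {a : Euc n → ℝ} (ha : ContinuousOn a Ω)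
    (h : ∀ᵐ z, z ∈ Ω → a z ≤ 0) : ∀ z ∈ Ω, a z ≤ 0 := by
  have ho : IsOpen (Ω ∩ a ⁻¹' Set.Ioi 0) := ha.isOpen_inter_preimage hΩ isOpen_Ioi
  have h0 : volume (Ω ∩ a ⁻¹' Set.Ioi 0) = 0 := by
    rw [ae_iff] at h
    refine measure_mono_null ?_ h
    rintro z ⟨h1, h2⟩
    simp only [Set.mem_setOf_eq, Classical.not_imp, not_le]
    exact ⟨h1, h2⟩
  replace h0 := (ho.measure_eq_zero_iff volume).1 h0
  intro z hz
  by_contra hlt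
  push Not at hlt
  have : z ∈ Ω ∩ a ⁻¹' Set.Ioi 0 := ⟨hz, hlt⟩
  rw [h0] at this
  exact this

theorem NL_bound (N : ℕ) (lam mu : ℕ → ℝ) (beta : ℕ → ℕ → ℝ) {M : ℝ} (hM : 0 ≤ M) (j : ℕ) (hj : j ∈ Icc 1 N) :
    ∃ M', 0 ≤ M' ∧ ∀ w : ℕ → ℝ, (∀ m ∈ Icc 1 N, |w m| ≤ M) → |NL N lam mu beta w j| ≤ M' := by
  refine ⟨M + |lam j| * M + (|mu j| * M ^ 3 + ∑ m ∈ (Icc 1 N).erase j, |beta j m| * M * M ^ 2), ?_, fun w hw => ?_⟩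
  · positivity
  · unfold NL
    have hwj := hw j hj
    refine (abs_add_le _ _).trans (add_le_add ((abs_sub _ _).trans (add_le_add hwj ?_)) ((abs_add_le _ _).trans (add_le_add ?_ ?_)))
    · rw [abs_mul]; gcongr
    · rw [abs_mul, abs_pow]; gcongr
    · refine (Finset.abs_sum_le_sum_abs _ _).trans (Finset.sum_le_sum fun m hm => ?_)
      rw [abs_mul, abs_mul, abs_pow]
      have := hw m (Finset.mem_of_mem_erase hm)
      gcongr

theorem f_bound (hn : n = 2 ∨ n = 3) {Ω : Set (Euc n)} (hΩ : RadialDomain Ω) {θ : ℝ} {N : ℕ} {lam mu : ℕ → ℝ} {beta : ℕ → ℕ → ℝ}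
    {u : ℕ → XX n} {f : ℕ → L2 n} (h : WS Ω θ N lam mu beta u f) {j : ℕ} (hj : j ∈ Icc 1 N) :
    ∃ M, 0 ≤ M ∧ ∀ᵐ z, |f j z| ≤ M := by
  obtain ⟨R, -, hR⟩ := radial_bdd hΩ
  have h1 : ∀ m, ∃ M : ℝ, 0 ≤ M ∧ (m ∈ Icc 1 N → ∀ᵐ z, |u m none z| ≤ M) := by
    intro m
    by_cases hm : m ∈ Icc 1 N
    · obtain ⟨M, a, b⟩ := abs_bound hn (radial_open hΩ) hR (h m hm).1 (h m hm).2.2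
      exact ⟨M, a, fun _ => b⟩
    · exact ⟨0, le_rfl, fun h => absurd h hm⟩
  choose M hM0 hM using h1
  obtain ⟨M', hM', hb⟩ := NL_bound N lam mu beta (M := ∑ m ∈ Icc 1 N, M m) (Finset.sum_nonneg fun m _ => hM0 m) j hj
  refine ⟨M', hM', ?_⟩
  have hall : ∀ᵐ z, ∀ m : ℕ, m ∈ Icc 1 N → |u m none z| ≤ M m := by
    rw [ae_all_iff]
    intro m
    by_cases hm : m ∈ Icc 1 N
    · filter_upwards [hM m hm] with z hz _ using hz
    · exact Eventually.of_forall fun z h => absurd h hm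
  filter_upwards [hall, (h j hj).2.1] with z h1 h2
  rw [h2]
  exact hb _ fun m hm => (h1 m hm).trans (Finset.single_le_sum (fun m _ => hM0 m) hm)

theorem boundary (hn : n = 2 ∨ n = 3) {Ω : Set (Euc n)} (hΩ : RadialDomain Ω) {θ : ℝ} {N : ℕ} {lam mu : ℕ → ℝ} {beta : ℕ → ℕ → ℝ}
    {u : ℕ → XX n} {f : ℕ → L2 n} (h : WS Ω θ N lam mu beta u f) {j : ℕ} (hj : j ∈ Icc 1 N)
    {w : Euc n → ℝ} (hw : ContinuousOn w Ω) (hw0 : ∀ x, x ∉ Ω → w x = 0) (hwu : w =ᵐ[volume] u j none) :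
    ContinuousOn w (closure Ω) ∧ ∀ x ∈ frontier Ω, w x = 0 := by
  have hop := radial_open hΩ
  obtain ⟨M, hM0, hM⟩ := f_bound hn hΩ h hj
  obtain ⟨R, -, hR⟩ := radial_bdd hΩ
  have hfr : ∀ x ∈ frontier Ω, x ∉ Ω := fun x hx => by rw [hop.frontier_eq] at hx; exact hx.2
  refine ⟨fun x hx => ?_, fun x hx => hw0 x (hfr x hx)⟩
  by_cases hxΩ : x ∈ Ω
  · exact (hw.continuousAt (hop.mem_nhds hxΩ)).continuousWithinAt
  · have hxf : x ∈ frontier Ω := by rw [hop.frontier_eq]; exact ⟨hx, hxΩ⟩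
    obtain ⟨v, v1, v2, v3, v4⟩ := barrier_exists hn hΩ hM0 hxf
    have hb := barrier hop hR (h j hj).1 (h j hj).2.2 v1 v2 hM v3
    have hp := cont_ae hop (a := fun z => |w z| - v z) (hw.abs.sub v1.continuous.continuousOn) (by
      filter_upwards [hb, hwu] with z h1 h2 hz
      rw [h2]; linarith [h1 hz])
    have hle : ∀ z, ‖w z‖ ≤ |v z| := by
      intro z
      by_cases hz : z ∈ Ω
      · have := hp z hz
        rw [Real.norm_eq_abs]
        exact le_trans (by linarith) (le_abs_self _)
      · rw [hw0 z hz, norm_zero]; exact abs_nonneg _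
    have hlim : Tendsto (fun z => |v z|) (𝓝 x) (𝓝 0) := by
      have := (v1.continuous.abs).tendsto x
      simpa [v4] using this
    have : ContinuousAt w x := by
      unfold ContinuousAt
      rw [hw0 x hxΩ]
      exact squeeze_zero_norm hle hlim
    exact this.continuousWithinAt

end Op23

section Op24
open Filter Topology
open scoped ENNReal NNReal ContDiff
variable {n : ℕ}

theorem grad_supp {Ω : Set (Euc n)} {θ : ℝ} {x : XX n} (hx : x ∈ HH Ω θ) (i : Fin n) :
    ∀ᵐ z, z ∉ Ω → x (some i) z = 0 := by
  obtain ⟨φ, y, h1, h2, h3, h4⟩ := HH_seq hx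
  obtain ⟨ns, hns, hae⟩ := (tendstoInMeasure_of_tendsto_Lp (tendsto_comp_XX h4 (some i))).exists_seq_tendsto_ae
  have hall : ∀ᵐ z, ∀ k, y k (some i) z = fderiv ℝ (φ k) z (bv i) := ae_all_iff.2 fun k => (h3 k).2 i
  filter_upwards [hae, hall] with z hz hz2 hzΩ
  have : ∀ k, y k (some i) z = 0 := fun k => by
    rw [hz2 k, image_eq_zero_of_notMem_tsupport (f := fderiv ℝ (φ k)) (x := z)
      (fun h => hzΩ ((h1 k).2.2 (tsupport_fderiv_subset ℝ h)))]
    simp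
  refine tendsto_nhds_unique hz ?_
  simp only [this]
  exact tendsto_const_nhds

theorem L2_sq (g : L2 n) : Integrable (fun z => g z ^ 2) ∧ ‖g‖ ^ 2 = ∫ z, g z ^ 2 := by
  refine ⟨(memLp_two_iff_integrable_sq (Lp.aestronglyMeasurable g)).1 (Lp.memLp g), ?_⟩
  rw [← real_inner_self_eq_norm_sq, L2_inner_eq]
  simp_rw [sq]

theorem H1_ge {Ω : Set (Euc n)} (hΩ : IsOpen Ω) {θ : ℝ} {u : XX n} (hu : u ∈ HH Ω θ) {w : Euc n → ℝ}
    (hwu : w =ᵐ[volume] u none) (hg : ∀ i, ∀ᵐ x, x ∈ Ω → u (some i) x = fderiv ℝ w x (bv i)) :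
    Gr2 u ≤ H1norm2 Ω w := by
  unfold H1norm2
  have hall : ∀ᵐ z, ∀ i, z ∈ Ω → u (some i) z = fderiv ℝ w z (bv i) := ae_all_iff.2 hg
  have e : ∀ᵐ z ∂(volume.restrict Ω), ‖fderiv ℝ w z‖ ^ 2 + w z ^ 2 = (∑ i, u (some i) z ^ 2) + u none z ^ 2 := by
    rw [ae_restrict_iff' hΩ.measurableSet]
    filter_upwards [hall, hwu] with z h1 h2 hz
    rw [dual_norm_sq, h2]
    congr 1
    exact Finset.sum_congr rfl fun i _ => by rw [h1 i hz]
  rw [integral_congr_ae e]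
  have i1 : IntegrableOn (fun z => ∑ i, u (some i) z ^ 2) Ω :=
    (integrable_finsetSum _ fun i _ => (L2_sq (u (some i))).1).integrableOn
  have i2 : IntegrableOn (fun z => u none z ^ 2) Ω := (L2_sq (u none)).1.integrableOn
  rw [integral_add i1 i2, integral_finsetSum _ (fun i _ => (L2_sq (u (some i))).1.integrableOn)]
  have h0 : 0 ≤ ∫ z in Ω, u none z ^ 2 := integral_nonneg fun z => sq_nonneg _
  have : Gr2 u = ∑ i, ∫ z in Ω, u (some i) z ^ 2 := by
    unfold Gr2
    refine Finset.sum_congr rfl fun i _ => ?_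
    rw [(L2_sq (u (some i))).2]
    refine (setIntegral_eq_integral_of_ae_compl_eq_zero ?_).symm
    filter_upwards [grad_supp hu i] with z hz hzΩ
    rw [hz hzΩ]; norm_num
  linarith

theorem anti_pt (hn : n = 2 ∨ n = 3) {Ω : Set (Euc n)} (hΩ : RadialDomain Ω) {θ : ℝ} {u : XX n} (hu : u ∈ HH Ω θ) {w : Euc n → ℝ}
    (hw : ContinuousOn w Ω) (hwu : w =ᵐ[volume] u none) : ∀ x ∈ Ω, w (rotPt θ x) = - w x := by
  have hrc : Continuous (fun x : Euc n => rotPt θ x) := by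
    have hq : Continuous (fun x : Euc n => ((θ, x) : ℝ × Euc n)) := by fun_prop
    have := (rotPt_continuous (n := n)).comp hq
    exact this
  have hm : Set.MapsTo (fun x : Euc n => rotPt θ x) Ω Ω := fun x hx => radial_rot hn hΩ θ x hx
  have hc : ContinuousOn (fun x => w (rotPt θ x)) Ω :=
    ContinuousOn.comp (g := w) (f := fun x : Euc n => rotPt θ x) (t := Ω) hw hrc.continuousOn hm
  have h0 : ∀ᵐ z : Euc n, w z = u none z := hwu
  have h1 : ∀ᵐ z : Euc n, w (rotPt θ z) = u none (rotPt θ z) :=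
    (rotPt_mp hn θ).quasiMeasurePreserving.ae h0
  have hc2 : ContinuousOn (fun x => |w (rotPt θ x) + w x|) Ω :=
    continuous_abs.comp_continuousOn (ContinuousOn.add hc hw)
  have h3 : ∀ᵐ z : Euc n, u none (rotPt θ z) = - u none z := HH_anti hn hu
  have hae : ∀ᵐ z : Euc n, z ∈ Ω → |w (rotPt θ z) + w z| ≤ 0 := by
    filter_upwards [h0, h1, h3] with z b a c _
    rw [a, b, c]; simp
  have := cont_ae (radial_open hΩ) (a := fun x => |w (rotPt θ x) + w x|) hc2 hae
  intro x hx
  have h2 := abs_nonpos_iff.1 (this x hx)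
  linarith

theorem one_sol (hn : n = 2 ∨ n = 3) {Ω : Set (Euc n)} (hΩ : RadialDomain Ω) (N : ℕ)
    (lam mu : ℕ → ℝ) (beta : ℕ → ℕ → ℝ) (hlam : ∀ j ∈ Finset.Icc 1 N, 0 < lam j)
    (hmu : ∀ j ∈ Finset.Icc 1 N, 0 < mu j)
    (hb : ∀ i ∈ Finset.Icc 1 N, ∀ j ∈ Finset.Icc 1 N, i ≠ j → beta i j = beta j i ∧ beta i j ≤ 0) :
    ∃ C : ℝ, 0 < C ∧ ∀ K : ℕ, 1 ≤ K → ∃ w : ℕ → Euc n → ℝ, IsClassicalSolution Ω N lam mu beta w ∧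
      ∀ j ∈ Finset.Icc 1 N, (∀ x ∈ Ω, w j (rotPt (π / K) x) = - w j x) ∧ (∃ x ∈ Ω, w j x ≠ 0) ∧
        (K : ℝ) ≤ C * H1norm2 Ω (w j) := by
  obtain ⟨C, hC, hs⟩ := weak_sol hn hΩ N lam mu beta hlam hmu hb
  refine ⟨C, hC, fun K hK => ?_⟩
  obtain ⟨u, f, huf⟩ := hs K hK
  have hop := radial_open hΩ
  have hWS : WS Ω (π / K) N lam mu beta u f := fun j hj =>
    ⟨(huf j hj).1, (huf j hj).2.2.2.1, (huf j hj).2.2.2.2⟩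
  obtain ⟨w, hw⟩ := reg_global hn hop hWS
  have hcont : ∀ j ∈ Icc 1 N, ContinuousOn (w j) Ω := fun j hj x hx =>
    ((hw j hj).1 x hx).continuousAt.continuousWithinAt
  refine ⟨w, fun j hj => ?_, fun j hj => ?_⟩
  · obtain ⟨w1, w2, w3, w4, w5⟩ := hw j hj
    obtain ⟨b1, b2⟩ := boundary hn hΩ hWS hj (hcont j hj) w2 w3
    refine ⟨fun x hx => (w1 x hx).contDiffWithinAt, b1, b2, fun x hx => ?_⟩
    have := w4 x hx
    unfold NL at this
    linarith
  · obtain ⟨w1, w2, w3, w4, w5⟩ := hw j hj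
    obtain ⟨u1, u2, u3, u4, u5⟩ := huf j hj
    refine ⟨anti_pt hn hΩ u1 (hcont j hj) w3, ?_, ?_⟩
    · by_contra hne
      push Not at hne
      apply u2
      apply HH_eq_zero u1
      apply Lp.ext
      filter_upwards [w3, Lp.coeFn_zero ℝ 2 (volume : Measure (Euc n))] with z h1 h2
      rw [← h1, h2, Pi.zero_apply]
      by_cases hz : z ∈ Ω
      · exact hne z hz
      · exact w2 z hz
    · exact u3.trans (mul_le_mul_of_nonneg_left (H1_ge hop u1 w3 w5) hC.le)

theorem anti_iter (hn : n = 2 ∨ n = 3) {Ω : Set (Euc n)} (hΩ : RadialDomain Ω) {θ : ℝ} {w : Euc n → ℝ}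
    (h : ∀ x ∈ Ω, w (rotPt θ x) = - w x) (m : ℕ) : ∀ x ∈ Ω, w (rotPt (m * θ) x) = (-1) ^ m * w x := by
  induction m with
  | zero => intro x hx; simp [rotPt_zero hn]
  | succ m ih =>
    intro x hx
    have e : ((m + 1 : ℕ) : ℝ) * θ = θ + m * θ := by push_cast; ring
    rw [e, ← rotPt_rotPt hn, h _ (radial_rot hn hΩ _ x hx), ih x hx]
    ring

theorem anti_iter_neg (hn : n = 2 ∨ n = 3) {Ω : Set (Euc n)} (hΩ : RadialDomain Ω) {θ : ℝ} {w : Euc n → ℝ}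
    (h : ∀ x ∈ Ω, w (rotPt θ x) = - w x) (m : ℕ) : ∀ x ∈ Ω, w x = (-1) ^ m * w (rotPt (-(m * θ)) x) := by
  intro x hx
  have := anti_iter hn hΩ h m _ (radial_rot hn hΩ (-(m * θ)) x hx)
  rw [rotPt_rotPt hn, add_neg_cancel, rotPt_zero hn] at this
  exact this

end Op24

/-- Theorem 1.4 of the paper. Fix an integer `k ≥ 1` and assume (A)-(D).
Then the system (S) admits an unbounded sequence of classical solutions with all components
nodal, each component being `𝓡_{2π/k}`-invariant but not `𝓡_{2π/(2k)}`-invariant, in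
particular non-radial. -/
theorem multiple_nonradial_nodal_solutions
    {n : ℕ} (hn : n = 2 ∨ n = 3) (Ω : Set (Euc n)) (hΩ : RadialDomain Ω)
    (N p B : ℕ) (lam mu : ℕ → ℝ) (beta : ℕ → ℕ → ℝ)
    (hassump : SysAssump N p B lam mu beta)
    (k : ℕ) (hk : 1 ≤ k) :
    ∃ u : ℕ → ℕ → Euc n → ℝ,
      (∀ l, IsClassicalSolution Ω N lam mu beta (u l)) ∧
      (∀ l, ∀ j ∈ Finset.Icc 1 N, (∃ x ∈ Ω, 0 < u l j x) ∧ (∃ x ∈ Ω, u l j x < 0)) ∧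
      (∀ C : ℝ, ∃ l, C < ∑ j ∈ Finset.Icc 1 N, H1norm2 Ω (u l j)) ∧
      (∀ l, ∀ i ∈ Finset.Icc 1 N,
        RotInv (2 * π / k) Ω (u l i) ∧ ¬ RotInv (2 * π / (2 * (k : ℝ))) Ω (u l i) ∧
        ¬ IsRadialFn Ω (u l i)) := by
  obtain ⟨hp, hN, hB, hA, hBeta, hmu, -, -⟩ := hassump
  have hp0 : 0 < p := hp.pos
  have hlam : ∀ j ∈ Finset.Icc 1 N, 0 < lam j := by
    intro j hj
    rw [Finset.mem_Icc] at hj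
    have hd := Nat.div_add_mod (j - 1) p
    have hm := Nat.mod_lt (j - 1) hp0
    have hbB : (j - 1) / p < B := by
      rw [Nat.div_lt_iff_lt_mul hp0, mul_comm, ← hN]; omega
    generalize (j - 1) / p = b at hd hbB
    have hmul : p * (b + 1) = p * b + p := by ring
    refine (hA (b + 1) ?_ j ?_).2
    · rw [Finset.mem_Icc]
      omega
    · rw [Finset.mem_Icc, hmul]
      generalize p * b = q at hd
      constructor <;> omega
  have hN1 : 1 ∈ Finset.Icc 1 N := by
    rw [Finset.mem_Icc, hN]
    exact ⟨le_rfl, Nat.mul_pos hp0 hB⟩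
  obtain ⟨C, hC, hs⟩ := one_sol hn hΩ N lam mu beta hlam hmu hBeta
  have hs' := fun l : ℕ => hs (k * (2 * l + 1)) (Nat.mul_pos hk (by omega))
  choose w hw1 hw2 using hs'
  have hk0 : (0:ℝ) < k := by exact_mod_cast hk
  refine ⟨w, hw1, fun l j hj => ?_, fun C' => ?_, fun l j hj => ?_⟩
  · obtain ⟨h1, ⟨x, hx, hne⟩, -⟩ := hw2 l j hj
    have hr := radial_rot hn hΩ (π / ((k * (2 * l + 1) : ℕ) : ℝ)) x hx
    have h2 := h1 x hx
    rcases lt_or_gt_of_ne hne with h | h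
    · exact ⟨⟨_, hr, by linarith⟩, ⟨x, hx, h⟩⟩
    · exact ⟨⟨x, hx, h⟩, ⟨_, hr, by linarith⟩⟩
  · obtain ⟨l, hl⟩ := exists_nat_gt (C * C')
    refine ⟨l, ?_⟩
    have h1 := (hw2 l 1 hN1).2.2
    have h2 : H1norm2 Ω (w l 1) ≤ ∑ j ∈ Finset.Icc 1 N, H1norm2 Ω (w l j) :=
      Finset.single_le_sum (f := fun j => H1norm2 Ω (w l j))
        (fun j _ => integral_nonneg fun x => by positivity) hN1
    refine lt_of_lt_of_le ?_ h2
    have h3 : (l : ℝ) ≤ ((k * (2 * l + 1) : ℕ) : ℝ) := by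
      norm_cast
      nlinarith
    by_contra hcon
    push Not at hcon
    have := mul_le_mul_of_nonneg_left hcon hC.le
    linarith
  · obtain ⟨h1, ⟨x, hx, hne⟩, -⟩ := hw2 l j hj
    have hl0 : (0:ℝ) < 2 * l + 1 := by positivity
    refine ⟨fun y hy => ?_, fun hri => ?_, fun hrad => ?_⟩
    · have := anti_iter_neg hn hΩ h1 (2 * (2 * l + 1)) y hy
      rw [pow_mul] at this
      have e : ((2 * (2 * l + 1) : ℕ) : ℝ) * (π / ((k * (2 * l + 1) : ℕ) : ℝ)) = 2 * π / k := by
        push_cast; field_simp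
      rw [e] at this
      rw [this]; simp
    · have := anti_iter_neg hn hΩ h1 (2 * l + 1) x hx
      have e : ((2 * l + 1 : ℕ) : ℝ) * (π / ((k * (2 * l + 1) : ℕ) : ℝ)) = 2 * π / (2 * (k : ℝ)) := by
        push_cast; field_simp
      rw [e, hri x hx, pow_succ, pow_mul] at this
      simp at this
      exact hne (by linarith)
    · have h2 := h1 x hx
      have h3 := hrad _ (radial_rot hn hΩ (π / ((k * (2 * l + 1) : ℕ) : ℝ)) x hx) x hx (rotPt_norm hn _ x)
      exact hne (by linarith)


end
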